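/- arXiv:1810.00227 — 3 statements merged into one kernel-verified Lean document; each statement's English description precedes it below -/
import Mathlib

section
/- Let $p$ be a prime with $p \equiv 3 \pmod{8}$. Then $N(p, S_4) = \frac{1}{2}\left\lfloor \frac{p-1}{4} \right\rfloor$, i.e. $2\,N(p, S_4) = \left\lfloor \frac{p-1}{4} \right\rfloor$. -/
/-- `a` is a quadratic residue modulo `p`: the congruence `x^2 ≡ a (mod p)` has a solution in `ℤ`. -/
def IsQR (p a : ℕ) : Prop := ∃ x : ℤ, x ^ 2 ≡ (a : ℤ) [ZMOD (p : ℤ)]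

open Classical in
/-- `Q(p, S_k)`: the number of quadratic residues modulo `p` in `[1, p-1]` that are multiples of `k`. -/
noncomputable def Qcount (p k : ℕ) : ℕ :=
  ((Finset.Icc 1 (p - 1)).filter fun a => k ∣ a ∧ IsQR p a).card

open Classical in
/-- `N(p, S_k)`: the number of quadratic non-residues modulo `p` in `[1, p-1]` that are multiples of `k`. -/
noncomputable def Ncount (p k : ℕ) : ℕ :=
  ((Finset.Icc 1 (p - 1)).filter fun a => k ∣ a ∧ ¬ IsQR p a).card

open Classical in
/-- `Q(p, 𝒪)`: the number of quadratic residues modulo `p` among the odd integers in `[1, p-1]`. -/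
noncomputable def QcountOdd (p : ℕ) : ℕ :=
  ((Finset.Icc 1 (p - 1)).filter fun a => Odd a ∧ IsQR p a).card

open Classical in
/-- `Q(p, S_2 \ S_4)`: the number of quadratic residues modulo `p` in `[1, p-1]`
divisible by `2` but not by `4`. -/
noncomputable def Qcount2not4 (p : ℕ) : ℕ :=
  ((Finset.Icc 1 (p - 1)).filter fun a => (2 ∣ a ∧ ¬ (4 ∣ a)) ∧ IsQR p a).card

theorem isQR_iff_isSquare (p a : ℕ) : IsQR p a ↔ IsSquare (a : ZMod p) := by
  constructor
  · rintro ⟨x, hx⟩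
    have h := (ZMod.intCast_eq_intCast_iff _ _ p).2 hx
    push_cast at h
    exact ⟨x, by rw [← h, sq]⟩
  · rintro ⟨y, hy⟩
    obtain ⟨x, rfl⟩ := ZMod.intCast_surjective y
    refine ⟨x, (ZMod.intCast_eq_intCast_iff _ _ p).1 ?_⟩
    push_cast
    rw [hy, sq]

theorem sum_range_two_mul_eq_even_add_odd (f : ℕ → ℤ) (n : ℕ) :
    ∑ i ∈ Finset.range (2 * n), f i =
      ∑ i ∈ Finset.range n, f (2 * i) + ∑ i ∈ Finset.range n, f (2 * i + 1) := by
  induction n with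
  | zero => simp
  | succ n ih =>
    rw [show 2 * (n + 1) = 2 * n + 1 + 1 by ring]
    simp only [Finset.sum_range_succ, ih]
    ring

/-- For a prime `p = 8k + 3`, the Legendre symbol sums to zero over `0 ≤ i < p / 4`. -/
theorem sum_legendreSym_range_quarter (p k : ℕ) [Fact p.Prime] (hk : p = 8 * k + 3) :
    ∑ i ∈ Finset.range (2 * k + 1), legendreSym p (i : ℤ) = 0 := by
  have hp2 : p ≠ 2 := by omega
  have h2 : legendreSym p 2 = -1 := by
    refine (legendreSym.eq_neg_one_iff p).2 ?_
    have := ZMod.exists_sq_eq_two_iff hp2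
    push_cast
    rw [this]
    omega
  have hneg2 : legendreSym p (-2) = 1 := by
    rw [legendreSym.at_neg hp2, h2, ZMod.χ₄_nat_three_mod_four (by omega)]
    norm_num
  have hsplit := sum_range_two_mul_eq_even_add_odd (fun i => legendreSym p (i : ℤ)) (2 * k + 1)
  rw [two_mul, Finset.sum_range_add] at hsplit
  have heven : ∑ i ∈ Finset.range (2 * k + 1), legendreSym p ((2 * i : ℕ) : ℤ) =
      -∑ i ∈ Finset.range (2 * k + 1), legendreSym p (i : ℤ) := by
    rw [← Finset.sum_neg_distrib]
    refine Finset.sum_congr rfl fun i _ => ?_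
    push_cast
    rw [legendreSym.mul, h2, neg_one_mul]
  have hodd : ∑ i ∈ Finset.range (2 * k + 1), legendreSym p ((2 * i + 1 : ℕ) : ℤ) =
      ∑ i ∈ Finset.range (2 * k + 1), legendreSym p ((2 * k + 1 + i : ℕ) : ℤ) := by
    rw [← Finset.sum_range_reflect (fun i => legendreSym p ((2 * k + 1 + i : ℕ) : ℤ))]
    refine Finset.sum_congr rfl fun i hi => ?_
    have hi' := Finset.mem_range.1 hi
    rw [← one_mul (legendreSym p ((2 * k + 1 + (2 * k + 1 - 1 - i) : ℕ) : ℤ)), ← hneg2,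
      ← legendreSym.mul, legendreSym.mod p ((2 * i + 1 : ℕ) : ℤ),
      legendreSym.mod p (-2 * _)]
    congr 1
    refine Int.ModEq.symm ((Int.modEq_iff_dvd).2 ⟨1, ?_⟩)
    omega
  linarith

theorem ncount_four_eq_card (p k : ℕ) [Fact p.Prime] (hk : p = 8 * k + 3) :
    Ncount p 4 =
      ((Finset.range (2 * k)).filter fun i => legendreSym p ((i + 1 : ℕ) : ℤ) = -1).card := by
  classical
  have key (a : ℕ) : ¬ IsQR p (4 * a) ↔ legendreSym p (a : ℤ) = -1 := by
    have h2 : ((2 : ℤ) : ZMod p) ≠ 0 := by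
      intro h0
      have := Int.le_of_dvd (by norm_num) ((ZMod.intCast_zmod_eq_zero_iff_dvd 2 p).1 h0)
      omega
    rw [isQR_iff_isSquare, ← legendreSym.eq_neg_one_iff' p]
    push_cast
    rw [legendreSym.mul, show (4 : ℤ) = 2 ^ 2 by norm_num, legendreSym.sq_one' p h2, one_mul]
  symm
  unfold Ncount
  refine Finset.card_bij (fun i _ => 4 * (i + 1)) ?_ ?_ ?_
  · intro i hi
    simp only [Finset.mem_filter, Finset.mem_range] at hi
    simp only [Finset.mem_filter, Finset.mem_Icc]
    exact ⟨by omega, dvd_mul_right _ _, (key _).2 hi.2⟩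
  · intro i _ j _ hij
    omega
  · intro b hb
    simp only [Finset.mem_filter, Finset.mem_Icc] at hb
    obtain ⟨hb1, ⟨c, rfl⟩, hb3⟩ := hb
    obtain ⟨d, rfl⟩ : ∃ d, c = d + 1 := ⟨c - 1, by omega⟩
    refine ⟨d, ?_, rfl⟩
    simp only [Finset.mem_filter, Finset.mem_range]
    exact ⟨by omega, (key _).1 hb3⟩

theorem stmt11 (p : ℕ) (hp : p.Prime) (h : p % 8 = 3) :
    2 * Ncount p 4 = (p - 1) / 4 := by
  have : Fact p.Prime := ⟨hp⟩
  obtain ⟨k, hk⟩ : ∃ k, p = 8 * k + 3 := ⟨p / 8, by omega⟩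
  have hsum := sum_legendreSym_range_quarter p k hk
  rw [Finset.sum_range_succ'] at hsum
  have hterm : ∀ i ∈ Finset.range (2 * k), legendreSym p ((i + 1 : ℕ) : ℤ) =
      1 - 2 * (if legendreSym p ((i + 1 : ℕ) : ℤ) = -1 then 1 else 0) := by
    intro i hi
    have hi' := Finset.mem_range.1 hi
    have h0 : (((i + 1 : ℕ) : ℤ) : ZMod p) ≠ 0 := by
      intro h0
      have := Int.le_of_dvd (by omega) ((ZMod.intCast_zmod_eq_zero_iff_dvd _ p).1 h0)
      omega
    rcases legendreSym.eq_one_or_neg_one p h0 with h1 | h1 <;> rw [h1] <;> norm_num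
  rw [Finset.sum_congr rfl hterm, Finset.sum_sub_distrib, ← Finset.mul_sum, Finset.sum_boole,
    ← ncount_four_eq_card p k hk] at hsum
  simp at hsum
  omega
end

section
/- For every real $\epsilon$ with $0 < \epsilon < 1/2$ there exists a constant $C = C(\epsilon) > 0$ such that for every prime $p$ with $p \equiv 1 \pmod{4}$ one has $\frac{p-1}{8} - N(p, S_4) \ge C\, p^{\frac{1}{2} - \epsilon}$ (as real numbers). -/
section

open Filter Topology Finset
open scoped ComplexOrder

/-- A completely multiplicative function with values in `{-1, 0, 1}` whose partial sums are bounded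
by `q`. -/
structure IsRealChar (f : ℕ → ℝ) (q : ℝ) : Prop where
  map_zero : f 0 = 0
  map_one : f 1 = 1
  map_mul : ∀ m n, f (m * n) = f m * f n
  values : ∀ n, f n = 0 ∨ f n = 1 ∨ f n = -1
  sum_le : ∀ n, |∑ k ∈ range n, f k| ≤ q

namespace IsRealChar

variable {f g : ℕ → ℝ} {q : ℝ}

lemma abs_le_one (hf : IsRealChar f q) (n : ℕ) : |f n| ≤ 1 := by
  rcases hf.values n with h | h | h <;> simp [h]

lemma one_le (hf : IsRealChar f q) : 1 ≤ q := by
  have := hf.sum_le 2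
  simpa [sum_range_succ, hf.map_zero, hf.map_one] using this

lemma abs_sum_le (hf : IsRealChar f q) (n : ℕ) : |∑ k ∈ range (n + 1), f k| ≤ n := by
  rw [sum_range_succ', hf.map_zero, add_zero]
  refine (abs_sum_le_sum_abs _ _).trans ?_
  calc _ ≤ ∑ _k ∈ range n, (1 : ℝ) := sum_le_sum fun i _ ↦ hf.abs_le_one _
    _ = n := by simp

lemma abs_sum_le_rpow (hf : IsRealChar f q) {δ : ℝ} (h0 : 0 ≤ δ) (h1 : δ ≤ 1) (n : ℕ) :
    |∑ k ∈ range (n + 1), f k| ≤ q ^ δ * (n : ℝ) ^ (1 - δ) := by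
  set A := |∑ k ∈ range (n + 1), f k|
  have hA : 0 ≤ A := abs_nonneg _
  calc A = A ^ δ * A ^ (1 - δ) := by
        rw [← Real.rpow_add_of_nonneg hA h0 (by linarith)]; simp
    _ ≤ _ := mul_le_mul (Real.rpow_le_rpow hA (hf.sum_le _) h0)
        (Real.rpow_le_rpow hA (hf.abs_sum_le n) (by linarith)) (by positivity)
        (Real.rpow_nonneg (zero_le_one.trans hf.one_le) _)

end IsRealChar

lemma norm_cpow_neg_sub_le {x : ℝ} (hx : 0 < x) {s : ℂ} (hs : 0 < s.re) :
    ‖((x : ℂ)) ^ (-s) - ((x + 1 : ℝ) : ℂ) ^ (-s)‖ ≤ ‖s‖ * x ^ (-s.re - 1) := by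
  have hs0 : -s ≠ 0 := by
    intro h; rw [neg_eq_zero] at h; simp [h] at hs
  have := Convex.norm_image_sub_le_of_norm_hasDerivWithin_le (𝕜 := ℝ) (s := Set.Icc x (x + 1))
    (f := fun y : ℝ ↦ (y : ℂ) ^ (-s)) (f' := fun y : ℝ ↦ -s * (y : ℂ) ^ (-s - 1))
    (C := ‖s‖ * x ^ (-s.re - 1)) (x := x + 1) (y := x)
    (fun y hy ↦ (hasDerivAt_ofReal_cpow_const' (hx.trans_le hy.1).ne' (r := -s - 1)
      (by simpa using fun h ↦ hs0 (by simpa using h)) |>.const_mul (-s) |>.congr_of_eventuallyEq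
        (Eventually.of_forall fun z ↦ by
          have hs1 : s ≠ 0 := neg_ne_zero.1 hs0
          simp; field_simp)).hasDerivWithinAt)
    (fun y hy ↦ by
      have hy0 := hx.trans_le hy.1
      rw [norm_mul, norm_neg, Complex.norm_cpow_eq_rpow_re_of_pos hy0]
      gcongr ?_ * ?_
      simp only [Complex.sub_re, Complex.neg_re, Complex.one_re]
      exact Real.rpow_le_rpow_of_nonpos hx hy.1 (by linarith))
    (convex_Icc _ _) (by simp) (by simp)
  simpa using this

/-- The term of the series obtained from `∑ f n / n ^ s` by summation by parts. -/
noncomputable def abelTerm (f : ℕ → ℝ) (s : ℂ) (n : ℕ) : ℂ :=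
  ((∑ k ∈ range (n + 2), f k : ℝ) : ℂ) *
    (((n + 1 : ℝ) : ℂ) ^ (-s) - ((n + 1 + 1 : ℝ) : ℂ) ^ (-s))

/-- The continuation of the Dirichlet series of `f` to `0 < re s`, for `f` with bounded partial
sums. -/
noncomputable def abelL (f : ℕ → ℝ) (s : ℂ) : ℂ := ∑' n, abelTerm f s n

lemma summable_nat_add_one_rpow {a : ℝ} (ha : 1 < a) :
    Summable fun n : ℕ ↦ ((n : ℝ) + 1) ^ (-a) := by
  have := (summable_nat_add_iff 1).2 (Real.summable_nat_rpow (p := -a) |>.2 (by linarith))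
  simpa using this

namespace IsRealChar

variable {f g : ℕ → ℝ} {q : ℝ}

lemma norm_abelTerm_le (hf : IsRealChar f q) {δ : ℝ} (h0 : 0 ≤ δ) (h1 : δ ≤ 1) {s : ℂ}
    (hs : 0 < s.re) (n : ℕ) :
    ‖abelTerm f s n‖ ≤ ‖s‖ * q ^ δ * ((n : ℝ) + 1) ^ (-(s.re + δ)) := by
  have hn : (0 : ℝ) < n + 1 := by positivity
  have e1 := hf.abs_sum_le_rpow h0 h1 (n + 1)
  have e2 := norm_cpow_neg_sub_le hn hs
  rw [abelTerm, norm_mul, Complex.norm_real, Real.norm_eq_abs]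
  refine (mul_le_mul e1 e2 (norm_nonneg _) ((abs_nonneg _).trans e1)).trans (le_of_eq ?_)
  have : -(s.re + δ) = (1 - δ) + (-s.re - 1) := by ring
  rw [this, Real.rpow_add hn]
  push_cast
  ring

lemma summable_abelTerm (hf : IsRealChar f q) {s : ℂ} (hs : 0 < s.re) :
    Summable (abelTerm f s) :=
  .of_norm_bounded ((summable_nat_add_one_rpow (a := s.re + 1) (by linarith)).mul_left _)
    (hf.norm_abelTerm_le zero_le_one le_rfl hs)

lemma norm_abelL_le (hf : IsRealChar f q) {δ : ℝ} (h0 : 0 ≤ δ) (h1 : δ ≤ 1) {s : ℂ}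
    (hs : 0 < s.re) (hsδ : 1 < s.re + δ) :
    ‖abelL f s‖ ≤ ‖s‖ * q ^ δ * ∑' n : ℕ, ((n : ℝ) + 1) ^ (-(s.re + δ)) := by
  rw [← tsum_mul_left]
  exact tsum_of_norm_bounded ((summable_nat_add_one_rpow hsδ).mul_left _).hasSum
    (hf.norm_abelTerm_le h0 h1 hs)

lemma differentiableOn_abelL (hf : IsRealChar f q) :
    DifferentiableOn ℂ (abelL f) {s | 0 < s.re} := by
  intro s hs
  have hs : 0 < s.re := hs
  set U : Set ℂ := {z | s.re / 2 < z.re} ∩ Metric.ball 0 (‖s‖ + 1)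
  have hU : IsOpen U := (isOpen_lt continuous_const Complex.continuous_re).inter Metric.isOpen_ball
  have hsU : s ∈ U := ⟨by simp; linarith, by simp⟩
  refine (DifferentiableOn.differentiableAt (s := U) ?_ (hU.mem_nhds hsU)).differentiableWithinAt
  refine Complex.differentiableOn_tsum_of_summable_norm
    (u := fun n : ℕ ↦ (‖s‖ + 1) * q ^ (1 : ℝ) * ((n : ℝ) + 1) ^ (-(s.re / 2 + 1)))
    ((summable_nat_add_one_rpow (by linarith)).mul_left _) (fun n ↦ ?_) hU fun n z hz ↦ ?_
  · intro z _
    have h1 : (((n : ℝ) + 1 : ℝ) : ℂ) ≠ 0 := by norm_cast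
    have h2 : (((n : ℝ) + 1 + 1 : ℝ) : ℂ) ≠ 0 := by norm_cast
    exact ((((differentiableAt_id.neg.const_cpow (Or.inl h1)).sub
      (differentiableAt_id.neg.const_cpow (Or.inl h2))).const_mul _)).differentiableWithinAt
  · have hz1 : s.re / 2 < z.re := hz.1
    have hz2 : ‖z‖ < ‖s‖ + 1 := by simpa using hz.2
    refine (hf.norm_abelTerm_le zero_le_one le_rfl (by linarith) n).trans ?_
    have := hf.one_le
    gcongr
    simp

lemma abelL_ofReal (f : ℕ → ℝ) (x : ℝ) : ((abelL f x).re : ℂ) = abelL f x := by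
  have h (n : ℕ) : abelTerm f x n = (((∑ k ∈ range (n + 2), f k) *
      (((n : ℝ) + 1) ^ (-x) - ((n : ℝ) + 1 + 1) ^ (-x)) : ℝ) : ℂ) := by
    rw [abelTerm, Complex.ofReal_mul, Complex.ofReal_sub, Complex.ofReal_cpow (by positivity),
      Complex.ofReal_cpow (by positivity), Complex.ofReal_neg]
  simp only [abelL, h, ← Complex.ofReal_tsum, Complex.ofReal_re]

lemma sum_div_cpow_eq (f : ℕ → ℝ) (hf0 : f 0 = 0) (s : ℂ) (n : ℕ) :
    ∑ k ∈ range n, (f (k + 1) : ℂ) * ((k + 1 : ℝ) : ℂ) ^ (-s) =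
      ∑ k ∈ range n, abelTerm f s k +
        ((∑ k ∈ range (n + 1), f k : ℝ) : ℂ) * ((n + 1 : ℝ) : ℂ) ^ (-s) := by
  induction n with
  | zero => simp [hf0]
  | succ n ih =>
    rw [sum_range_succ, ih, sum_range_succ (abelTerm f s), abelTerm, sum_range_succ f (n + 1)]
    push_cast
    ring

lemma tendsto_sum (hf : IsRealChar f q) {s : ℂ} (hs : 0 < s.re) :
    Tendsto (fun n ↦ ∑ k ∈ range n, (f (k + 1) : ℂ) * ((k + 1 : ℝ) : ℂ) ^ (-s)) atTop
      (𝓝 (abelL f s)) := by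
  have h1 := (hf.summable_abelTerm hs).hasSum.tendsto_sum_nat
  have h2 : Tendsto (fun n : ℕ ↦ ((∑ k ∈ range (n + 1), f k : ℝ) : ℂ) * ((n + 1 : ℝ) : ℂ) ^ (-s))
      atTop (𝓝 0) := by
    have h3 : Tendsto (fun n : ℕ ↦ q * ((n : ℝ) + 1) ^ (-s.re)) atTop (𝓝 0) := by
      have : Tendsto (fun n : ℕ ↦ (n : ℝ) + 1) atTop atTop :=
        tendsto_atTop_add_const_right _ _ tendsto_natCast_atTop_atTop
      simpa using ((tendsto_rpow_neg_atTop hs).comp this).const_mul q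
    refine squeeze_zero_norm (fun n ↦ ?_) h3
    rw [norm_mul, Complex.norm_real, Complex.norm_cpow_eq_rpow_re_of_pos (by positivity)]
    exact mul_le_mul_of_nonneg_right (hf.sum_le _) (by positivity)
  simpa only [sum_div_cpow_eq f hf.map_zero s, abelL, add_zero] using h1.add h2

lemma lseriesSummable (hf : IsRealChar f q) {s : ℂ} (hs : 1 < s.re) :
    LSeriesSummable (fun n ↦ (f n : ℂ)) s :=
  LSeriesSummable_of_bounded_of_one_lt_re (m := 1)
    (fun n _ ↦ by simpa using hf.abs_le_one n) hs

lemma abelL_eq_LSeries (hf : IsRealChar f q) {s : ℂ} (hs : 1 < s.re) :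
    abelL f s = LSeries (fun n ↦ (f n : ℂ)) s := by
  have h1 := (hf.lseriesSummable hs).hasSum.tendsto_sum_nat
  have h2 := h1.comp (tendsto_add_atTop_nat 1)
  refine tendsto_nhds_unique (hf.tendsto_sum (by linarith)) ?_
  rw [LSeries]
  refine h2.congr fun n ↦ ?_
  simp only [Function.comp, sum_range_succ', LSeries.term_zero, add_zero]
  refine sum_congr rfl fun k _ ↦ ?_
  rw [LSeries.term_of_ne_zero (by simp), Complex.cpow_neg, div_eq_mul_inv]
  push_cast
  rfl

end IsRealChar

section Estermann

variable {a : ℕ → ℂ} {H : ℂ → ℂ}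

lemma abscissa_lt_two (hs : ∀ s : ℂ, 1 < s.re → LSeriesSummable a s) :
    LSeries.abscissaOfAbsConv a < 2 := by
  have := (hs ((3 / 2 : ℝ) : ℂ) (by norm_num)).abscissaOfAbsConv_le
  refine this.trans_lt ?_
  rw [Complex.ofReal_re]
  exact EReal.coe_lt_coe_iff.2 (by norm_num : (3 / 2 : ℝ) < 2)

lemma iteratedDeriv_inv_sub_one (m : ℕ) :
    iteratedDeriv m (fun s : ℂ ↦ (s - 1)⁻¹) 2 = (-1) ^ m * m.factorial := by
  rw [iteratedDeriv_comp_sub_const (f := Inv.inv), iteratedDeriv_eq_iterate, iter_deriv_inv']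
  norm_num

lemma iteratedDeriv_dslope_eq (hs : ∀ s : ℂ, 1 < s.re → LSeriesSummable a s)
    (hHL : ∀ s : ℂ, 1 < s.re → H s = (s - 1) * LSeries a s) (m : ℕ) :
    iteratedDeriv m (dslope H 1) 2 =
      iteratedDeriv m (LSeries a) 2 - H 1 * ((-1) ^ m * m.factorial) := by
  have hU : {s : ℂ | 1 < s.re} ∈ 𝓝 (2 : ℂ) :=
    (isOpen_lt continuous_const Complex.continuous_re).mem_nhds (by simp)
  have h1 : dslope H 1 =ᶠ[𝓝 2] fun s ↦ LSeries a s - H 1 * (s - 1)⁻¹ := by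
    filter_upwards [hU] with s hs
    have h : s - 1 ≠ 0 := by
      intro h
      rw [sub_eq_zero.1 h] at hs
      simp at hs
    rw [dslope_of_ne _ (sub_ne_zero.1 h), slope_def_field, hHL s hs]
    field_simp
  have h2 : ContDiffAt ℂ m (LSeries a) 2 := by
    refine ((LSeries_analyticOnNhd a) 2 ?_).contDiffAt
    exact_mod_cast abscissa_lt_two hs
  have h3 : ContDiffAt ℂ m (fun s : ℂ ↦ (s - 1)⁻¹) 2 :=
    (contDiffAt_id.sub contDiffAt_const).inv (by norm_num)
  rw [h1.iteratedDeriv_eq, iteratedDeriv_fun_sub h2 (contDiffAt_const.mul h3),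
    iteratedDeriv_const_mul_field, iteratedDeriv_inv_sub_one]

/-- Estermann's inequality: a Dirichlet series with nonnegative coefficients and a simple pole
at `1` that continues to the left is bounded below in terms of its residue. -/
theorem estermann_le (ha : 0 ≤ a) (ha1 : a 1 = 1)
    (hs : ∀ s : ℂ, 1 < s.re → LSeriesSummable a s)
    (hH : DifferentiableOn ℂ H {s | 0 < s.re})
    (hHL : ∀ s : ℂ, 1 < s.re → H s = (s - 1) * LSeries a s) {M : ℝ}
    (hM : ∀ z ∈ Metric.sphere (2 : ℂ) (4 / 3), ‖H z‖ ≤ M) (hM1 : ‖H 1‖ ≤ M)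
    {x : ℝ} (hx : 1 < x) (hx' : x ≤ 9 / 8) {m : ℕ} (hm : m ≠ 0) :
    1 - (H 1).re * (x ^ m / (x - 1)) - 6 * M * ((27 / 32) ^ m * (32 / 5)) ≤
      (H (2 - x : ℝ) / (1 - x : ℝ)).re := by
  set G := dslope H 1 with hG
  have hGd : DifferentiableOn ℂ G {s | 0 < s.re} :=
    (Complex.differentiableOn_dslope ((isOpen_lt continuous_const
      Complex.continuous_re).mem_nhds (by simp))).2 hH
  have hball : Metric.closedBall (2 : ℂ) (4 / 3) ⊆ {s | 0 < s.re} := by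
    intro z hz
    have h1 : ‖z - 2‖ ≤ 4 / 3 := by simpa [dist_eq_norm] using hz
    have h2 := (abs_le.1 ((Complex.abs_re_le_norm (z - 2)).trans h1)).1
    simp only [Complex.sub_re, Complex.re_ofNat] at h2
    simp only [Set.mem_ofPred_eq]
    linarith
  have hGs : ∀ z ∈ Metric.sphere (2 : ℂ) (4 / 3), ‖G z‖ ≤ 6 * M := by
    intro z hz
    have hz1 : ‖z - 2‖ = 4 / 3 := by simpa [dist_eq_norm] using hz
    have hz2 : 1 / 3 ≤ ‖z - 1‖ := by
      have := norm_sub_norm_le (z - 2) (-1)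
      rw [hz1, norm_neg, norm_one, sub_neg_eq_add] at this
      have e : z - 2 + 1 = z - 1 := by ring
      rw [e] at this
      linarith
    have hz3 : z ≠ 1 := by
      rintro rfl
      norm_num at hz2
    rw [hG, dslope_of_ne _ hz3, slope_def_field, norm_div, div_le_iff₀ (by linarith)]
    have := norm_sub_le (H z) (H 1)
    have := hM z hz
    have : 0 ≤ M := (norm_nonneg _).trans hM1
    nlinarith
  set c : ℕ → ℂ := fun n ↦ (-1) ^ n * ((n.factorial : ℂ)⁻¹ * iteratedDeriv n G 2) with hc
  have hM0 : 0 ≤ M := (norm_nonneg _).trans hM1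
  have hcn (n : ℕ) : ‖c n‖ ≤ 6 * M * (3 / 4) ^ n := by
    have := Complex.norm_iteratedDeriv_le_of_forall_mem_sphere_norm_le n (by norm_num)
      (hGd.diffContOnCl_ball hball) hGs
    rw [hc]
    simp only [norm_mul, norm_pow, norm_neg, norm_one, one_pow, one_mul, norm_inv,
      Complex.norm_natCast]
    rw [inv_mul_le_iff₀ (by positivity)]
    refine this.trans (le_of_eq ?_)
    rw [div_eq_mul_inv, ← inv_pow]
    norm_num
    ring
  have hsum : HasSum (fun n ↦ c n * (x : ℂ) ^ n) (G (2 - x : ℝ)) := by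
    have := Complex.hasSum_taylorSeries_on_ball (f := G) (c := 2) (r := 4 / 3)
      (z := (2 - x : ℝ)) (hGd.mono (Metric.ball_subset_closedBall.trans hball)) (by
        rw [Metric.mem_ball, dist_eq_norm]
        have : (((2 - x : ℝ) : ℂ) - 2) = ((-x : ℝ) : ℂ) := by push_cast; ring
        rw [this, Complex.norm_real, Real.norm_eq_abs, abs_neg, abs_of_pos (by linarith)]
        linarith)
    refine this.congr_fun ?_
    intro n
    have : (((2 - x : ℝ) : ℂ) - 2) = -1 * x := by push_cast; ring
    rw [hc, this, mul_pow]
    simp only [smul_eq_mul]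
    ring
  have hcre (n : ℕ) : (c n).re = ((-1) ^ n * ((n.factorial : ℂ)⁻¹ *
      iteratedDeriv n (LSeries a) 2)).re - (H 1).re := by
    rw [hc, ← Complex.sub_re]
    simp only
    congr 1
    rw [iteratedDeriv_dslope_eq hs hHL]
    have h1 : ((-1 : ℂ) ^ n) * (-1) ^ n = 1 := by rw [← mul_pow]; norm_num
    have h2 : (n.factorial : ℂ) ≠ 0 := by exact_mod_cast n.factorial_ne_zero
    field_simp
    linear_combination (-(H 1) * n.factorial) * h1
  have hnn (n : ℕ) : 0 ≤ ((-1) ^ n * ((n.factorial : ℂ)⁻¹ *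
      iteratedDeriv n (LSeries a) 2)).re := by
    have h := LSeries.iteratedDeriv_alternating ha (x := 2)
      (by exact_mod_cast abscissa_lt_two hs) n
    have h' := (Complex.nonneg_iff.1 h).1
    have e : ((-1) ^ n * ((n.factorial : ℂ)⁻¹ * iteratedDeriv n (LSeries a) 2)) =
      (((n.factorial : ℝ)⁻¹ : ℝ) : ℂ) * ((-1) ^ n * iteratedDeriv n (LSeries a) (2 : ℝ)) := by
      push_cast; ring
    rw [e, Complex.re_ofReal_mul]
    positivity
  have hone : 1 ≤ ((-1) ^ 0 * (((Nat.factorial 0 : ℕ) : ℂ)⁻¹ *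
      iteratedDeriv 0 (LSeries a) 2)).re := by
    simp only [pow_zero, Nat.factorial_zero, Nat.cast_one, inv_one, one_mul, iteratedDeriv_zero]
    have hS := hs 2 (by norm_num)
    have hre : Summable fun n ↦ (LSeries.term a 2 n).re := (Complex.hasSum_re hS.hasSum).summable
    have e : (LSeries a 2).re = ∑' n, (LSeries.term a 2 n).re := Complex.re_tsum hS
    rw [e]
    have h1 : (LSeries.term a 2 1).re = 1 := by
      rw [LSeries.term_of_ne_zero one_ne_zero, ha1]; simp
    rw [← h1]
    refine hre.le_tsum 1 fun n _ ↦ ?_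
    rcases eq_or_ne n 0 with rfl | hn
    · simp
    · rw [LSeries.term_of_ne_zero hn]
      have e : ((n : ℂ) ^ (2 : ℂ)) = (((n : ℝ) ^ 2 : ℝ) : ℂ) := by
        rw [show (2 : ℂ) = ((2 : ℕ) : ℂ) by norm_num, Complex.cpow_natCast]; push_cast; rfl
      rw [e, Complex.div_ofReal_re]
      have := (Complex.nonneg_iff.1 (ha n)).1
      positivity
  have hrsum : HasSum (fun n ↦ (c n).re * x ^ n) (G (2 - x : ℝ)).re := by
    refine (Complex.hasSum_re hsum).congr_fun ?_
    intro n
    rw [← Complex.ofReal_pow, Complex.re_mul_ofReal]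
  have htail : -(6 * M * ((27 / 32) ^ m * (32 / 5))) ≤ ∑' n, (c (n + m)).re * x ^ (n + m) := by
    have hgeo : HasSum (fun n : ℕ ↦ 6 * M * ((27 / 32 : ℝ) ^ m * (27 / 32) ^ n))
        (6 * M * ((27 / 32) ^ m * (32 / 5))) := by
      have := hasSum_geometric_of_lt_one (r := (27 / 32 : ℝ)) (by norm_num) (by norm_num)
      norm_num at this
      exact (this.mul_left _).mul_left _
    have hb (n : ℕ) : ‖(c (n + m)).re * x ^ (n + m)‖ ≤
        6 * M * ((27 / 32 : ℝ) ^ m * (27 / 32) ^ n) := by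
      have hxn : x ^ (n + m) ≤ (9 / 8) ^ (n + m) := pow_le_pow_left₀ (by linarith) hx' _
      rw [norm_mul, Real.norm_eq_abs, Real.norm_eq_abs, abs_of_pos (a := x ^ (n + m))
        (by positivity)]
      calc _ ≤ (6 * M * (3 / 4) ^ (n + m)) * (9 / 8) ^ (n + m) :=
            mul_le_mul ((Complex.abs_re_le_norm _).trans (hcn _)) hxn (by positivity)
              (by positivity)
        _ = _ := by
            rw [mul_assoc, ← mul_pow, ← pow_add, add_comm m n]; norm_num
    have := tsum_of_norm_bounded hgeo hb
    exact (abs_le.1 this).1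
  have hhead : 1 - (H 1).re * ((x ^ m - 1) / (x - 1)) ≤
      ∑ n ∈ range m, (c n).re * x ^ n := by
    rw [← geom_sum_eq hx.ne', mul_sum]
    obtain ⟨m, rfl⟩ := Nat.exists_eq_succ_of_ne_zero hm
    simp only [Nat.succ_eq_add_one, sum_range_succ']
    have h0 : ∑ k ∈ range m, -((H 1).re * x ^ (k + 1)) ≤
        ∑ k ∈ range m, (c (k + 1)).re * x ^ (k + 1) := by
      refine sum_le_sum fun k _ ↦ ?_
      rw [hcre]
      have := mul_nonneg (hnn (k + 1)) (by positivity : 0 ≤ x ^ (k + 1))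
      linarith
    rw [sum_neg_distrib] at h0
    rw [hcre 0]
    simp
    simp at hone h0
    linarith
  have hsplit := hrsum.summable.sum_add_tsum_nat_add m
  rw [hrsum.tsum_eq] at hsplit
  have hfin : (H (2 - x : ℝ) / (1 - x : ℝ)).re = (G (2 - x : ℝ)).re - (H 1).re / (x - 1) := by
    have h1 : ((2 - x : ℝ) : ℂ) ≠ 1 := by
      norm_cast; intro h; linarith
    have h2 : ((1 - x : ℝ) : ℂ) ≠ 0 := by
      norm_cast; intro h; linarith
    have h3 : ((2 - x : ℝ) : ℂ) - 1 = ((1 - x : ℝ) : ℂ) := by push_cast; ring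
    rw [hG, dslope_of_ne _ h1, slope_def_field, h3, Complex.div_ofReal_re, Complex.div_ofReal_re,
      Complex.sub_re]
    have h4 : (1 - x) ≠ 0 := by intro h; linarith
    have h5 : (x - 1) ≠ 0 := by intro h; linarith
    field_simp
    ring
  rw [hfin]
  have h5 : (x - 1) ≠ 0 := by intro h; linarith
  have h6 : (H 1).re * (x ^ m / (x - 1)) =
      (H 1).re * ((x ^ m - 1) / (x - 1)) + (H 1).re / (x - 1) := by field_simp; ring
  rw [h6]
  linarith
end Estermann

section Convolution
open ArithmeticFunction

lemma ArithmeticFunction.mul_apply_prime_pow {R : Type*} [Semiring R] (F G : ArithmeticFunction R)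
    {p : ℕ} (hp : p.Prime) (k : ℕ) :
    (F * G) (p ^ k) = ∑ i ∈ range (k + 1), F (p ^ i) * G (p ^ (k - i)) := by
  rw [mul_apply, Nat.sum_divisorsAntidiagonal (f := fun i j ↦ F i * G j),
    Nat.sum_divisors_prime_pow hp]
  refine sum_congr rfl fun i hi ↦ ?_
  rw [Nat.pow_div (by simpa [Nat.lt_succ_iff] using hi) hp.pos]

/-- A real function as a complex arithmetic function. -/
noncomputable def toComplexAF (f : ℕ → ℝ) : ArithmeticFunction ℂ :=
  toArithmeticFunction fun n ↦ (f n : ℂ)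

lemma toComplexAF_apply {f : ℕ → ℝ} (h0 : f 0 = 0) (n : ℕ) : toComplexAF f n = f n := by
  rcases eq_or_ne n 0 with rfl | hn
  · simp [toComplexAF, h0]
  · simp [toComplexAF, toArithmeticFunction, hn]

/-- The coefficients of `ζ(s) L(s, f)`. -/
noncomputable def zetaConv (f : ℕ → ℝ) : ArithmeticFunction ℂ := zeta * toComplexAF f

/-- The coefficients of `ζ(s) L(s, f) L(s, g) L(s, f g)`. -/
noncomputable def biquadConv (f g : ℕ → ℝ) : ArithmeticFunction ℂ :=
  zetaConv f * (toComplexAF g * toComplexAF (f * g))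

lemma biquadConv_comm (f g : ℕ → ℝ) : biquadConv f g = biquadConv g f := by
  simp only [biquadConv, zetaConv, mul_comm g f]
  ring

namespace IsRealChar

variable {f g : ℕ → ℝ} {q r t : ℝ}

lemma map_pow (hf : IsRealChar f q) (p k : ℕ) : f (p ^ k) = f p ^ k := by
  induction k with
  | zero => simp [hf.map_one]
  | succ k ih => rw [pow_succ, hf.map_mul, ih, pow_succ]

lemma isMultiplicative (hf : IsRealChar f q) : (toComplexAF f).IsMultiplicative := by
  refine ⟨by simp [toComplexAF_apply hf.map_zero, hf.map_one], fun {m n} _ ↦ ?_⟩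
  simp [toComplexAF_apply hf.map_zero, hf.map_mul]

lemma zetaConv_mult (hf : IsRealChar f q) : (zetaConv f).IsMultiplicative :=
  isMultiplicative_zeta.natCast.mul hf.isMultiplicative

lemma zetaConv_prime_pow (hf : IsRealChar f q) {p : ℕ} (hp : p.Prime) (k : ℕ) :
    zetaConv f (p ^ k) = ((∑ i ∈ range (k + 1), f p ^ i : ℝ) : ℂ) := by
  rw [zetaConv, coe_zeta_mul_apply, Nat.sum_divisors_prime_pow hp]
  simp [toComplexAF_apply hf.map_zero, hf.map_pow]

lemma zetaConv_prime_pow_nonneg (hf : IsRealChar f q) {p : ℕ} (hp : p.Prime) (k : ℕ) :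
    0 ≤ zetaConv f (p ^ k) := by
  rw [hf.zetaConv_prime_pow hp, Complex.zero_le_real]
  rcases hf.values p with h | h | h
  · exact sum_nonneg fun i _ ↦ by rw [h]; positivity
  · exact sum_nonneg fun i _ ↦ by rw [h]; positivity
  · rw [h, neg_one_geom_sum]
    split_ifs
    exacts [le_rfl, zero_le_one]

lemma _root_.ArithmeticFunction.IsMultiplicative.nonneg_of_prime_pow {F : ArithmeticFunction ℂ}
    (hF : F.IsMultiplicative) (h : ∀ p : ℕ, p.Prime → ∀ k, 0 ≤ F (p ^ k)) (n : ℕ) : 0 ≤ F n := by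
  rcases eq_or_ne n 0 with rfl | hn
  · simp
  · rw [hF.multiplicative_factorization _ hn]
    exact Finset.prod_nonneg fun p hp ↦ h p (Nat.prime_of_mem_primeFactors hp) _

lemma zetaConv_nonneg (hf : IsRealChar f q) (n : ℕ) : 0 ≤ zetaConv f n :=
  hf.zetaConv_mult.nonneg_of_prime_pow (fun _ hp k ↦ hf.zetaConv_prime_pow_nonneg hp k) n

lemma biquadConv_prime_pow (hf : IsRealChar f q) (hg : IsRealChar g r) (hfg : IsRealChar (f * g) t)
    {p : ℕ} (hp : p.Prime) (k : ℕ) :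
    biquadConv f g (p ^ k) =
      ∑ i ∈ range (k + 1), zetaConv f (p ^ i) *
        ((g p : ℂ) ^ (k - i) * zetaConv f (p ^ (k - i))) := by
  rw [biquadConv, mul_apply_prime_pow _ _ hp]
  refine sum_congr rfl fun i _ ↦ ?_
  rw [mul_comm (toComplexAF g), mul_apply_prime_pow _ _ hp, hf.zetaConv_prime_pow hp (k - i)]
  congr 1
  push_cast
  rw [mul_sum]
  refine sum_congr rfl fun j hj ↦ ?_
  have hj : j ≤ k - i := by simpa [Nat.lt_succ_iff] using hj
  rw [toComplexAF_apply hg.map_zero, toComplexAF_apply hfg.map_zero, hfg.map_pow, hg.map_pow,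
    Pi.mul_apply]
  push_cast
  rw [mul_pow, mul_assoc, ← pow_add, Nat.add_sub_cancel' hj, mul_comm]

lemma biquadConv_prime_pow_nonneg (hf : IsRealChar f q) (hg : IsRealChar g r)
    (hfg : IsRealChar (f * g) t) {p : ℕ} (hp : p.Prime) (k : ℕ) :
    0 ≤ biquadConv f g (p ^ k) := by
  have key {f g : ℕ → ℝ} {q r t : ℝ} (hf : IsRealChar f q) (hg : IsRealChar g r)
      (hfg : IsRealChar (f * g) t) (h : 0 ≤ g p) : 0 ≤ biquadConv f g (p ^ k) := by
    rw [hf.biquadConv_prime_pow hg hfg hp]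
    refine sum_nonneg fun i _ ↦ mul_nonneg (hf.zetaConv_prime_pow_nonneg hp _)
      (mul_nonneg (pow_nonneg ?_ _) (hf.zetaConv_prime_pow_nonneg hp _))
    exact Complex.zero_le_real.2 h
  rcases le_or_gt 0 (g p) with h | h
  · exact key hf hg hfg h
  rcases le_or_gt 0 (f p) with h' | h'
  · rw [biquadConv_comm]
    exact key hg hf (mul_comm f g ▸ hfg) h'
  have hg1 : g p = -1 := by rcases hg.values p with e | e | e <;> simp_all; linarith
  have hf1 : f p = -1 := by rcases hf.values p with e | e | e <;> simp_all; linarith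
  rw [hf.biquadConv_prime_pow hg hfg hp]
  refine sum_nonneg fun i _ ↦ mul_nonneg (hf.zetaConv_prime_pow_nonneg hp _) ?_
  rw [hf.zetaConv_prime_pow hp, ← Complex.ofReal_pow, ← Complex.ofReal_mul, Complex.zero_le_real,
    hf1, hg1, neg_one_geom_sum]
  split_ifs with hpar
  · simp
  · have : Even (k - i) := by
      rw [Nat.even_add_one, not_not] at hpar
      exact hpar
    simp [this.neg_one_pow]

lemma biquadConv_nonneg (hf : IsRealChar f q) (hg : IsRealChar g r)
    (hfg : IsRealChar (f * g) t) (n : ℕ) : 0 ≤ biquadConv f g n :=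
  (hf.zetaConv_mult.mul (hg.isMultiplicative.mul hfg.isMultiplicative)).nonneg_of_prime_pow
    (fun _ hp k ↦ hf.biquadConv_prime_pow_nonneg hg hfg hp k) n

lemma toComplexAF_summable (hf : IsRealChar f q) {s : ℂ} (hs : 1 < s.re) :
    LSeriesSummable (toComplexAF f) s := by
  refine (LSeriesSummable_congr s fun {n} _ ↦ ?_).1 (hf.lseriesSummable hs)
  rw [toComplexAF_apply hf.map_zero]

lemma LSeries_toComplexAF (hf : IsRealChar f q) {s : ℂ} (hs : 1 < s.re) :
    LSeries (toComplexAF f) s = abelL f s := by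
  rw [hf.abelL_eq_LSeries hs]
  exact LSeries_congr (fun {n} _ ↦ toComplexAF_apply hf.map_zero n) s

lemma _root_.ArithmeticFunction.LSeriesSummable_coe_zeta {s : ℂ} (hs : 1 < s.re) :
    LSeriesSummable (fun n ↦ (zeta : ArithmeticFunction ℂ) n) s := by
  simpa only [natCoe_apply] using LSeriesSummable_zeta_iff.mpr hs

lemma zetaConv_summable (hf : IsRealChar f q) {s : ℂ} (hs : 1 < s.re) :
    LSeriesSummable (zetaConv f) s :=
  LSeriesSummable_mul (LSeriesSummable_coe_zeta hs) (hf.toComplexAF_summable hs)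

lemma LSeries_zetaConv (hf : IsRealChar f q) {s : ℂ} (hs : 1 < s.re) :
    LSeries (zetaConv f) s = riemannZeta s * abelL f s := by
  rw [zetaConv, LSeries_mul' (LSeriesSummable_coe_zeta hs) (hf.toComplexAF_summable hs),
    hf.LSeries_toComplexAF hs, ← LSeries_zeta_eq_riemannZeta hs]
  simp_rw [← natCoe_apply]

lemma biquadConv_summable (hf : IsRealChar f q) (hg : IsRealChar g r)
    (hfg : IsRealChar (f * g) t) {s : ℂ} (hs : 1 < s.re) :
    LSeriesSummable (biquadConv f g) s :=
  LSeriesSummable_mul (hf.zetaConv_summable hs)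
    (LSeriesSummable_mul (hg.toComplexAF_summable hs) (hfg.toComplexAF_summable hs))

lemma LSeries_biquadConv (hf : IsRealChar f q) (hg : IsRealChar g r)
    (hfg : IsRealChar (f * g) t) {s : ℂ} (hs : 1 < s.re) :
    LSeries (biquadConv f g) s =
      riemannZeta s * abelL f s * (abelL g s * abelL (f * g) s) := by
  have h1 := LSeriesSummable_mul (hg.toComplexAF_summable hs) (hfg.toComplexAF_summable hs)
  rw [biquadConv, LSeries_mul' (hf.zetaConv_summable hs) h1,
    LSeries_mul' (hg.toComplexAF_summable hs) (hfg.toComplexAF_summable hs),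
    hf.LSeries_zetaConv hs, hg.LSeries_toComplexAF hs, hfg.LSeries_toComplexAF hs]

lemma zetaConv_one (hf : IsRealChar f q) : zetaConv f 1 = 1 := hf.zetaConv_mult.map_one

lemma biquadConv_one (hf : IsRealChar f q) (hg : IsRealChar g r)
    (hfg : IsRealChar (f * g) t) : biquadConv f g 1 = 1 :=
  (hf.zetaConv_mult.mul (hg.isMultiplicative.mul hfg.isMultiplicative)).map_one

end IsRealChar
end Convolution

lemma exists_entire_eq_sub_one_mul_riemannZeta :
    ∃ Z : ℂ → ℂ, Differentiable ℂ Z ∧ Z 1 = 1 ∧ ∀ s, s ≠ 1 → Z s = (s - 1) * riemannZeta s := by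
  refine ⟨DirichletCharacter.LFunctionTrivChar₁ 1,
    DirichletCharacter.differentiable_LFunctionTrivChar₁ 1, ?_, fun s hs ↦ ?_⟩
  · simp [DirichletCharacter.LFunctionTrivChar₁]
  · simp [DirichletCharacter.LFunctionTrivChar₁, Function.update_of_ne hs,
      DirichletCharacter.LFunctionTrivChar, DirichletCharacter.LFunction_modOne_eq]

namespace IsRealChar

variable {f g : ℕ → ℝ} {q r : ℝ}

lemma continuousOn_re_abelL (hf : IsRealChar f q) :
    ContinuousOn (fun x : ℝ ↦ (abelL f x).re) (Set.Ioi 0) :=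
  Complex.continuous_re.comp_continuousOn
    (hf.differentiableOn_abelL.continuousOn.comp Complex.continuous_ofReal.continuousOn
      fun x hx ↦ by simpa using hx)

lemma re_abelL_pos_of_one_lt (hf : IsRealChar f q) {x : ℝ} (hx : 1 < x) :
    0 < (abelL f x).re := by
  have habs {a : ℕ → ℂ} (h : ∀ s : ℂ, 1 < s.re → LSeriesSummable a s) :
      LSeries.abscissaOfAbsConv a < (x : EReal) := by
    refine (LSeries.abscissaOfAbsConv_le_of_forall_lt_LSeriesSummable (x := 1) fun y hy ↦
      h y (by simpa using hy)).trans_lt ?_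
    exact_mod_cast hx
  have h1 := LSeries.positive (a := zetaConv f) (x := x) (fun n ↦ hf.zetaConv_nonneg n)
    (by rw [hf.zetaConv_one]; exact one_pos) (habs fun s hs ↦ hf.zetaConv_summable hs)
  have h2 := LSeries.positive (a := 1) (x := x) (fun n ↦ zero_le_one) one_pos
    (habs fun s hs ↦ LSeriesSummable_one_iff.2 hs)
  rw [hf.LSeries_zetaConv (by simpa using hx)] at h1
  rw [LSeries_one_eq_riemannZeta (by simpa using hx)] at h2
  rw [← abelL_ofReal] at h1
  obtain ⟨h2, h2'⟩ := Complex.pos_iff.1 h2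
  obtain ⟨h1, -⟩ := Complex.pos_iff.1 h1
  rw [Complex.mul_re, ← h2'] at h1
  simp only [Complex.ofReal_re, zero_mul, sub_zero] at h1
  exact (mul_pos_iff_of_pos_left h2).1 h1

lemma re_abelL_one_nonneg (hf : IsRealChar f q) : 0 ≤ (abelL f 1).re := by
  have h : ContinuousAt (fun x : ℝ ↦ (abelL f x).re) 1 :=
    hf.continuousOn_re_abelL.continuousAt (Ioi_mem_nhds one_pos)
  have h' : Tendsto (fun x : ℝ ↦ (abelL f x).re) (𝓝[>] 1) (𝓝 (abelL f (1 : ℝ)).re) :=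
    h.tendsto.mono_left nhdsWithin_le_nhds
  rw [Complex.ofReal_one] at h'
  exact ge_of_tendsto h' (eventually_nhdsWithin_of_forall fun x hx ↦
    (hf.re_abelL_pos_of_one_lt hx).le)

lemma re_abelL_one_pos (hf : IsRealChar f q) (h : abelL f 1 ≠ 0) : 0 < (abelL f 1).re := by
  refine hf.re_abelL_one_nonneg.lt_of_ne' fun h0 ↦ h ?_
  have := abelL_ofReal f 1
  rw [Complex.ofReal_one] at this
  rw [← this, h0, Complex.ofReal_zero]

end IsRealChar

lemma exists_norm_abelL_le : ∃ B : ℝ, 1 ≤ B ∧ ∀ (f : ℕ → ℝ) (q : ℝ), IsRealChar f q →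
    ∀ s : ℂ, 2 / 3 ≤ s.re → ‖s‖ ≤ 10 / 3 → ‖abelL f s‖ ≤ B * q := by
  set S := ∑' n : ℕ, ((n : ℝ) + 1) ^ (-(5 / 3 : ℝ))
  refine ⟨max 1 (10 / 3 * S), le_max_left _ _, fun f q hf s hs hs' ↦ ?_⟩
  have hq := hf.one_le
  have hS : 0 ≤ ∑' n : ℕ, ((n : ℝ) + 1) ^ (-(s.re + 1)) := tsum_nonneg fun n ↦ by positivity
  calc ‖abelL f s‖ ≤ ‖s‖ * q ^ (1 : ℝ) * ∑' n : ℕ, ((n : ℝ) + 1) ^ (-(s.re + 1)) :=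
        hf.norm_abelL_le zero_le_one le_rfl (by linarith) (by linarith)
    _ ≤ 10 / 3 * q ^ (1 : ℝ) * S := by
        gcongr
        refine Summable.tsum_le_tsum (fun n ↦ ?_) (summable_nat_add_one_rpow (by linarith))
          (summable_nat_add_one_rpow (by norm_num))
        exact Real.rpow_le_rpow_of_exponent_le (by simp) (by linarith)
    _ = 10 / 3 * S * q := by rw [Real.rpow_one]; ring
    _ ≤ _ := by gcongr; exact le_max_right _ _

lemma exists_norm_abelL_one_le {δ : ℝ} (hδ : 0 < δ) (hδ1 : δ ≤ 1) : ∃ B : ℝ, 1 ≤ B ∧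
    ∀ (f : ℕ → ℝ) (q : ℝ), IsRealChar f q → ‖abelL f 1‖ ≤ B * q ^ δ := by
  set S := ∑' n : ℕ, ((n : ℝ) + 1) ^ (-(1 + δ))
  refine ⟨max 1 S, le_max_left _ _, fun f q hf ↦ ?_⟩
  have hq := hf.one_le
  calc ‖abelL f 1‖ ≤ ‖(1 : ℂ)‖ * q ^ δ * ∑' n : ℕ, ((n : ℝ) + 1) ^ (-((1 : ℂ).re + δ)) :=
        hf.norm_abelL_le hδ.le hδ1 (by simp) (by simpa using hδ)
    _ = S * q ^ δ := by simp [S, mul_comm]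
    _ ≤ _ := by gcongr; exact le_max_right _ _

lemma le_re_of_exceptional {a : ℕ → ℂ} {H : ℂ → ℂ} (ha : 0 ≤ a) (ha1 : a 1 = 1)
    (hs : ∀ s : ℂ, 1 < s.re → LSeriesSummable a s)
    (hH : DifferentiableOn ℂ H {s | 0 < s.re})
    (hHL : ∀ s : ℂ, 1 < s.re → H s = (s - 1) * LSeries a s) {M : ℝ} (hM0 : 1 ≤ M)
    (hM : ∀ z : ℂ, 2 / 3 ≤ z.re → ‖z‖ ≤ 10 / 3 → ‖H z‖ ≤ M)
    {α : ℝ} (hα : 7 / 8 ≤ α) (hα1 : α < 1) (hneg : (H α / (α - 1)).re ≤ 0) :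
    (1 - α) / (2 * Real.exp 1) * (77 * M) ^ (-(7 * (1 - α))) ≤ (H 1).re := by
  set ℓ := Real.log (77 * M) with hℓ
  have hℓ0 : 0 < ℓ := Real.log_pos (by linarith)
  set m := ⌈7 * ℓ⌉₊ with hm
  have hm0 : m ≠ 0 := (Nat.ceil_pos.2 (by positivity)).ne'
  have hm1 : 7 * ℓ ≤ m := Nat.le_ceil _
  have hm2 : (m : ℝ) ≤ 7 * ℓ + 1 := (Nat.ceil_lt_add_one (by positivity)).le
  have hsph : ∀ z ∈ Metric.sphere (2 : ℂ) (4 / 3), ‖H z‖ ≤ M := by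
    intro z hz
    have hz : ‖z - 2‖ = 4 / 3 := by simpa [dist_eq_norm] using hz
    have h1 := (Complex.abs_re_le_norm (z - 2)).trans hz.le
    have h2 := norm_le_norm_add_norm_sub' z 2
    simp only [Complex.sub_re, Complex.re_ofNat, abs_le] at h1
    refine hM z (by linarith [h1.1]) ?_
    rw [hz] at h2
    refine h2.trans ?_
    rw [Complex.norm_ofNat]
    norm_num
  have hE := estermann_le ha ha1 hs hH hHL hsph (hM 1 (by norm_num) (by norm_num))
    (x := 2 - α) (by linarith) (by linarith) hm0
  have e1 : ((2 - (2 - α) : ℝ) : ℂ) = α := by push_cast; ring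
  have e2 : ((1 - (2 - α) : ℝ) : ℂ) = α - 1 := by push_cast; ring
  rw [e1, e2] at hE
  have hpow : 6 * M * ((27 / 32) ^ m * (32 / 5)) ≤ 1 / 2 := by
    have h1 : (27 / 32 : ℝ) ^ m ≤ (77 * M)⁻¹ := by
      rw [← Real.log_le_log_iff (by positivity) (by positivity), Real.log_pow, Real.log_inv, ← hℓ]
      have h2 : Real.log (27 / 32) ≤ - (5 / 32) := by
        have := Real.log_le_sub_one_of_pos (x := 27 / 32) (by norm_num)
        linarith
      have h3 : (m : ℝ) * Real.log (27 / 32) ≤ m * (- (5 / 32)) := by gcongr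
      nlinarith
    calc 6 * M * ((27 / 32) ^ m * (32 / 5)) ≤ 6 * M * ((77 * M)⁻¹ * (32 / 5)) := by gcongr
      _ = 6 * 32 / (5 * 77) := by field_simp
      _ ≤ 1 / 2 := by norm_num
  have hx : (2 - α) ^ m ≤ Real.exp 1 * (77 * M) ^ (7 * (1 - α)) := by
    rw [Real.rpow_def_of_pos (by positivity), ← Real.exp_add, ← hℓ]
    calc (2 - α) ^ m ≤ (Real.exp (1 - α)) ^ m := by
          gcongr
          · linarith
          · linarith [Real.add_one_le_exp (1 - α)]
      _ = Real.exp (m * (1 - α)) := by rw [← Real.exp_nat_mul]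
      _ ≤ _ := Real.exp_le_exp.2 (by nlinarith)
  have hd : 0 < 1 - α := by linarith
  have hR : 0 < (77 * M) ^ (7 * (1 - α)) := by positivity
  have hxp : 0 < (2 - α) ^ m := pow_pos (by linarith) m
  have h3 : 1 / 2 ≤ (H 1).re * ((2 - α) ^ m / (1 - α)) := by
    have : 2 - α - 1 = 1 - α := by ring
    rw [this] at hE
    linarith
  have hpos : 0 ≤ (H 1).re := by
    by_contra! h
    have := mul_neg_of_neg_of_pos h (div_pos hxp hd)
    linarith
  have h4 : 1 / 2 ≤ (H 1).re * (Real.exp 1 * (77 * M) ^ (7 * (1 - α)) / (1 - α)) :=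
    h3.trans (by gcongr)
  rw [Real.rpow_neg (by positivity)]
  have h5 := Real.exp_pos 1
  have h6 : 1 / 2 * (1 - α) ≤ (H 1).re * (Real.exp 1 * (77 * M) ^ (7 * (1 - α))) := by
    rw [mul_div_assoc', le_div_iff₀ hd] at h4
    exact h4
  rw [← div_eq_mul_inv, div_le_iff₀ hR, div_le_iff₀ (by positivity)]
  linarith

lemma rpow_neg_mul_rpow_neg_le {A q t ε : ℝ} {k : ℕ} (hA : 0 < A) (hq : 1 ≤ q) (ht : k * t ≤ ε) :
    A ^ (-t) * q ^ (-ε) ≤ (A * q ^ k) ^ (-t) := by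
  rw [Real.mul_rpow hA.le (by positivity), ← Real.rpow_natCast q, ← Real.rpow_mul (by positivity)]
  gcongr
  linarith

theorem siegel_lower_bound {ι : Type*} {f : ι → ℕ → ℝ} {q : ι → ℝ}
    (hf : ∀ i, IsRealChar (f i) (q i))
    (hff : ∀ i j, i ≠ j → IsRealChar (f i * f j) (q i * q j))
    (hf1 : ∀ i, abelL (f i) 1 ≠ 0) {ε : ℝ} (hε : 0 < ε) (hε1 : ε ≤ 1) :
    ∃ c : ℝ, 0 < c ∧ ∀ i, c * q i ^ (-ε) ≤ (abelL (f i) 1).re := by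
  obtain ⟨Z, hZ, hZ1, hZζ⟩ := exists_entire_eq_sub_one_mul_riemannZeta
  obtain ⟨B, hB1, hB⟩ := exists_norm_abelL_le
  obtain ⟨B', hB'1, hB'⟩ := exists_norm_abelL_one_le (half_pos hε) (by linarith)
  obtain ⟨K, hK1, hK⟩ : ∃ K : ℝ, 1 ≤ K ∧ ∀ s : ℂ, ‖s‖ ≤ 10 / 3 → ‖Z s‖ ≤ K := by
    obtain ⟨K, hK⟩ := (isCompact_closedBall (0 : ℂ) (10 / 3)).exists_bound_of_continuousOn
      hZ.continuous.continuousOn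
    exact ⟨max 1 K, le_max_left _ _, fun s hs ↦
      (hK s (by simpa using hs)).trans (le_max_right _ _)⟩
  have hZpos : ∀ᶠ x : ℝ in 𝓝 1, 0 < (Z x).re := by
    have : ContinuousAt (fun x : ℝ ↦ (Z x).re) 1 :=
      (Complex.continuous_re.comp (hZ.continuous.comp Complex.continuous_ofReal)).continuousAt
    exact this.eventually (lt_mem_nhds (by simp [hZ1]))
  obtain ⟨α₀, ⟨h7, hα1⟩, hαZ, hαε⟩ : ∃ α₀ : ℝ, (7 / 8 ≤ α₀ ∧ α₀ < 1) ∧ 0 < (Z α₀).re ∧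
      14 * (1 - α₀) ≤ ε / 2 := by
    have h1 : ∀ᶠ x : ℝ in 𝓝[<] 1, 0 < (Z x).re := hZpos.filter_mono nhdsWithin_le_nhds
    have h2 : ∀ᶠ x : ℝ in 𝓝[<] 1, x ∈ Set.Ioo (max (7 / 8) (1 - ε / 28)) 1 :=
      Ioo_mem_nhdsLT (max_lt (by norm_num) (by linarith))
    obtain ⟨x, hx1, hx2, hx3⟩ := (h1.and h2).exists
    have := (le_max_left _ _).trans_lt hx2
    have := (le_max_right _ _).trans_lt hx2
    exact ⟨x, ⟨by linarith, hx3⟩, hx1, by linarith⟩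
  have hpos (i) : 0 < (abelL (f i) 1).re := (hf i).re_abelL_one_pos (hf1 i)
  have hq (i) : 1 ≤ q i := (hf i).one_le
  have hre (g : ℕ → ℝ) : ((abelL g 1).re : ℂ) = abelL g 1 := by
    simpa using IsRealChar.abelL_ofReal g 1
  have hle (g : ℕ → ℝ) : (abelL g 1).re ≤ ‖abelL g 1‖ := Complex.re_le_norm _
  by_cases hz : ∃ i₀, ∃ α : ℝ, α₀ ≤ α ∧ α < 1 ∧ abelL (f i₀) α = 0
  · obtain ⟨i₀, α, hα, hα', h0⟩ := hz
    set A := 77 * (K * B ^ 3 * q i₀ ^ 2) with hA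
    have hq0 := hq i₀
    have hA0 : 0 < A := by positivity
    set c₁ := (1 - α) / (2 * Real.exp 1) * A ^ (-(7 * (1 - α))) with hc₁
    have hc₁0 : 0 < c₁ := mul_pos (div_pos (by linarith) (by positivity)) (by positivity)
    set c₂ := B * q i₀ * (B' * q i₀ ^ (ε / 2)) with hc₂
    have hc₂0 : 0 < c₂ := by positivity
    refine ⟨min (c₁ / c₂) ((abelL (f i₀) 1).re), lt_min (div_pos hc₁0 hc₂0) (hpos i₀),
      fun i ↦ ?_⟩
    have hqi := hq i
    by_cases hi : i = i₀
    · subst hi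
      calc _ ≤ (abelL (f i) 1).re * 1 := by
            gcongr
            · exact (hpos i).le
            · exact min_le_right _ _
            · exact Real.rpow_le_one_of_one_le_of_nonpos hqi (by linarith)
        _ = _ := mul_one _
    have hfi := hf i
    have hf0 := hf i₀
    have hf0i := hff i₀ i (Ne.symm hi)
    have key := le_re_of_exceptional (a := biquadConv (f i₀) (f i))
      (H := fun s ↦ Z s * (abelL (f i₀) s * (abelL (f i) s * abelL (f i₀ * f i) s)))
      (fun n ↦ hf0.biquadConv_nonneg hfi hf0i n) (hf0.biquadConv_one hfi hf0i)
      (fun s hs ↦ hf0.biquadConv_summable hfi hf0i hs)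
      (hZ.differentiableOn.mul (hf0.differentiableOn_abelL.mul
        (hfi.differentiableOn_abelL.mul hf0i.differentiableOn_abelL)))
      (fun s hs ↦ by
        have : s ≠ 1 := by rintro rfl; simp at hs
        rw [hf0.LSeries_biquadConv hfi hf0i hs, hZζ s this]
        ring)
      (M := K * (B * q i₀ * (B * q i * (B * (q i₀ * q i)))))
      (by
        have h1 : 1 ≤ B * q i₀ := one_le_mul_of_one_le_of_one_le hB1 hq0
        have h2 : 1 ≤ B * q i := one_le_mul_of_one_le_of_one_le hB1 hqi
        have h3 : 1 ≤ B * (q i₀ * q i) :=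
          one_le_mul_of_one_le_of_one_le hB1 (one_le_mul_of_one_le_of_one_le hq0 hqi)
        exact one_le_mul_of_one_le_of_one_le hK1 (one_le_mul_of_one_le_of_one_le h1
          (one_le_mul_of_one_le_of_one_le h2 h3)))
      (fun z hz hz' ↦ by
        simp only [norm_mul]
        gcongr
        · exact hK z hz'
        · exact hB _ _ hf0 z hz hz'
        · exact hB _ _ hfi z hz hz'
        · exact hB _ _ hf0i z hz hz')
      (α := α) (h7.trans hα) hα' (by simp [h0])
    have e1 : 77 * (K * (B * q i₀ * (B * q i * (B * (q i₀ * q i))))) = A * q i ^ 2 := by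
      rw [hA]; ring
    rw [e1] at key
    simp only [hZ1, one_mul] at key
    rw [← hre (f i₀), ← hre (f i), ← hre (f i₀ * f i), ← Complex.ofReal_mul, ← Complex.ofReal_mul,
      Complex.ofReal_re] at key
    have h2 : c₁ * q i ^ (-(ε / 2)) ≤
        (1 - α) / (2 * Real.exp 1) * (A * q i ^ 2) ^ (-(7 * (1 - α))) := by
      rw [hc₁, mul_assoc]
      gcongr
      exact rpow_neg_mul_rpow_neg_le hA0 hqi (by push_cast; linarith)
    have h3 : (abelL (f i₀) 1).re ≤ B * q i₀ :=
      (hle _).trans (hB _ _ hf0 1 (by norm_num) (by norm_num))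
    have h4 : (abelL (f i₀ * f i) 1).re ≤ B' * (q i₀ ^ (ε / 2) * q i ^ (ε / 2)) := by
      rw [← Real.mul_rpow (by positivity) (by positivity)]
      exact (hle _).trans (hB' _ _ hf0i)
    have h5 := hf0i.re_abelL_one_nonneg
    have h6 : c₁ * q i ^ (-(ε / 2)) ≤ (abelL (f i) 1).re * (c₂ * q i ^ (ε / 2)) := by
      refine (h2.trans key).trans ?_
      calc _ ≤ B * q i₀ * ((abelL (f i) 1).re * (B' * (q i₀ ^ (ε / 2) * q i ^ (ε / 2)))) := by
            have := (hpos i).le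
            gcongr
        _ = _ := by rw [hc₂]; ring
    have h7 : q i ^ (-ε) * q i ^ (ε / 2) = q i ^ (-(ε / 2)) := by
      rw [← Real.rpow_add (by positivity)]; ring_nf
    calc _ ≤ c₁ / c₂ * q i ^ (-ε) := by gcongr; exact min_le_left _ _
      _ = c₁ * q i ^ (-(ε / 2)) / (c₂ * q i ^ (ε / 2)) := by
        rw [← h7]
        field_simp
      _ ≤ _ := by rw [div_le_iff₀ (by positivity)]; exact h6
  · push Not at hz
    set A := 77 * (K * B) with hA
    have hA0 : 0 < A := by positivity
    refine ⟨(1 - α₀) / (2 * Real.exp 1) * A ^ (-(7 * (1 - α₀))),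
      mul_pos (div_pos (by linarith) (by positivity)) (by positivity), fun i ↦ ?_⟩
    have hqi := hq i
    have hfi := hf i
    have hα : 0 < (abelL (f i) α₀).re := by
      by_contra! hneg
      have hcont : ContinuousOn (fun x : ℝ ↦ (abelL (f i) x).re) (Set.Icc α₀ 1) :=
        hfi.continuousOn_re_abelL.mono fun x hx ↦ by
          have := hx.1
          simp only [Set.mem_Ioi]; linarith
      obtain ⟨x, hx, hx0⟩ := intermediate_value_Icc hα1.le hcont
        (show (0 : ℝ) ∈ _ from ⟨hneg, by simpa using (hpos i).le⟩)
      have hx0 : (abelL (f i) x).re = 0 := hx0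
      have hx1 : x ≠ 1 := by
        rintro rfl
        have := hpos i
        rw [Complex.ofReal_one] at hx0
        linarith
      refine hz i x hx.1 (lt_of_le_of_ne hx.2 hx1) ?_
      rw [← IsRealChar.abelL_ofReal, hx0, Complex.ofReal_zero]
    have key := le_re_of_exceptional (a := zetaConv (f i))
      (H := fun s ↦ Z s * abelL (f i) s)
      (fun n ↦ hfi.zetaConv_nonneg n) hfi.zetaConv_one
      (fun s hs ↦ hfi.zetaConv_summable hs)
      (hZ.differentiableOn.mul hfi.differentiableOn_abelL)
      (fun s hs ↦ by
        have : s ≠ 1 := by rintro rfl; simp at hs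
        rw [hfi.LSeries_zetaConv hs, hZζ s this]
        ring)
      (M := K * (B * q i))
      (one_le_mul_of_one_le_of_one_le hK1 (one_le_mul_of_one_le_of_one_le hB1 hqi))
      (fun z hz hz' ↦ by
        simp only [norm_mul]
        gcongr
        · exact hK z hz'
        · exact hB _ _ hfi z hz hz')
      (α := α₀) h7 hα1 (by
        rw [← IsRealChar.abelL_ofReal, ← Complex.ofReal_one, ← Complex.ofReal_sub, Complex.div_ofReal_re,
          Complex.re_mul_ofReal]
        exact div_nonpos_of_nonneg_of_nonpos (mul_pos hαZ hα).le (by linarith))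
    have e1 : 77 * (K * (B * q i)) = A * q i ^ 1 := by rw [hA]; ring
    simp only [hZ1, one_mul] at key
    rw [e1] at key
    refine le_trans ?_ key
    rw [mul_assoc]
    gcongr
    exact rpow_neg_mul_rpow_neg_le hA0 hqi (by push_cast; linarith)

section RogersSzego
open Polynomial

/-- The Rogers–Szegő polynomials. -/
noncomputable def rogersSzego (q : ℂ) : ℕ → ℂ[X]
  | 0 => 1
  | n + 1 => X * rogersSzego q n + (rogersSzego q n).comp (C q * X)

variable (q : ℂ)

lemma rogersSzego_comp (n : ℕ) :
    (rogersSzego q (n + 1)).comp (C q * X) =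
      rogersSzego q (n + 1) - C (1 - q ^ (n + 1)) * X * rogersSzego q n := by
  induction n with
  | zero =>
    simp [rogersSzego]
    ring
  | succ n ih =>
    have h1 : rogersSzego q (n + 1 + 1) =
      X * rogersSzego q (n + 1) + (rogersSzego q (n + 1)).comp (C q * X) := rfl
    have h2 : rogersSzego q (n + 1) =
      X * rogersSzego q n + (rogersSzego q n).comp (C q * X) := rfl
    have ih' := congrArg (fun r ↦ r.comp (C q * X)) ih
    simp only [sub_comp, mul_comp, C_comp, X_comp] at ih'
    rw [h1, add_comp, ih', ih, mul_comp, X_comp, ih]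
    simp only [map_sub, map_one, map_pow] at *
    linear_combination (-C q * X * (1 - C q ^ (n + 1))) * h2.symm

lemma rogersSzego_eval_neg_one (n : ℕ) :
    (rogersSzego q (n + 2)).eval (-1) = (1 - q ^ (n + 1)) * (rogersSzego q n).eval (-1) := by
  rw [rogersSzego, rogersSzego_comp]
  simp
  ring

lemma rogersSzego_eval_neg_one_two_mul (k : ℕ) :
    (rogersSzego q (2 * k)).eval (-1) = ∏ i ∈ range k, (1 - q ^ (2 * i + 1)) := by
  induction k with
  | zero => simp [rogersSzego]
  | succ k ih => rw [mul_add_one, rogersSzego_eval_neg_one, ih, prod_range_succ, mul_comm]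

lemma rogersSzego_natDegree_le (n : ℕ) : (rogersSzego q n).natDegree ≤ n := by
  induction n with
  | zero => simp [rogersSzego]
  | succ n ih =>
    refine (natDegree_add_le _ _).trans (max_le ?_ ?_)
    · exact natDegree_mul_le.trans (by linarith [natDegree_X_le (R := ℂ)])
    · refine natDegree_comp_le.trans ?_
      calc _ ≤ n * 1 := Nat.mul_le_mul ih ((natDegree_C_mul_le q X).trans natDegree_X_le)
        _ ≤ _ := by omega

lemma rogersSzego_coeff_zero (n : ℕ) : (rogersSzego q n).coeff 0 = 1 := by
  induction n with
  | zero => simp [rogersSzego]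
  | succ n ih => simp [rogersSzego, comp_C_mul_X_coeff, ih]

lemma rogersSzego_coeff_of_isPrimitiveRoot {w : ℂ} {n : ℕ} (hw : IsPrimitiveRoot w (n + 1))
    (hodd : Odd (n + 1)) {j : ℕ} (hj : j ≤ n) :
    (rogersSzego ((w ^ 2)⁻¹) n).coeff j = (-1) ^ j * w ^ (j * (j + 1)) := by
  have hq : IsPrimitiveRoot (w ^ 2)⁻¹ (n + 1) :=
    (hw.pow_of_coprime 2 (Nat.coprime_two_left.2 hodd)).inv
  have hw0 : w ≠ 0 := hw.ne_zero (Nat.succ_ne_zero n)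
  set q := (w ^ 2)⁻¹ with hqd
  induction j with
  | zero => simp [rogersSzego_coeff_zero]
  | succ j ih =>
    have h1 := rogersSzego_comp q n
    rw [hq.pow_eq_one, sub_self, C_0, zero_mul, zero_mul, sub_zero] at h1
    have h2 := congrArg (fun r ↦ r.coeff (j + 1)) h1
    simp only [comp_C_mul_X_coeff] at h2
    have h3 : q ^ (j + 1) ≠ 1 := hq.pow_ne_one_of_pos_of_lt (Nat.succ_ne_zero j) (by omega)
    have h4 : (rogersSzego q (n + 1)).coeff (j + 1) = 0 := by
      by_contra h
      exact h3 (mul_left_cancel₀ h (by rw [h2, mul_one]))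
    rw [rogersSzego, coeff_add, coeff_X_mul, comp_C_mul_X_coeff, ih (by omega)] at h4
    have h5 : q ^ (j + 1) * w ^ (2 * (j + 1)) = 1 := by
      rw [hqd, inv_pow, ← pow_mul, inv_mul_cancel₀ (pow_ne_zero _ hw0)]
    have h6 : (j + 1) * (j + 1 + 1) = j * (j + 1) + 2 * (j + 1) := by ring
    rw [h6, pow_add w, pow_succ (-1 : ℂ)]
    linear_combination w ^ (2 * (j + 1)) * h4 - (rogersSzego q n).coeff (j + 1) * h5

lemma sum_pow_mul_add_one {w : ℂ} {k : ℕ} (hw : IsPrimitiveRoot w (2 * k + 1)) :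
    ∑ j ∈ range (2 * k + 1), w ^ (j * (j + 1)) =
      ∏ i ∈ range k, (1 - (w ^ 2)⁻¹ ^ (2 * i + 1)) := by
  rw [← rogersSzego_eval_neg_one_two_mul, eval_eq_sum_range' (n := 2 * k + 1)
    (Nat.lt_succ_of_le (rogersSzego_natDegree_le _ _))]
  refine sum_congr rfl fun j hj ↦ ?_
  rw [rogersSzego_coeff_of_isPrimitiveRoot hw (odd_two_mul_add_one k)
    (Nat.lt_succ_iff.1 (mem_range.1 hj)), mul_right_comm, ← mul_pow]
  simp

end RogersSzego

section GaussSum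

lemma ZMod.sum_range_natCast {N : ℕ} [NeZero N] {M : Type*} [AddCommMonoid M] (F : ZMod N → M) :
    ∑ j ∈ range N, F j = ∑ a, F a :=
  sum_nbij' (fun k : ℕ ↦ (k : ZMod N)) ZMod.val (fun _ _ ↦ mem_univ _)
    (fun a _ ↦ mem_range.2 (ZMod.val_lt a))
    (fun _ hk ↦ ZMod.val_cast_of_lt (mem_range.1 hk)) (fun a _ ↦ ZMod.natCast_zmod_val a)
    fun _ _ ↦ rfl

lemma pow_sq_mul_prod_range {w : ℂ} (hw0 : w ≠ 0) (k : ℕ) :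
    w ^ (k ^ 2) * ∏ i ∈ range k, (1 - (w ^ 2)⁻¹ ^ (2 * i + 1)) =
      ∏ i ∈ range k, (w ^ (2 * i + 1) - (w ^ (2 * i + 1))⁻¹) := by
  induction k with
  | zero => simp
  | succ k ih =>
    rw [prod_range_succ, prod_range_succ, ← ih]
    have : (k + 1) ^ 2 = k ^ 2 + (2 * k + 1) := by ring
    have h1 : (w ^ 2)⁻¹ ^ (2 * k + 1) = (w ^ (2 * k + 1))⁻¹ ^ 2 := by
      rw [inv_pow, inv_pow, ← pow_mul, ← pow_mul, mul_comm]
    rw [this, pow_add, h1]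
    have h2 : w ^ (2 * k + 1) ≠ 0 := pow_ne_zero _ hw0
    generalize w ^ (2 * k + 1) = v at h2
    have h3 : v * (1 - v⁻¹ ^ 2) = v - v⁻¹ := by field_simp
    rw [← h3]
    ring

lemma sum_range_pow_sq {w : ℂ} {k : ℕ} (hw : IsPrimitiveRoot w (2 * k + 1)) :
    ∑ j ∈ range (2 * k + 1), w ^ (j ^ 2) =
      ∏ i ∈ range k, (w ^ (2 * i + 1) - (w ^ (2 * i + 1))⁻¹) := by
  have hw0 : w ≠ 0 := hw.ne_zero (Nat.succ_ne_zero _)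
  have hper (a b : ℕ) (h : a ≡ b [MOD 2 * k + 1]) : w ^ a = w ^ b := by
    rw [← pow_mod_orderOf w a, ← pow_mod_orderOf w b, ← hw.eq_orderOf, h]
  rw [← pow_sq_mul_prod_range hw0, ← sum_pow_mul_add_one hw, mul_sum]
  have e (j : ℕ) : w ^ (k ^ 2) * w ^ (j * (j + 1)) = w ^ ((j + (k + 1)) ^ 2) := by
    rw [← pow_add]
    refine hper _ _ ?_
    have : (j + (k + 1)) ^ 2 = k ^ 2 + j * (j + 1) + (2 * k + 1) * (j + 1) := by ring
    rw [this]
    simp [Nat.ModEq]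
  simp_rw [e]
  have hM (j : ℕ) : w ^ (j ^ 2) = (fun a : ZMod (2 * k + 1) ↦ w ^ (a.val ^ 2)) (j : ZMod _) := by
    refine hper _ _ (Nat.ModEq.pow 2 ?_)
    rw [← ZMod.natCast_eq_natCast_iff]
    simp
  have hM' (j : ℕ) : w ^ ((j + (k + 1)) ^ 2) =
      (fun a : ZMod (2 * k + 1) ↦ w ^ ((a + (k + 1 : ℕ)).val ^ 2)) (j : ZMod _) := by
    simpa only [← Nat.cast_add] using hM (j + (k + 1))
  rw [sum_congr rfl fun j _ ↦ hM j, sum_congr rfl fun j _ ↦ hM' j,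
    ZMod.sum_range_natCast fun a : ZMod (2 * k + 1) ↦ w ^ (a.val ^ 2),
    ZMod.sum_range_natCast fun a : ZMod (2 * k + 1) ↦ w ^ ((a + (k + 1 : ℕ)).val ^ 2)]
  exact (Equiv.sum_comp (Equiv.addRight ((k + 1 : ℕ) : ZMod (2 * k + 1)))
    fun a : ZMod (2 * k + 1) ↦ w ^ (a.val ^ 2)).symm

lemma prod_sub_inv_pos {n : ℕ} :
    0 < ∏ i ∈ range (2 * n), (Complex.exp (2 * Real.pi * Complex.I / (4 * n + 1 : ℕ)) ^ (2 * i + 1)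
      - (Complex.exp (2 * Real.pi * Complex.I / (4 * n + 1 : ℕ)) ^ (2 * i + 1))⁻¹) := by
  set s : ℕ → ℝ := fun i ↦ Real.sin (2 * Real.pi * (2 * i + 1) / (4 * n + 1)) with hs
  have e (i : ℕ) : Complex.exp (2 * Real.pi * Complex.I / (4 * n + 1 : ℕ)) ^ (2 * i + 1)
      - (Complex.exp (2 * Real.pi * Complex.I / (4 * n + 1 : ℕ)) ^ (2 * i + 1))⁻¹ =
      2 * Complex.I * s i := by
    rw [← Complex.exp_nat_mul, ← Complex.exp_neg, hs]
    simp only [Complex.ofReal_sin, Complex.sin]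
    push_cast
    have h1 : (2 * (i : ℂ) + 1) * (2 * Real.pi * Complex.I / (4 * n + 1)) =
      2 * Real.pi * (2 * i + 1) / (4 * n + 1) * Complex.I := by ring
    rw [h1, neg_mul]
    linear_combination (Complex.exp (2 * Real.pi * (2 * i + 1) / (4 * n + 1) * Complex.I) -
      Complex.exp (-(2 * Real.pi * (2 * i + 1) / (4 * n + 1) * Complex.I))) * Complex.I_sq
  simp_rw [e]
  rw [two_mul n, prod_range_add]
  have e2 (i : ℕ) : 2 * Complex.I * (s (n + i) : ℂ) = 2 * Complex.I * (-1) * (-s (n + i) : ℝ) := by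
    push_cast; ring
  simp_rw [e2]
  simp only [prod_mul_distrib, prod_const, card_range, ← Complex.ofReal_prod]
  have e3 : (2 : ℂ) ^ n * Complex.I ^ n * (∏ i ∈ range n, s i : ℝ) *
      (2 ^ n * Complex.I ^ n * (-1) ^ n * (∏ i ∈ range n, -s (n + i) : ℝ)) =
      ((4 ^ n * (∏ i ∈ range n, s i) * ∏ i ∈ range n, -s (n + i) : ℝ) : ℂ) := by
    have : (2 : ℂ) ^ n * Complex.I ^ n * (2 ^ n * Complex.I ^ n * (-1) ^ n) = 4 ^ n := by
      simp only [← mul_pow]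
      congr 1
      linear_combination (-4 : ℂ) * Complex.I_sq
    push_cast
    rw [← this]
    ring
  rw [e3, Complex.zero_lt_real]
  have hn : (0 : ℝ) < 4 * n + 1 := by positivity
  have hpi := Real.pi_pos
  refine mul_pos (mul_pos (by positivity) (prod_pos fun i hi ↦ ?_)) (prod_pos fun i hi ↦ ?_)
  · have hi : (i : ℝ) + 1 ≤ n := by exact_mod_cast mem_range.1 hi
    refine Real.sin_pos_of_pos_of_lt_pi (by positivity) ?_
    rw [div_lt_iff₀ hn]
    nlinarith
  · have hi : (i : ℝ) + 1 ≤ n := by exact_mod_cast mem_range.1 hi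
    rw [hs, neg_pos]
    simp only
    rw [← Real.sin_sub_two_pi]
    refine Real.sin_neg_of_neg_of_neg_pi_lt ?_ ?_
    · rw [sub_neg, div_lt_iff₀ hn]
      push_cast
      nlinarith
    · rw [lt_sub_iff_add_lt, lt_div_iff₀ hn]
      push_cast
      nlinarith

/-- The quadratic character modulo `p` with complex values. -/
noncomputable abbrev quadCharC (p : ℕ) [Fact p.Prime] : MulChar (ZMod p) ℂ :=
  (quadraticChar (ZMod p)).ringHomComp (Int.castRingHom ℂ)

variable {p : ℕ} [Fact p.Prime]

lemma quadCharC_ne_one (hp : p % 4 = 1) : quadCharC p ≠ 1 :=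
  (MulChar.ringHomComp_ne_one_iff (RingHom.injective_int _)).2
    (quadraticChar_ne_one (by rw [ZMod.ringChar_zmod_n]; rintro rfl; norm_num at hp))

lemma gaussSum_quadCharC_eq_sum_sq (hp : p % 4 = 1) :
    gaussSum (quadCharC p) ZMod.stdAddChar = ∑ a : ZMod p, ZMod.stdAddChar (a ^ 2) := by
  have h2 : ringChar (ZMod p) ≠ 2 := by rw [ZMod.ringChar_zmod_n]; rintro rfl; norm_num at hp
  have h0 : ∑ a : ZMod p, (ZMod.stdAddChar a : ℂ) = 0 :=
    AddChar.sum_eq_zero_of_ne_one (by simpa using ZMod.isPrimitive_stdAddChar p one_ne_zero)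
  have h1 : ∑ a : ZMod p, (ZMod.stdAddChar (a ^ 2) : ℂ) =
      ∑ b : ZMod p, (#{a : ZMod p | a ^ 2 = b} : ℂ) * ZMod.stdAddChar b := by
    rw [← sum_fiberwise (s := univ) (g := fun a : ZMod p ↦ a ^ 2)]
    refine sum_congr rfl fun b _ ↦ ?_
    rw [← nsmul_eq_mul, ← sum_const]
    exact sum_congr rfl fun a ha ↦ by rw [(mem_filter.1 ha).2]
  rw [h1, gaussSum, ← add_zero (∑ a, _), ← h0, ← sum_add_distrib]
  refine sum_congr rfl fun b _ ↦ ?_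
  have h3 := quadraticChar_card_sqrts h2 b
  have h4 : #{a : ZMod p | a ^ 2 = b} = #{x : ZMod p | x ^ 2 = b}.toFinset := by
    congr 1; ext; simp
  have h5 : (#{a : ZMod p | a ^ 2 = b} : ℂ) = ((quadraticChar (ZMod p) b + 1 : ℤ) : ℂ) := by
    rw [h4, ← h3]; simp
  rw [h5]
  simp [MulChar.ringHomComp_apply]
  ring

lemma gaussSum_quadCharC_pos (hp : p % 4 = 1) :
    0 < gaussSum (quadCharC p) ZMod.stdAddChar := by
  obtain ⟨n, hn⟩ : ∃ n, p = 4 * n + 1 := ⟨p / 4, by omega⟩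
  rw [gaussSum_quadCharC_eq_sum_sq hp]
  have h1 := prod_sub_inv_pos (n := n)
  have hw := Complex.isPrimitiveRoot_exp p (Fact.out : p.Prime).ne_zero
  rw [← hn] at h1
  set w := Complex.exp (2 * Real.pi * Complex.I / p) with hwd
  have h2 := sum_range_pow_sq (w := w) (k := 2 * n) (by convert hw using 1; omega)
  rw [← h2, show 2 * (2 * n) + 1 = p by omega] at h1
  convert h1 using 1
  rw [← ZMod.sum_range_natCast fun a : ZMod p ↦ (ZMod.stdAddChar (a ^ 2) : ℂ)]
  refine sum_congr rfl fun j _ ↦ ?_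
  have := ZMod.stdAddChar_coe (N := p) ((j : ℤ) ^ 2)
  push_cast at this
  rw [this, hwd, ← Complex.exp_nat_mul]
  congr 1
  push_cast
  ring

theorem gaussSum_quadCharC (hp : p % 4 = 1) :
    gaussSum (quadCharC p) ZMod.stdAddChar = (√p : ℝ) := by
  have h1 : gaussSum (quadCharC p) ZMod.stdAddChar ^ 2 =
      quadCharC p (-1) * Fintype.card (ZMod p) := gaussSum_sq (quadCharC_ne_one hp)
    ((quadraticChar_isQuadratic (ZMod p)).comp (Int.castRingHom ℂ))
    (ZMod.isPrimitive_stdAddChar p)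
  obtain ⟨h2, h3⟩ := Complex.pos_iff.1 (gaussSum_quadCharC_pos hp)
  set τ := gaussSum (quadCharC p) ZMod.stdAddChar
  have h4 : τ = (τ.re : ℝ) := by
    apply Complex.ext
    · simp
    · simp [← h3]
  have h5 : quadCharC p (-1) = 1 := by
    have h2 : p ≠ 2 := by rintro rfl; norm_num at hp
    have := quadraticChar_neg_one (F := ZMod p) (by rwa [ZMod.ringChar_zmod_n])
    rw [ZMod.card, ZMod.χ₄_nat_one_mod_four hp] at this
    simp [MulChar.ringHomComp_apply, this]
  rw [h5, one_mul, ZMod.card] at h1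
  rw [h4] at h1 ⊢
  congr 1
  rw [eq_comm, Real.sqrt_eq_iff_mul_self_eq_of_pos h2, ← sq]
  exact_mod_cast h1

end GaussSum

namespace DirichletCharacter

variable {N N₁ N₂ : ℕ}

lemma exists_mul_apply_natCast (χ₁ : DirichletCharacter ℤ N₁) (χ₂ : DirichletCharacter ℤ N₂) :
    ∃ χ : DirichletCharacter ℤ (N₁ * N₂), ∀ n : ℕ, χ n = χ₁ n * χ₂ n := by
  refine ⟨changeLevel (dvd_mul_right N₁ N₂) χ₁ * changeLevel (dvd_mul_left N₂ N₁) χ₂,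
    fun n ↦ ?_⟩
  by_cases h : n.Coprime (N₁ * N₂)
  · have hu : IsUnit (n : ZMod (N₁ * N₂)) := (ZMod.isUnit_iff_coprime _ _).2 h
    obtain ⟨u, hu⟩ := hu
    rw [MulChar.mul_apply, ← hu, changeLevel_eq_cast_of_dvd, changeLevel_eq_cast_of_dvd, hu,
      ZMod.cast_natCast (dvd_mul_right N₁ N₂), ZMod.cast_natCast (dvd_mul_left N₂ N₁)]
  · rw [MulChar.map_nonunit _ (fun hu ↦ h ((ZMod.isUnit_iff_coprime _ _).1 hu))]
    rw [Nat.coprime_mul_iff_right, not_and_or] at h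
    rcases h with h | h
    · rw [MulChar.map_nonunit χ₁ (fun hu ↦ h ((ZMod.isUnit_iff_coprime _ _).1 hu)), zero_mul]
    · rw [MulChar.map_nonunit χ₂ (fun hu ↦ h ((ZMod.isUnit_iff_coprime _ _).1 hu)), mul_zero]

lemma ne_one_of_apply_natCast_eq_neg_one {χ : DirichletCharacter ℤ N} {n : ℕ} (h : χ n = -1) :
    χ ≠ 1 := by
  rintro rfl
  by_cases hn : IsUnit (n : ZMod N)
  · rw [MulChar.one_apply hn] at h
    norm_num at h
  · rw [MulChar.map_nonunit _ hn] at h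
    norm_num at h

lemma sum_range_eq_zero [NeZero N] {χ : DirichletCharacter ℤ N} (hχ : χ ≠ 1) :
    ∑ k ∈ range N, χ k = 0 := by
  rw [ZMod.sum_range_natCast fun a ↦ χ a, MulChar.sum_eq_zero_of_ne_one hχ]

lemma abs_sum_range_le [NeZero N] {χ : DirichletCharacter ℤ N} (hχ : χ ≠ 1)
    (hv : ∀ a, |χ a| ≤ 1) (n : ℕ) : |∑ k ∈ range n, χ k| ≤ N := by
  induction n using Nat.strong_induction_on with
  | _ n ih =>
    rcases le_or_gt N n with h | h
    · obtain ⟨m, rfl⟩ := Nat.exists_eq_add_of_le h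
      rw [sum_range_add, sum_range_eq_zero hχ, zero_add]
      simpa using ih m (by have := NeZero.pos N; omega)
    · calc _ ≤ ∑ k ∈ range n, |χ k| := abs_sum_le_sum_abs _ _
        _ ≤ ∑ k ∈ range n, 1 := sum_le_sum fun _ _ ↦ hv _
        _ ≤ N := by simpa using h.le

lemma abelL_one_ne_zero [NeZero N] {χ : DirichletCharacter ℤ N} (hχ : χ ≠ 1)
    {f : ℕ → ℝ} {q : ℝ} (hf : IsRealChar f q) (hfχ : ∀ n, f n = χ n) : abelL f 1 ≠ 0 := by
  set ψ : DirichletCharacter ℂ N := χ.ringHomComp (Int.castRingHom ℂ) with hψ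
  have hψ1 : ψ ≠ 1 :=
    (MulChar.ringHomComp_ne_one_iff (RingHom.injective_int _)).2 hχ
  have h1 : Tendsto (fun x : ℝ ↦ LFunction ψ x) (𝓝[>] 1) (𝓝 (LFunction ψ 1)) := by
    have := ((differentiable_LFunction hψ1).continuous.comp
      Complex.continuous_ofReal).continuousAt (x := 1)
    simpa [Function.comp_def] using this.tendsto.mono_left nhdsWithin_le_nhds
  have h2 : Tendsto (fun x : ℝ ↦ abelL f x) (𝓝[>] 1) (𝓝 (abelL f 1)) := by
    have : ContinuousAt (fun x : ℝ ↦ abelL f x) 1 :=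
      (hf.differentiableOn_abelL.continuousOn.continuousAt ((isOpen_lt continuous_const
        Complex.continuous_re).mem_nhds (by simp))).comp Complex.continuous_ofReal.continuousAt
    simpa using this.tendsto.mono_left nhdsWithin_le_nhds
  have h3 : LFunction ψ 1 = abelL f 1 := by
    refine tendsto_nhds_unique h1 (h2.congr' (eventually_nhdsWithin_of_forall fun x hx ↦ ?_))
    have hx : 1 < (x : ℂ).re := by simpa using hx
    change _ = LFunction ψ x
    rw [hf.abelL_eq_LSeries hx, LFunction_eq_LSeries ψ hx]
    refine LSeries_congr (fun {n} _ ↦ ?_) _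
    simp [hfχ, hψ, MulChar.ringHomComp_apply]
  rw [← h3]
  exact LFunction_apply_one_ne_zero hψ1

end DirichletCharacter

lemma IsRealChar.of_dirichletCharacter {N : ℕ} [NeZero N] (hN : N ≠ 1) {χ : DirichletCharacter ℤ N}
    (hχ : χ ≠ 1) (hv : ∀ n : ℕ, χ n = 0 ∨ χ n = 1 ∨ χ n = -1) :
    IsRealChar (fun n ↦ χ n) N where
  map_zero := by
    have : Nontrivial (ZMod N) := ZMod.nontrivial_iff.2 hN
    simpa using MulChar.map_zero χ
  map_one := by simp
  map_mul m n := by simp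
  values n := by exact_mod_cast hv n
  sum_le n := by
    have := DirichletCharacter.abs_sum_range_le hχ (fun a ↦ ?_) n
    · exact_mod_cast this
    · obtain ⟨n, rfl⟩ := ZMod.natCast_zmod_surjective a
      rcases hv n with h | h | h <;> simp [h]

/-- The real character `n ↦ χ₄(n) (n / p)` modulo `4 p`. -/
noncomputable def chiFourMul (p : ℕ) [Fact p.Prime] (n : ℕ) : ℝ :=
  ((ZMod.χ₄ n * quadraticChar (ZMod p) n : ℤ) : ℝ)

section
variable {p : ℕ} [Fact p.Prime]

lemma exists_dirichletCharacter_eq_chiFourMul (p : ℕ) [Fact p.Prime] :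
    ∃ χ : DirichletCharacter ℤ (4 * p), ∀ n : ℕ, χ n = ZMod.χ₄ n * quadraticChar (ZMod p) n :=
  DirichletCharacter.exists_mul_apply_natCast ZMod.χ₄ (quadraticChar (ZMod p))

lemma quadraticChar_values (a : ZMod p) :
    quadraticChar (ZMod p) a = 0 ∨ quadraticChar (ZMod p) a = 1 ∨ quadraticChar (ZMod p) a = -1 :=
  quadraticChar_isQuadratic _ a

lemma chiFour_values (a : ZMod 4) :
    ZMod.χ₄ a = 0 ∨ ZMod.χ₄ a = 1 ∨ ZMod.χ₄ a = -1 := ZMod.isQuadratic_χ₄ a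

lemma chiFourMul_values (n : ℕ) :
    ZMod.χ₄ n * quadraticChar (ZMod p) n = 0 ∨ ZMod.χ₄ n * quadraticChar (ZMod p) n = 1 ∨
      ZMod.χ₄ n * quadraticChar (ZMod p) n = -1 := by
  rcases chiFour_values (n : ZMod 4) with h | h | h <;>
    rcases quadraticChar_values (n : ZMod p) with h' | h' | h' <;> simp [h, h']

lemma quadraticChar_neg_one_of_mod_four (hp : p % 4 = 1) : quadraticChar (ZMod p) (-1) = 1 := by
  have h2 : p ≠ 2 := by rintro rfl; norm_num at hp
  rw [quadraticChar_neg_one (by rwa [ZMod.ringChar_zmod_n]), ZMod.card, ZMod.χ₄_nat_one_mod_four hp]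

lemma chiFourMul_neg_one (hp : p % 4 = 1) :
    ZMod.χ₄ ((4 * p - 1 : ℕ)) * quadraticChar (ZMod p) ((4 * p - 1 : ℕ)) = -1 := by
  have h1 : 1 ≤ 4 * p := by have := (Fact.out : p.Prime).pos; omega
  rw [Nat.cast_sub h1, Nat.cast_sub h1]
  have : ((4 * p : ℕ) : ZMod 4) = 0 := by
    rw [Nat.cast_mul]; rw [show ((4 : ℕ) : ZMod 4) = 0 from rfl, zero_mul]
  rw [this]
  simp [quadraticChar_neg_one_of_mod_four hp]
  rfl

lemma isRealChar_chiFourMul (hp : p % 4 = 1) : IsRealChar (chiFourMul p) (4 * p : ℕ) := by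
  have : NeZero p := ⟨(Fact.out : p.Prime).ne_zero⟩
  obtain ⟨χ, hχ⟩ := exists_dirichletCharacter_eq_chiFourMul p
  have h := IsRealChar.of_dirichletCharacter (by omega) (χ := χ)
    (DirichletCharacter.ne_one_of_apply_natCast_eq_neg_one (n := 4 * p - 1)
      (by rw [hχ, chiFourMul_neg_one hp])) (fun n ↦ by rw [hχ]; exact chiFourMul_values n)
  have e : chiFourMul p = fun n : ℕ ↦ ((χ n : ℤ) : ℝ) := by
    ext n
    rw [hχ, chiFourMul]
  rwa [e]

lemma abelL_chiFourMul_one_ne_zero (hp : p % 4 = 1) : abelL (chiFourMul p) 1 ≠ 0 := by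
  have : NeZero p := ⟨(Fact.out : p.Prime).ne_zero⟩
  obtain ⟨χ, hχ⟩ := exists_dirichletCharacter_eq_chiFourMul p
  exact DirichletCharacter.abelL_one_ne_zero (χ := χ)
    (DirichletCharacter.ne_one_of_apply_natCast_eq_neg_one (n := 4 * p - 1)
      (by rw [hχ, chiFourMul_neg_one hp])) (isRealChar_chiFourMul hp)
    (fun n ↦ by rw [hχ, chiFourMul])

lemma isRealChar_chiFourMul_mul {p' : ℕ} [Fact p'.Prime] (hp : p % 4 = 1)
    (hne : p ≠ p') :
    IsRealChar (chiFourMul p * chiFourMul p') ((4 * p : ℕ) * (4 * p' : ℕ)) := by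
  have : NeZero p := ⟨(Fact.out : p.Prime).ne_zero⟩
  have : NeZero p' := ⟨(Fact.out : p'.Prime).ne_zero⟩
  obtain ⟨χ₁, hχ₁⟩ := exists_dirichletCharacter_eq_chiFourMul p
  obtain ⟨χ₂, hχ₂⟩ := exists_dirichletCharacter_eq_chiFourMul p'
  obtain ⟨χ, hχ⟩ := DirichletCharacter.exists_mul_apply_natCast χ₁ χ₂
  obtain ⟨a, ha⟩ := quadraticChar_exists_neg_one (F := ZMod p)
    (by rw [ZMod.ringChar_zmod_n]; rintro rfl; norm_num at hp)
  have hodd : p.Coprime 4 := by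
    have : p.Coprime (2 ^ 2) := Nat.Coprime.pow_right 2
      (Nat.coprime_two_right.2 (Nat.odd_iff.2 (by omega)))
    simpa using this
  obtain ⟨n, hn1, hn2⟩ := Nat.chineseRemainder (hodd.mul_right
    ((Nat.coprime_primes Fact.out Fact.out).2 hne)) a.val 1
  have hn4 : (n : ZMod 4) = 1 := by
    simpa using (ZMod.natCast_eq_natCast_iff _ _ _).2 (hn2.of_mul_right p')
  have hnp' : (n : ZMod p') = 1 := by
    simpa using (ZMod.natCast_eq_natCast_iff _ _ _).2 (hn2.of_mul_left 4)
  have hnp : (n : ZMod p) = a := by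
    simpa using (ZMod.natCast_eq_natCast_iff _ _ _).2 hn1
  have h := IsRealChar.of_dirichletCharacter (N := 4 * p * (4 * p')) (by grind) (χ := χ)
    (DirichletCharacter.ne_one_of_apply_natCast_eq_neg_one (n := n)
      (by simp [hχ, hχ₁, hχ₂, hn4, hnp, hnp', ha])) (fun n ↦ by
      rw [hχ, hχ₁, hχ₂]
      rcases chiFourMul_values (p := p) n with h | h | h <;>
        rcases chiFourMul_values (p := p') n with h' | h' | h' <;>
          rw [h, h'] <;> norm_num)
  have e : (chiFourMul p * chiFourMul p') = fun n : ℕ ↦ ((χ n : ℤ) : ℝ) := by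
    ext n
    simp [hχ, hχ₁, hχ₂, chiFourMul]
  rw [e, ← Nat.cast_mul]
  exact h

theorem exists_le_abelL_chiFourMul {ε : ℝ} (hε : 0 < ε) (hε1 : ε ≤ 1) :
    ∃ c : ℝ, 0 < c ∧ ∀ (p : ℕ) [Fact p.Prime], p % 4 = 1 →
      c * (4 * p : ℕ) ^ (-ε) ≤ (abelL (chiFourMul p) 1).re := by
  let ι := {p : ℕ // p.Prime ∧ p % 4 = 1}
  have (i : ι) : Fact i.1.Prime := ⟨i.2.1⟩
  obtain ⟨c, hc, h⟩ := siegel_lower_bound (ι := ι) (f := fun i ↦ chiFourMul i.1)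
    (q := fun i ↦ (4 * i.1 : ℕ)) (fun i ↦ isRealChar_chiFourMul i.2.2)
    (fun i j hij ↦ isRealChar_chiFourMul_mul i.2.2 fun h ↦ hij (Subtype.ext h))
    (fun i ↦ abelL_chiFourMul_one_ne_zero i.2.2) hε hε1
  exact ⟨c, hc, fun p hp hp1 ↦ h ⟨p, hp.out, hp1⟩⟩

end

section QuarterSum

lemma sum_quadCharC_mul_stdAddChar {p : ℕ} [Fact p.Prime] (hp : p % 4 = 1) (k : ZMod p) :
    ∑ m : ZMod p, quadCharC p m * ZMod.stdAddChar (k * m) = quadCharC p k * (√p : ℝ) := by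
  have hτ := gaussSum_quadCharC (p := p) hp
  by_cases hk : k = 0
  · subst hk
    have h := MulChar.sum_eq_zero_of_ne_one (quadCharC_ne_one (p := p) hp)
    simpa using h
  · have h := gaussSum_mulShift (quadCharC p) ZMod.stdAddChar (Units.mk0 k hk)
    rw [hτ] at h
    have hsq : quadCharC p k * quadCharC p k = 1 := by
      have h1 := quadraticChar_sq_one (F := ZMod p) hk
      have h2 : quadCharC p k = ((quadraticChar (ZMod p) k : ℤ) : ℂ) := rfl
      rw [h2, ← Int.cast_mul, ← sq, h1, Int.cast_one]
    have h3 : ∑ m : ZMod p, quadCharC p m * ZMod.stdAddChar (k * m) =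
        gaussSum (quadCharC p) (AddChar.mulShift ZMod.stdAddChar (Units.mk0 k hk : ZMod p)) := by
      simp only [gaussSum, AddChar.mulShift_apply, Units.val_mk0]
    rw [h3, ← h, Units.val_mk0, ← mul_assoc, hsq, one_mul]

lemma hasSum_chiFourMul_arctan {p : ℕ} [Fact p.Prime] (hp : p % 4 = 1) {t : ℝ} (h0 : 0 < t)
    (h1 : t < 1) :
    HasSum (fun k : ℕ ↦ t * √p * (chiFourMul p (k + 1) / (k + 1) * t ^ k))
      (∑ a : ZMod p, (quadraticChar (ZMod p) a : ℝ) *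
        (Complex.arctan (t * ZMod.stdAddChar a)).re) := by
  have hz (a : ZMod p) : ‖(t : ℂ) * ZMod.stdAddChar a‖ < 1 := by
    rw [norm_mul, AddChar.norm_apply, mul_one, Complex.norm_real, Real.norm_of_nonneg h0.le]
    exact h1
  have hsum := hasSum_sum (s := (univ : Finset (ZMod p))) fun a _ ↦
    (Complex.hasSum_arctan (hz a)).mul_left (quadCharC p a)
  have hre := Complex.reCLM.hasSum hsum
  have hinj : Function.Injective fun n : ℕ ↦ 2 * n := fun a b h ↦ by simpa using h
  rw [← hinj.hasSum_iff]
  · convert hre using 1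
    · funext n
      have hχ : chiFourMul p (2 * n + 1) = (-1) ^ n * quadraticChar (ZMod p) (2 * n + 1 : ℕ) := by
        rw [chiFourMul, ZMod.χ₄_eq_neg_one_pow (by omega), show (2 * n + 1) / 2 = n by omega]
        push_cast
        rfl
      have hs := sum_quadCharC_mul_stdAddChar (p := p) hp (2 * n + 1 : ℕ)
      have hterm : ∑ a : ZMod p, quadCharC p a *
          ((-1) ^ n * ((t : ℂ) * ZMod.stdAddChar a) ^ (2 * n + 1) / ((2 * n + 1 : ℕ) : ℂ)) =
          (-1) ^ n * (t : ℂ) ^ (2 * n + 1) / ((2 * n + 1 : ℕ) : ℂ) *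
            ∑ m : ZMod p, quadCharC p m * ZMod.stdAddChar (((2 * n + 1 : ℕ) : ZMod p) * m) := by
        rw [mul_sum]
        refine sum_congr rfl fun a _ ↦ ?_
        rw [← nsmul_eq_mul, AddChar.map_nsmul_eq_pow]
        ring
      have h2 : quadCharC p (2 * n + 1 : ℕ) =
        ((quadraticChar (ZMod p) (2 * n + 1 : ℕ) : ℤ) : ℂ) := rfl
      simp only [Function.comp_apply, Complex.reCLM_apply]
      rw [hterm, hs, h2, hχ]
      rw [show (-1 : ℂ) ^ n * (t : ℂ) ^ (2 * n + 1) / ((2 * n + 1 : ℕ) : ℂ) *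
        (((quadraticChar (ZMod p) (2 * n + 1 : ℕ) : ℤ) : ℂ) * (√p : ℝ)) =
        (((-1) ^ n * t ^ (2 * n + 1) / ((2 * n + 1 : ℕ) : ℝ) *
        (((quadraticChar (ZMod p) (2 * n + 1 : ℕ) : ℤ) : ℝ) * √p) : ℝ) : ℂ) by push_cast; rfl,
        Complex.ofReal_re]
      push_cast
      ring
    · rw [Complex.reCLM_apply, Complex.re_sum]
      refine sum_congr rfl fun a _ ↦ ?_
      have h2 : quadCharC p a = (((quadraticChar (ZMod p) a : ℤ) : ℝ) : ℂ) := by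
        rw [Complex.ofReal_intCast]; rfl
      rw [h2, Complex.re_ofReal_mul]
  · intro k hk
    have hodd : (k + 1) % 2 = 0 := by
      by_contra h
      exact hk ⟨k / 2, by simp only []; omega⟩
    have : chiFourMul p (k + 1) = 0 := by
      rw [chiFourMul, ZMod.χ₄_nat_eq_if_mod_four]
      simp [hodd]
    simp [this]

lemma Complex.re_arctan_of_norm_lt_one {z : ℂ} (hz : ‖z‖ < 1) :
    (arctan z).re = arg (1 - ‖z‖ ^ 2 + 2 * z.re * I) / 2 := by
  have hne : 1 - z * I ≠ 0 := by
    intro h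
    have : ‖z * I‖ = 1 := by rw [← sub_eq_zero.1 h, norm_one]
    rw [norm_mul, norm_I, mul_one] at this
    exact hz.ne this
  have hpos : 0 < (normSq (1 - z * I))⁻¹ := inv_pos.2 (normSq_pos.2 hne)
  have hdiv : (1 + z * I) / (1 - z * I) =
      ((normSq (1 - z * I))⁻¹ : ℝ) * (1 - ‖z‖ ^ 2 + 2 * z.re * I) := by
    rw [div_eq_mul_inv, inv_def, ← mul_assoc, mul_comm]
    congr 1
    have h1 := add_conj z
    have h2 := mul_conj' z
    simp only [map_sub, map_one, map_mul, conj_I]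
    push_cast at h1
    rw [← h1, ← h2]
    linear_combination (z * (starRingEnd ℂ) z) * I_sq
  rw [arctan, hdiv, ← arg_real_mul (1 - ‖z‖ ^ 2 + 2 * z.re * I : ℂ) hpos, ← log_im]
  simp [Complex.mul_re]
  ring

lemma tendsto_re_arctan {z : ℂ} (hz : ‖z‖ = 1) (hre : z.re ≠ 0) :
    Tendsto (fun t : ℝ ↦ (Complex.arctan (t * z)).re) (𝓝[<] 1)
      (𝓝 (Real.pi / 4 * Real.sign z.re)) := by
  have harg : Complex.arg (2 * z.re * Complex.I) = Real.pi / 2 * Real.sign z.re := by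
    rcases lt_or_gt_of_ne hre with h | h
    · rw [Real.sign_of_neg h, mul_neg_one, Complex.arg_eq_neg_pi_div_two_iff]
      exact ⟨by simp, by simpa using mul_neg_of_pos_of_neg two_pos h⟩
    · rw [Real.sign_of_pos h, mul_one, Complex.arg_eq_pi_div_two_iff]
      simpa using h
  have hslit : (2 * z.re * Complex.I : ℂ) ∈ Complex.slitPlane := by
    rw [Complex.mem_slitPlane_iff]
    right
    simpa using hre
  have hc : Tendsto (fun t : ℝ ↦ ((1 - t ^ 2 : ℝ) : ℂ) + 2 * (t * z.re : ℝ) * Complex.I) (𝓝[<] 1)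
      (𝓝 (2 * z.re * Complex.I)) := by
    have : Continuous fun t : ℝ ↦ ((1 - t ^ 2 : ℝ) : ℂ) + 2 * (t * z.re : ℝ) * Complex.I := by
      fun_prop
    have h := (this.tendsto 1).mono_left (nhdsWithin_le_nhds (s := Set.Iio 1))
    simpa using h
  have h := ((Complex.continuousAt_arg hslit).tendsto.comp hc).div_const 2
  rw [harg, show Real.pi / 2 * Real.sign z.re / 2 = Real.pi / 4 * Real.sign z.re by ring] at h
  refine h.congr' ?_
  filter_upwards [Ioo_mem_nhdsLT (show (0 : ℝ) < 1 by norm_num)] with t ht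
  have hn : ‖(t : ℂ) * z‖ = t := by
    rw [norm_mul, hz, mul_one, Complex.norm_real, Real.norm_of_nonneg ht.1.le]
  rw [Complex.re_arctan_of_norm_lt_one (by rw [hn]; exact ht.2), hn, Complex.re_ofReal_mul]
  simp

lemma sqrt_mul_abelL_chiFourMul {p : ℕ} [Fact p.Prime] (hp : p % 4 = 1)
    (hre : ∀ a : ZMod p, (ZMod.stdAddChar a : ℂ).re ≠ 0) :
    √p * (abelL (chiFourMul p) 1).re = ∑ a : ZMod p, (quadraticChar (ZMod p) a : ℝ) *
        (Real.pi / 4 * Real.sign (ZMod.stdAddChar a : ℂ).re) := by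
  have hL : Tendsto (fun n ↦ ∑ k ∈ range n, chiFourMul p (k + 1) / (k + 1)) atTop
      (𝓝 (abelL (chiFourMul p) 1).re) := by
    have h := (Complex.continuous_re.tendsto _).comp
      ((isRealChar_chiFourMul (p := p) hp).tendsto_sum (s := 1) (by simp))
    refine h.congr fun n ↦ ?_
    simp only [Function.comp_apply, Complex.re_sum]
    refine sum_congr rfl fun k _ ↦ ?_
    rw [Complex.cpow_neg_one, ← Complex.ofReal_inv, ← Complex.ofReal_mul, Complex.ofReal_re,
      div_eq_mul_inv]
  have hab := Real.tendsto_tsum_powerSeries_nhdsWithin_lt hL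
  have ht : Tendsto (fun t : ℝ ↦ t * √p) (𝓝[<] 1) (𝓝 (√p)) := by
    have h := (Continuous.tendsto (show Continuous fun t : ℝ ↦ t * √p by fun_prop) 1).mono_left
      (nhdsWithin_le_nhds (s := Set.Iio 1))
    simpa using h
  refine tendsto_nhds_unique (ht.mul hab) ?_
  have h := tendsto_finsetSum (univ : Finset (ZMod p)) fun a _ ↦
    (tendsto_re_arctan (AddChar.norm_apply ZMod.stdAddChar a) (hre a)).const_mul
      (quadraticChar (ZMod p) a : ℝ)
  refine h.congr' ?_
  filter_upwards [Ioo_mem_nhdsLT (show (0 : ℝ) < 1 by norm_num)] with t ht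
  rw [← (hasSum_chiFourMul_arctan (p := p) hp ht.1 ht.2).tsum_eq, tsum_mul_left]

lemma ZMod.stdAddChar_natCast_re (p : ℕ) [NeZero p] (j : ℕ) :
    (ZMod.stdAddChar (j : ZMod p) : ℂ).re = Real.cos (2 * Real.pi * j / p) := by
  have h := ZMod.stdAddChar_coe (N := p) (j : ℤ)
  rw [Int.cast_natCast] at h
  rw [h, ← Complex.exp_ofReal_mul_I_re]
  congr 2
  push_cast
  ring

lemma Real.sign_cos_quarter {n j : ℕ} (hj : j < 4 * n + 1) :
    Real.sign (Real.cos (2 * Real.pi * j / (4 * n + 1 : ℕ))) =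
      if j ≤ n then 1 else if j ≤ 3 * n then -1 else 1 := by
  have hpi := Real.pi_pos
  have hN : (0 : ℝ) < (4 * n + 1 : ℕ) := by positivity
  have hj0 : (0 : ℝ) ≤ j := by positivity
  split_ifs with h1 h2
  · apply Real.sign_of_pos
    have h1 : (j : ℝ) ≤ n := by exact_mod_cast h1
    apply Real.cos_pos_of_mem_Ioo
    constructor
    · have : 0 ≤ 2 * Real.pi * j / (4 * n + 1 : ℕ) := by positivity
      linarith
    · rw [div_lt_iff₀ hN]
      push_cast
      nlinarith
  · apply Real.sign_of_neg
    have h1 : (n : ℝ) + 1 ≤ j := by exact_mod_cast not_le.1 h1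
    have h2 : (j : ℝ) ≤ 3 * n := by exact_mod_cast h2
    apply Real.cos_neg_of_pi_div_two_lt_of_lt
    · rw [lt_div_iff₀ hN]
      push_cast
      nlinarith
    · rw [div_lt_iff₀ hN]
      push_cast
      nlinarith
  · apply Real.sign_of_pos
    have h2 : 3 * (n : ℝ) + 1 ≤ j := by exact_mod_cast not_le.1 h2
    have h3 : (j : ℝ) + 1 ≤ 4 * n + 1 := by exact_mod_cast hj
    rw [← Real.cos_sub_two_pi]
    apply Real.cos_pos_of_mem_Ioo
    constructor
    · rw [lt_sub_iff_add_lt, lt_div_iff₀ hN]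
      push_cast
      nlinarith
    · rw [sub_lt_iff_lt_add, div_lt_iff₀ hN]
      push_cast
      nlinarith

/-- The sum of the quadratic character over the first quarter of the residues. -/
lemma pi_mul_sum_quadraticChar_quarter {n : ℕ} [Fact (4 * n + 1).Prime] :
    Real.pi * ∑ i ∈ range n, (quadraticChar (ZMod (4 * n + 1)) (i + 1 : ℕ) : ℝ) =
      √(4 * n + 1 : ℕ) * (abelL (chiFourMul (4 * n + 1)) 1).re := by
  have hp : (4 * n + 1) % 4 = 1 := by omega
  have hsign (a : ZMod (4 * n + 1)) : Real.sign (ZMod.stdAddChar a : ℂ).re =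
      if a.val ≤ n then 1 else if a.val ≤ 3 * n then -1 else 1 := by
    rw [← Real.sign_cos_quarter (ZMod.val_lt a), ← ZMod.stdAddChar_natCast_re, ZMod.natCast_zmod_val]
  rw [sqrt_mul_abelL_chiFourMul hp]
  swap
  · intro a ha
    have h := hsign a
    rw [ha, Real.sign_zero] at h
    split_ifs at h <;> norm_num at h
  simp only [hsign]
  rw [← ZMod.sum_range_natCast fun a : ZMod (4 * n + 1) ↦
    (quadraticChar (ZMod (4 * n + 1)) a : ℝ) *
      (Real.pi / 4 * if a.val ≤ n then 1 else if a.val ≤ 3 * n then -1 else 1)]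
  set g : ℕ → ℝ := fun j ↦ (quadraticChar (ZMod (4 * n + 1)) (j : ZMod (4 * n + 1)) : ℝ) with hg
  have h0 : g 0 = 0 := by simp [hg]
  have htot : ∑ j ∈ range (4 * n + 1), g j = 0 := by
    rw [ZMod.sum_range_natCast fun a : ZMod (4 * n + 1) ↦
      (quadraticChar (ZMod (4 * n + 1)) a : ℝ), ← Int.cast_sum, quadraticChar_sum_zero,
      Int.cast_zero]
    rw [ZMod.ringChar_zmod_n]
    omega
  have hlast : ∑ i ∈ range n, g (n + 1 + 2 * n + i) = ∑ i ∈ range n, g (i + 1) := by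
    rw [← sum_range_reflect]
    refine sum_congr rfl fun i hi ↦ ?_
    have hi := mem_range.1 hi
    have hcast : ((n + 1 + 2 * n + (n - 1 - i) : ℕ) : ZMod (4 * n + 1)) =
        -1 * ((i + 1 : ℕ) : ZMod (4 * n + 1)) := by
      rw [neg_one_mul, eq_neg_iff_add_eq_zero, ← Nat.cast_add,
        show n + 1 + 2 * n + (n - 1 - i) + (i + 1) = 4 * n + 1 by omega, ZMod.natCast_self]
    simp only [hg]
    rw [hcast, map_mul, quadraticChar_neg_one_of_mod_four hp, one_mul]
  have hsplit (F : ℕ → ℝ) : ∑ j ∈ range (4 * n + 1), F j =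
      ∑ j ∈ range (n + 1), F j + ∑ i ∈ range (2 * n), F (n + 1 + i) +
        ∑ i ∈ range n, F (n + 1 + 2 * n + i) := by
    rw [show 4 * n + 1 = n + 1 + 2 * n + n by ring, sum_range_add, sum_range_add]
  have hfirst : ∑ j ∈ range (n + 1), g j = ∑ i ∈ range n, g (i + 1) := by
    rw [sum_range_succ', h0, add_zero]
  rw [hsplit, hfirst, hlast] at htot
  rw [hsplit]
  have e1 : ∑ j ∈ range (n + 1), (quadraticChar (ZMod (4 * n + 1)) j : ℝ) *
      (Real.pi / 4 * if (j : ZMod (4 * n + 1)).val ≤ n then 1 else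
        if (j : ZMod (4 * n + 1)).val ≤ 3 * n then -1 else 1) =
      Real.pi / 4 * ∑ i ∈ range n, g (i + 1) := by
    rw [← hfirst, mul_sum]
    refine sum_congr rfl fun j hj ↦ ?_
    have hj := mem_range.1 hj
    rw [ZMod.val_natCast_of_lt (by omega), if_pos (by omega), mul_one, mul_comm]
  have e2 : ∑ i ∈ range (2 * n), (quadraticChar (ZMod (4 * n + 1)) (n + 1 + i : ℕ) : ℝ) *
      (Real.pi / 4 * if ((n + 1 + i : ℕ) : ZMod (4 * n + 1)).val ≤ n then 1 else
        if ((n + 1 + i : ℕ) : ZMod (4 * n + 1)).val ≤ 3 * n then -1 else 1) =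
      -(Real.pi / 4) * ∑ i ∈ range (2 * n), g (n + 1 + i) := by
    rw [mul_sum]
    refine sum_congr rfl fun j hj ↦ ?_
    have hj := mem_range.1 hj
    rw [ZMod.val_natCast_of_lt (by omega), if_neg (by omega), if_pos (by omega)]
    simp only [hg]
    ring
  have e3 : ∑ i ∈ range n, (quadraticChar (ZMod (4 * n + 1)) (n + 1 + 2 * n + i : ℕ) : ℝ) *
      (Real.pi / 4 * if ((n + 1 + 2 * n + i : ℕ) : ZMod (4 * n + 1)).val ≤ n then 1 else
        if ((n + 1 + 2 * n + i : ℕ) : ZMod (4 * n + 1)).val ≤ 3 * n then -1 else 1) =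
      Real.pi / 4 * ∑ i ∈ range n, g (i + 1) := by
    rw [← hlast, mul_sum]
    refine sum_congr rfl fun j hj ↦ ?_
    have hj := mem_range.1 hj
    rw [ZMod.val_natCast_of_lt (by omega), if_neg (by omega), if_neg (by omega), mul_one, mul_comm]
  rw [e1, e2, e3]
  linear_combination (Real.pi / 4) * htot

end QuarterSum

section QuarterCount

lemma isQR_iff_quadraticChar {p a : ℕ} [Fact p.Prime] (ha : (a : ZMod p) ≠ 0) :
    IsQR p a ↔ quadraticChar (ZMod p) a = 1 := by
  rw [quadraticChar_one_iff_isSquare ha, IsQR]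
  constructor
  · rintro ⟨x, hx⟩
    refine ⟨(x : ZMod p), ?_⟩
    have h := (ZMod.intCast_eq_intCast_iff _ _ _).2 hx
    push_cast at h
    rw [← h, sq]
  · rintro ⟨y, hy⟩
    refine ⟨(y.val : ℤ), (ZMod.intCast_eq_intCast_iff _ _ _).1 ?_⟩
    push_cast
    rw [ZMod.natCast_zmod_val, hy, sq]

lemma Ncount_four_eq {n : ℕ} [Fact (4 * n + 1).Prime] :
    (Ncount (4 * n + 1) 4 : ℝ) =
      ∑ i ∈ range n, (1 - (quadraticChar (ZMod (4 * n + 1)) (i + 1 : ℕ) : ℝ)) / 2 := by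
  classical
  have hne {a : ℕ} (h1 : 0 < a) (h2 : a < 4 * n + 1) : (a : ZMod (4 * n + 1)) ≠ 0 := by
    rw [Ne, ZMod.natCast_eq_zero_iff]
    exact Nat.not_dvd_of_pos_of_lt h1 h2
  have hset : (Icc 1 (4 * n + 1 - 1)).filter (fun a ↦ 4 ∣ a ∧ ¬ IsQR (4 * n + 1) a) =
      ((range n).filter fun i ↦ ¬ IsQR (4 * n + 1) (4 * (i + 1))).image fun i ↦ 4 * (i + 1) := by
    ext a
    simp only [mem_filter, mem_Icc, mem_image, mem_range]
    constructor
    · rintro ⟨⟨h1, h2⟩, ⟨m, rfl⟩, h3⟩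
      obtain ⟨k, rfl⟩ : ∃ k, m = k + 1 := ⟨m - 1, by omega⟩
      exact ⟨k, ⟨by omega, h3⟩, rfl⟩
    · rintro ⟨i, ⟨h1, h2⟩, rfl⟩
      exact ⟨⟨by omega, by omega⟩, dvd_mul_right _ _, h2⟩
  have hcard : Ncount (4 * n + 1) 4 =
      ((range n).filter fun i ↦ ¬ IsQR (4 * n + 1) (4 * (i + 1))).card := by
    rw [← card_image_of_injective _ (show Function.Injective fun i : ℕ ↦ 4 * (i + 1) from
      fun a b h ↦ by simp only [] at h; omega), ← hset, Ncount]
  rw [hcard, card_filter, Nat.cast_sum]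
  refine sum_congr rfl fun i hi ↦ ?_
  have hi := mem_range.1 hi
  have h0 : ((i + 1 : ℕ) : ZMod (4 * n + 1)) ≠ 0 := hne (by omega) (by omega)
  have hfour : quadraticChar (ZMod (4 * n + 1)) ((4 * (i + 1) : ℕ) : ZMod (4 * n + 1)) =
      quadraticChar (ZMod (4 * n + 1)) ((i + 1 : ℕ) : ZMod (4 * n + 1)) := by
    have h2 : ((2 : ℕ) : ZMod (4 * n + 1)) ≠ 0 := hne (by omega) (by omega)
    rw [show 4 * (i + 1) = 2 ^ 2 * (i + 1) by ring, Nat.cast_mul, map_mul, Nat.cast_pow,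
      quadraticChar_sq_one' h2, one_mul]
  rw [isQR_iff_quadraticChar (hne (by omega) (by omega)), hfour]
  rcases quadraticChar_dichotomy h0 with h | h <;> rw [h] <;> norm_num

lemma sub_Ncount_four {p : ℕ} [hp' : Fact p.Prime] (hp : p % 4 = 1) :
    ((p : ℝ) - 1) / 8 - Ncount p 4 = √p * (abelL (chiFourMul p) 1).re / (2 * Real.pi) := by
  obtain ⟨n, rfl⟩ : ∃ n, p = 4 * n + 1 := ⟨p / 4, by omega⟩
  rw [← pi_mul_sum_quadraticChar_quarter, Ncount_four_eq, ← sum_div, sum_sub_distrib]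
  have := Real.pi_ne_zero
  simp only [sum_const, card_range, nsmul_eq_mul, mul_one]
  push_cast
  field_simp
  ring

end QuarterCount

end

theorem stmt12 (ε : ℝ) (hε0 : 0 < ε) (hε : ε < 1 / 2) :
    ∃ C : ℝ, 0 < C ∧ ∀ p : ℕ, p.Prime → p % 4 = 1 →
      ((p : ℝ) - 1) / 8 - (Ncount p 4 : ℝ) ≥ C * (p : ℝ) ^ ((1 : ℝ) / 2 - ε) := by
  obtain ⟨c, hc, hL⟩ := exists_le_abelL_chiFourMul hε0 (by linarith)
  refine ⟨c * 4 ^ (-ε) / (2 * Real.pi), by positivity, fun p hp hp4 ↦ ?_⟩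
  have := Fact.mk hp
  have hp0 : (0 : ℝ) < p := by exact_mod_cast hp.pos
  have h := hL p hp4
  rw [sub_Ncount_four hp4, ge_iff_le, Real.sqrt_eq_rpow, sub_eq_add_neg, Real.rpow_add hp0,
    div_mul_eq_mul_div]
  push_cast at h
  rw [Real.mul_rpow (by norm_num) hp0.le] at h
  refine div_le_div_of_nonneg_right ?_ (by positivity)
  calc c * 4 ^ (-ε) * ((p : ℝ) ^ ((1 : ℝ) / 2) * (p : ℝ) ^ (-ε))
      = (p : ℝ) ^ ((1 : ℝ) / 2) * (c * (4 ^ (-ε) * (p : ℝ) ^ (-ε))) := by ring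
    _ ≤ _ := by gcongr
end

section
/- For every real $\epsilon$ with $0 < \epsilon < 1/2$ there exists a constant $C = C(\epsilon) > 0$ such that for every prime $p$ with $p \equiv 7 \pmod{8}$ one has $\frac{1}{2}\left\lfloor \frac{p-1}{4} \right\rfloor - N(p, S_4) \ge C\, p^{\frac{1}{2} - \epsilon}$ (as real numbers). -/
section

open Filter Topology Complex
open scoped ComplexOrder Nat

lemma sum_Icc_add_period {N : ℕ} [NeZero N] {χ : DirichletCharacter ℂ N} (hχ : χ ≠ 1) (n : ℕ) :
    ∑ k ∈ Finset.Icc 1 (n + N), χ k = ∑ k ∈ Finset.Icc 1 n, χ k := by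
  induction n with
  | zero =>
    have h : ∑ k ∈ Finset.range N, χ k = ∑ a : ZMod N, χ a := by
      refine Finset.sum_bij (fun k _ => (k : ZMod N)) (by simp) ?_ ?_ (by simp)
      · intro a ha b hb hab
        rw [ZMod.natCast_eq_natCast_iff'] at hab
        rwa [Nat.mod_eq_of_lt (Finset.mem_range.1 ha), Nat.mod_eq_of_lt (Finset.mem_range.1 hb)]
          at hab
      · intro b _
        exact ⟨b.val, Finset.mem_range.2 b.val_lt, by simp⟩
    rw [MulChar.sum_eq_zero_of_ne_one hχ] at h
    have h2 := Finset.sum_range_succ (fun k : ℕ => χ k) N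
    rw [Finset.sum_range_succ', h] at h2
    have h3 : ∑ k ∈ Finset.Icc 1 N, χ k = ∑ k ∈ Finset.range N, χ ((k + 1 : ℕ) : ZMod N) := by
      rw [Finset.range_eq_Ico, Finset.sum_Ico_add' (fun k : ℕ => χ k) 0 N 1]
      rfl
    simp only [Nat.cast_zero, CharP.cast_eq_zero] at h2
    simpa [h3] using h2
  | succ n ih =>
    rw [show n + 1 + N = (n + N) + 1 by ring, Finset.sum_Icc_succ_top (by omega),
      Finset.sum_Icc_succ_top (by omega), ih]
    congr 2
    push_cast
    simp

lemma norm_sum_Icc_le_self {N : ℕ} (χ : DirichletCharacter ℂ N) (n : ℕ) :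
    ‖∑ k ∈ Finset.Icc 1 n, χ k‖ ≤ n := by
  refine (norm_sum_le_of_le (f := fun k : ℕ => χ k) _ fun k _ => χ.norm_le_one _).trans ?_
  simp

lemma norm_sum_Icc_le_level {N : ℕ} [NeZero N] {χ : DirichletCharacter ℂ N} (hχ : χ ≠ 1) (n : ℕ) :
    ‖∑ k ∈ Finset.Icc 1 n, χ k‖ ≤ N := by
  have h : Function.Periodic (fun n : ℕ => ∑ k ∈ Finset.Icc 1 n, χ k) N := sum_Icc_add_period hχ
  have h1 := h.map_mod_nat n
  rw [← h1]
  refine (norm_sum_Icc_le_self χ _).trans ?_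
  exact_mod_cast (Nat.mod_lt n (NeZero.pos N)).le

lemma norm_sum_Icc_le_rpow {N : ℕ} [NeZero N] {χ : DirichletCharacter ℂ N} (hχ : χ ≠ 1)
    {δ : ℝ} (hδ : 0 ≤ δ) (hδ1 : δ ≤ 1) {t : ℝ} (ht : 0 < t) :
    ‖∑ k ∈ Finset.Icc 1 ⌊t⌋₊, χ k‖ ≤ (N : ℝ) ^ δ * t ^ (1 - δ) := by
  set x := ‖∑ k ∈ Finset.Icc 1 ⌊t⌋₊, χ k‖ with hx
  have hx0 : 0 ≤ x := norm_nonneg _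
  rcases hx0.eq_or_lt with h | h
  · rw [← h]; positivity
  calc x = x ^ δ * x ^ (1 - δ) := by rw [← Real.rpow_add h]; simp
    _ ≤ _ := by
      have h1 : x ≤ N := norm_sum_Icc_le_level hχ _
      have h2 : x ≤ t := (norm_sum_Icc_le_self χ _).trans (Nat.floor_le ht.le)
      have h3 : 0 ≤ 1 - δ := by linarith
      gcongr

/-- The partial sums of a Dirichlet character, as a function of a real variable. -/
noncomputable def charSum {N : ℕ} (χ : DirichletCharacter ℂ N) (t : ℝ) : ℂ :=
  ∑ k ∈ Finset.Icc 1 ⌊t⌋₊, χ k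

lemma measurable_charSum {N : ℕ} (χ : DirichletCharacter ℂ N) : Measurable (charSum χ) :=
  (measurable_from_top (f := fun n : ℕ => ∑ k ∈ Finset.Icc 1 n, χ k)).comp Nat.measurable_floor

lemma charSum_of_lt_one {N : ℕ} (χ : DirichletCharacter ℂ N) {t : ℝ} (ht : t < 1) :
    charSum χ t = 0 := by
  simp [charSum, Nat.floor_eq_zero.2 ht]

lemma differentiableAt_mellin_charSum {N : ℕ} [NeZero N] {χ : DirichletCharacter ℂ N}
    (hχ : χ ≠ 1) {s : ℂ} (hs : 0 < s.re) : DifferentiableAt ℂ (mellin (charSum χ)) (-s) := by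
  refine mellin_differentiableAt_of_isBigO_rpow (a := 0) (b := -s.re - 1) ?_ ?_ (by simpa) ?_
    (by simp)
  · refine MeasureTheory.LocallyIntegrable.locallyIntegrableOn ?_ _
    refine MeasureTheory.LocallyIntegrable.mono (MeasureTheory.locallyIntegrable_const (N : ℝ))
      (measurable_charSum χ).aestronglyMeasurable (.of_forall fun t => ?_)
    simpa [charSum] using norm_sum_Icc_le_level hχ ⌊t⌋₊
  · refine Asymptotics.IsBigO.of_bound N (.of_forall fun t => ?_)
    simpa [charSum] using norm_sum_Icc_le_level hχ ⌊t⌋₊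
  · refine Asymptotics.IsBigO.of_bound 1 ?_
    filter_upwards [Ioo_mem_nhdsGT (show (0 : ℝ) < 1 by norm_num)] with t ht
    rw [charSum_of_lt_one χ ht.2, norm_zero]
    positivity

lemma LFunction_eq_mul_integral {N : ℕ} [NeZero N] {χ : DirichletCharacter ℂ N} (hχ : χ ≠ 1)
    {s : ℂ} (hs : 0 < s.re) :
    χ.LFunction s = s * ∫ t in Set.Ioi (1 : ℝ), charSum χ t * (t : ℂ) ^ (-(s + 1)) := by
  have key (s : ℂ) : mellin (charSum χ) (-s) =
      ∫ t in Set.Ioi (1 : ℝ), charSum χ t * (t : ℂ) ^ (-(s + 1)) := by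
    rw [mellin]
    have : Set.Ioi (1 : ℝ) ⊆ Set.Ioi 0 := Set.Ioi_subset_Ioi zero_le_one
    rw [← MeasureTheory.setIntegral_eq_of_subset_of_ae_sdiff_eq_zero
      measurableSet_Ioi.nullMeasurableSet this]
    · refine MeasureTheory.setIntegral_congr_fun measurableSet_Ioi fun t _ => ?_
      simp only [smul_eq_mul]
      rw [mul_comm, neg_add']
    · have h1 : ∀ᵐ t : ℝ, t ≠ 1 := by simp [MeasureTheory.ae_iff]
      filter_upwards [h1] with t ht1 ht
      rw [charSum_of_lt_one χ, zero_mul]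
      exact lt_of_le_of_ne (by simpa [ht.1] using ht.2) ht1
  rw [← key]
  have hopen : IsOpen {s : ℂ | 0 < s.re} := isOpen_lt continuous_const continuous_re
  have hA : AnalyticOnNhd ℂ χ.LFunction {s | 0 < s.re} :=
    (DirichletCharacter.differentiable_LFunction hχ).differentiableOn.analyticOnNhd hopen
  have hB : AnalyticOnNhd ℂ (fun s => s * mellin (charSum χ) (-s)) {s | 0 < s.re} := by
    refine DifferentiableOn.analyticOnNhd (fun z hz => ?_) hopen
    refine DifferentiableAt.differentiableWithinAt ?_
    exact differentiableAt_id.mul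
      ((differentiableAt_mellin_charSum hχ hz).comp z differentiableAt_id.neg)
  refine hA.eqOn_of_preconnected_of_eventuallyEq hB (z₀ := 2) ?_ (by simp) ?_ hs
  · exact (convex_halfSpace_re_gt 0).isPreconnected
  · have h1 : {s : ℂ | 1 < s.re} ∈ 𝓝 (2 : ℂ) :=
      (isOpen_lt continuous_const continuous_re).mem_nhds (by simp)
    filter_upwards [h1] with z hz
    have hz0 : 0 < z.re := lt_trans one_pos hz
    rw [χ.LFunction_eq_LSeries hz, key, LSeries_eq_mul_integral (χ ·) le_rfl hz0
      (ZMod.LSeriesSummable_of_one_lt_re χ hz)]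
    · rfl
    · refine Asymptotics.IsBigO.of_bound N (.of_forall fun n => ?_)
      simpa using norm_sum_Icc_le_level hχ _

lemma norm_LFunction_le {N : ℕ} [NeZero N] {χ : DirichletCharacter ℂ N} (hχ : χ ≠ 1)
    {δ : ℝ} (hδ : 0 ≤ δ) (hδ1 : δ ≤ 1) {s : ℂ} (hs : 0 < s.re) (hs1 : 1 < s.re + δ) :
    ‖χ.LFunction s‖ ≤ ‖s‖ * ((N : ℝ) ^ δ / (s.re + δ - 1)) := by
  rw [LFunction_eq_mul_integral hχ hs, norm_mul]
  gcongr
  have h : ∀ t ∈ Set.Ioi (1 : ℝ), ‖charSum χ t * (t : ℂ) ^ (-(s + 1))‖ ≤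
      (N : ℝ) ^ δ * t ^ (-(s.re + δ)) := by
    intro t ht
    have ht0 : (0 : ℝ) < t := lt_trans one_pos ht
    rw [norm_mul, norm_cpow_eq_rpow_re_of_pos ht0]
    calc _ ≤ ((N : ℝ) ^ δ * t ^ (1 - δ)) * t ^ (-(s + 1)).re := by
          gcongr; exact norm_sum_Icc_le_rpow hχ hδ hδ1 ht0
      _ = _ := by
          rw [mul_assoc, ← Real.rpow_add ht0]
          congr 2
          simp; ring
  refine (MeasureTheory.norm_integral_le_of_norm_le ?_
    ((MeasureTheory.ae_restrict_iff' measurableSet_Ioi).2 (.of_forall h))).trans ?_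
  · exact (integrableOn_Ioi_rpow_of_lt (by linarith) one_pos).const_mul _
  · rw [MeasureTheory.integral_const_mul, integral_Ioi_rpow_of_lt (by linarith) one_pos,
      Real.one_rpow]
    refine le_of_eq ?_
    rw [show -(s.re + δ) + 1 = -(s.re + δ - 1) by ring, neg_div_neg_eq]
    ring

/-- The entire function `ζ(s) - 1 / (s - 1)`. -/
noncomputable def zetaRegular : ℂ → ℂ :=
  Function.update (fun s => riemannZeta s - 1 / (s - 1)) 1 Real.eulerMascheroniConstant

lemma differentiable_zetaRegular : Differentiable ℂ zetaRegular := by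
  rw [← differentiableOn_univ,
    ← differentiableOn_compl_singleton_and_continuousAt_iff (c := 1) univ_mem]
  refine ⟨fun s hs => ?_, ?_⟩
  · have hs1 : s ≠ 1 := by simpa using hs
    have h : DifferentiableAt ℂ (fun s => riemannZeta s - 1 / (s - 1)) s :=
      (differentiableAt_riemannZeta hs1).sub
        ((differentiableAt_const _).div (by fun_prop) (sub_ne_zero.2 hs1))
    refine (h.congr_of_eventuallyEq ?_).differentiableWithinAt
    filter_upwards [isOpen_ne.mem_nhds hs1] with z hz
    exact Function.update_of_ne hz _ _
  · rw [zetaRegular, continuousAt_update_same]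
    exact tendsto_riemannZeta_sub_one_div

/-- The data entering the argument of Estermann: `a` has nonnegative coefficients with `a 1 = 1` and
its Dirichlet series is the product of `ζ` with an entire function `G`. -/
structure IsZetaMul (a : ℕ → ℂ) (G : ℂ → ℂ) : Prop where
  nonneg : 0 ≤ a
  one : a 1 = 1
  abscissa_le : LSeries.abscissaOfAbsConv a ≤ 1
  differentiable : Differentiable ℂ G
  eq : ∀ s : ℂ, 1 < s.re → LSeries a s = riemannZeta s * G s

/-- The regular part of `ζ * G` at `1`. -/
noncomputable def regularPart (G : ℂ → ℂ) (s : ℂ) : ℂ := dslope G 1 s + zetaRegular s * G s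

lemma differentiable_regularPart {G : ℂ → ℂ} (hG : Differentiable ℂ G) :
    Differentiable ℂ (regularPart G) := by
  refine Differentiable.add ?_ (differentiable_zetaRegular.mul hG)
  rw [← differentiableOn_univ, differentiableOn_dslope univ_mem]
  exact hG.differentiableOn

lemma zeta_mul_eq (G : ℂ → ℂ) {s : ℂ} (hs : s ≠ 1) :
    riemannZeta s * G s = regularPart G s + G 1 * (s - 1)⁻¹ := by
  have : s - 1 ≠ 0 := sub_ne_zero.2 hs
  rw [regularPart, dslope_of_ne _ hs, zetaRegular, Function.update_of_ne hs, slope_def_field]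
  field_simp
  ring

/-- The Taylor coefficients, in powers of `2 - s`, of a function at the point `2`. -/
noncomputable def taylorTwo (f : ℂ → ℂ) (m : ℕ) : ℂ := (-1) ^ m * iteratedDeriv m f 2 / m !

lemma taylorTwo_inv (m : ℕ) : taylorTwo (fun s => (s - 1)⁻¹) m = 1 := by
  have h := congrFun (iter_deriv_inv_linear_sub m (1 : ℂ) 1) 2
  simp only [one_mul, one_pow, mul_one] at h
  rw [taylorTwo, iteratedDeriv_eq_iterate, h]
  have : (m ! : ℂ) ≠ 0 := by exact_mod_cast m.factorial_ne_zero
  rw [show (2 : ℂ) - 1 = 1 by norm_num, one_zpow, mul_one, ← mul_assoc, ← pow_add,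
    Even.neg_one_pow ⟨m, rfl⟩, one_mul, div_self this]

namespace IsZetaMul

variable {a : ℕ → ℂ} {G : ℂ → ℂ} (h : IsZetaMul a G)
include h

lemma taylorTwo_regularPart (m : ℕ) :
    taylorTwo (regularPart G) m = taylorTwo (LSeries a) m - G 1 := by
  have h1 : LSeries a =ᶠ[𝓝 2] fun s => regularPart G s + G 1 * (s - 1)⁻¹ := by
    have : {s : ℂ | 1 < s.re} ∈ 𝓝 (2 : ℂ) :=
      (isOpen_lt continuous_const continuous_re).mem_nhds (by simp)
    filter_upwards [this] with s hs
    rw [h.eq s hs, zeta_mul_eq]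
    rintro rfl
    simp at hs
  have h2 : ContDiffAt ℂ m (fun s : ℂ => (s - 1)⁻¹) 2 :=
    ContDiffAt.inv (by fun_prop) (by norm_num)
  have h3 := taylorTwo_inv m
  rw [taylorTwo] at h3
  rw [taylorTwo, taylorTwo, h1.iteratedDeriv_eq, iteratedDeriv_fun_add
    (differentiable_regularPart h.differentiable).contDiff.contDiffAt (contDiffAt_const.mul h2),
    iteratedDeriv_const_mul _ h2]
  linear_combination (-G 1) * h3

lemma abscissa_lt {x : ℝ} (hx : 1 < x) : LSeries.abscissaOfAbsConv a < x :=
  h.abscissa_le.trans_lt (by exact_mod_cast hx)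

lemma taylorTwo_nonneg (m : ℕ) : 0 ≤ taylorTwo (LSeries a) m := by
  have := LSeries.iteratedDeriv_alternating h.nonneg (h.abscissa_lt one_lt_two) m
  simp only [ofReal_ofNat] at this
  exact div_nonneg this (by exact_mod_cast (m !).zero_le)

lemma one_le_taylorTwo_zero : 1 ≤ (taylorTwo (LSeries a) 0).re := by
  have hs : LSeriesSummable a ((2 : ℝ) : ℂ) :=
    LSeriesSummable_of_abscissaOfAbsConv_lt_re (by simpa using h.abscissa_lt one_lt_two)
  have h1 : LSeries.term a ((2 : ℝ) : ℂ) 1 ≤ LSeries a ((2 : ℝ) : ℂ) :=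
    hs.le_tsum 1 fun n _ => LSeries.term_nonneg (h.nonneg n) 2
  have h2 : LSeries.term a ((2 : ℝ) : ℂ) 1 = 1 := by simp [h.one]
  rw [h2] at h1
  simpa [taylorTwo] using (Complex.le_def.1 h1).1

lemma norm_taylorTwo_le {M : ℝ} (hM : ∀ s ∈ Metric.sphere (2 : ℂ) (3 / 2), ‖regularPart G s‖ ≤ M)
    (m : ℕ) : ‖taylorTwo (regularPart G) m‖ ≤ M * (2 / 3) ^ m := by
  have h1 := norm_iteratedDeriv_le_of_forall_mem_sphere_norm_le m (by norm_num)
    (differentiable_regularPart h.differentiable).diffContOnCl hM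
  have h2 : (0 : ℝ) < m ! := by exact_mod_cast m.factorial_pos
  rw [taylorTwo, norm_div, norm_mul, norm_pow, norm_neg, norm_one, one_pow, one_mul,
    norm_natCast, div_le_iff₀ h2]
  refine h1.trans (le_of_eq ?_)
  rw [show (2 / 3 : ℝ) = (3 / 2)⁻¹ by norm_num, inv_pow]
  field_simp

lemma nonneg_apply_one : 0 ≤ G 1 := by
  obtain ⟨M, hM⟩ := (isCompact_sphere (2 : ℂ) (3 / 2)).exists_bound_of_continuousOn
    (differentiable_regularPart h.differentiable).continuous.continuousOn
  have h1 : Tendsto (taylorTwo (regularPart G)) atTop (𝓝 0) := by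
    refine squeeze_zero_norm (h.norm_taylorTwo_le hM) ?_
    simpa using (tendsto_pow_atTop_nhds_zero_of_lt_one (by norm_num : (0 : ℝ) ≤ 2 / 3)
      (by norm_num)).const_mul M
  have h2 : Tendsto (taylorTwo (LSeries a)) atTop (𝓝 (G 1)) := by
    have := h1.add_const (G 1)
    simp only [zero_add] at this
    exact this.congr fun m => by rw [h.taylorTwo_regularPart]; ring
  exact ge_of_tendsto' h2 h.taylorTwo_nonneg

lemma hasSum_regularPart (x : ℝ) :
    HasSum (fun m => ((taylorTwo (LSeries a) m).re - (G 1).re) * (2 - x) ^ m)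
      (regularPart G x).re ∧ (regularPart G x).im = 0 := by
  have h1 := hasSum_taylorSeries_of_entire (differentiable_regularPart h.differentiable) 2 x
  have h2 (m : ℕ) : (m ! : ℂ)⁻¹ • ((x : ℂ) - 2) ^ m • iteratedDeriv m (regularPart G) 2 =
      ((((taylorTwo (LSeries a) m).re - (G 1).re) * (2 - x) ^ m : ℝ) : ℂ) := by
    have e1 : ((taylorTwo (LSeries a) m).re : ℂ) = taylorTwo (LSeries a) m :=
      (Complex.eq_re_of_ofReal_le (r := 0) (by simpa using h.taylorTwo_nonneg m)).symm
    have e2 : ((G 1).re : ℂ) = G 1 :=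
      (Complex.eq_re_of_ofReal_le (r := 0) (by simpa using h.nonneg_apply_one)).symm
    push_cast
    rw [e1, e2, ← h.taylorTwo_regularPart, taylorTwo, show (x : ℂ) - 2 = (-1) * (2 - x) by ring,
      mul_pow, smul_eq_mul, smul_eq_mul]
    ring
  simp only [h2] at h1
  have h3 := Complex.hasSum_re h1
  simp only [ofReal_re] at h3
  refine ⟨h3, ?_⟩
  have := Complex.hasSum_im h1
  simp only [ofReal_im] at this
  exact (this.unique hasSum_zero)

end IsZetaMul

lemma le_of_hasSum_taylor {B : ℕ → ℝ} {l x M S : ℝ} (hB : ∀ m, 0 ≤ B m) (hB0 : 1 ≤ B 0)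
    (hl : 0 ≤ l) (hx : 1 < x) (hx1 : x ≤ 9 / 8) (hM : 1 ≤ M)
    (hbd : ∀ m, |B m - l| ≤ M * (2 / 3) ^ m) (hS : HasSum (fun m => (B m - l) * x ^ m) S)
    (hneg : S - l / (x - 1) ≤ 0) :
    (x - 1) / 4 * (8 * M) ^ (-((Real.log (4 / 3))⁻¹ * (x - 1))) ≤ l := by
  have hlog : 0 < Real.log (4 / 3) := Real.log_pos (by norm_num)
  set L : ℝ := Real.log (8 * M) * (Real.log (4 / 3))⁻¹ with hL
  have hlogM : 0 ≤ Real.log (8 * M) := Real.log_nonneg (by linarith)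
  have hL0 : 0 ≤ L := by positivity
  set K : ℕ := ⌊L⌋₊ + 1 with hK
  have hKL : L ≤ K := by rw [hK]; push_cast; exact (Nat.lt_floor_add_one L).le
  have hKL' : (K : ℝ) ≤ L + 1 := by
    rw [hK]; push_cast; linarith [Nat.floor_le hL0]
  have hx0 : 0 < x := by linarith
  have hpow1 : (8 * M) * (3 / 4) ^ K ≤ 1 := by
    have e : (8 * M) ≤ (4 / 3 : ℝ) ^ K := by
      rw [← Real.rpow_natCast, ← Real.log_le_log_iff (by linarith) (by positivity),
        Real.log_rpow (by norm_num)]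
      calc Real.log (8 * M) = L * Real.log (4 / 3) := by rw [hL]; field_simp
        _ ≤ _ := by gcongr
    calc (8 * M) * (3 / 4) ^ K ≤ (4 / 3 : ℝ) ^ K * (3 / 4) ^ K := by gcongr
      _ = 1 := by rw [← mul_pow]; norm_num
  have hpow2 : x ^ K ≤ 2 * (8 * M) ^ ((Real.log (4 / 3))⁻¹ * (x - 1)) := by
    calc x ^ K = x ^ (K : ℝ) := (Real.rpow_natCast _ _).symm
      _ ≤ x ^ (L + 1) := Real.rpow_le_rpow_of_exponent_le hx.le hKL'
      _ = x * x ^ L := by rw [Real.rpow_add hx0, Real.rpow_one, mul_comm]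
      _ ≤ 2 * x ^ L := by gcongr; linarith
      _ = 2 * (8 * M) ^ ((Real.log (4 / 3))⁻¹ * Real.log x) := by
        rw [Real.rpow_def_of_pos hx0, Real.rpow_def_of_pos (by linarith : 0 < 8 * M), hL]
        congr 2
        ring
      _ ≤ _ := by
        gcongr
        · linarith
        · exact Real.log_le_sub_one_of_pos hx0
  have htail : ∀ m, -(M * (3 / 4) ^ m) ≤ (B m - l) * x ^ m := by
    intro m
    have e1 : |(B m - l) * x ^ m| ≤ M * (3 / 4) ^ m := by
      rw [abs_mul, abs_of_pos (pow_pos hx0 m)]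
      calc |B m - l| * x ^ m ≤ (M * (2 / 3) ^ m) * (9 / 8) ^ m := by gcongr; exact hbd m
        _ = M * (3 / 4) ^ m := by rw [mul_assoc, ← mul_pow]; norm_num
    exact (abs_le.1 e1).1
  have hsum := (hasSum_nat_add_iff' K).2 hS
  have hgeo : HasSum (fun m => -(M * (3 / 4 : ℝ) ^ (m + K))) (-(M * (3 / 4) ^ K * 4)) := by
    have := (hasSum_geometric_of_lt_one (by norm_num : (0 : ℝ) ≤ 3 / 4) (by norm_num)).mul_left
      (M * (3 / 4) ^ K)
    have e : (fun m : ℕ => -(M * (3 / 4 : ℝ) ^ (m + K))) =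
        fun m => -(M * (3 / 4) ^ K * (3 / 4) ^ m) := by
      ext m; rw [pow_add]; ring
    rw [e, show M * (3 / 4 : ℝ) ^ K * 4 = M * (3 / 4) ^ K * (1 - 3 / 4)⁻¹ by norm_num]
    exact this.neg
  have h1 := hasSum_le (fun m => htail (m + K)) hgeo hsum
  have h2 : 1 - l * ((x ^ K - 1) / (x - 1)) ≤ ∑ m ∈ Finset.range K, (B m - l) * x ^ m := by
    simp only [sub_mul, Finset.sum_sub_distrib, ← Finset.mul_sum, geom_sum_eq hx.ne']
    gcongr
    rw [hK, Finset.sum_range_succ']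
    have : 0 ≤ ∑ k ∈ Finset.range ⌊L⌋₊, B (k + 1) * x ^ (k + 1) :=
      Finset.sum_nonneg fun k _ => mul_nonneg (hB _) (by positivity)
    simp only [pow_zero, mul_one]
    linarith
  have hx2 : 0 < x - 1 := by linarith
  have h3 : 1 / 2 ≤ l * x ^ K / (x - 1) := by
    have e : l * x ^ K / (x - 1) = l * ((x ^ K - 1) / (x - 1)) + l / (x - 1) := by
      field_simp; ring
    rw [e]
    linarith
  rw [le_div_iff₀ hx2] at h3
  have hP : 0 < (8 * M) ^ ((Real.log (4 / 3))⁻¹ * (x - 1)) := Real.rpow_pos_of_pos (by linarith) _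
  rw [Real.rpow_neg (by linarith), ← div_eq_mul_inv, div_le_iff₀ hP]
  have := mul_le_mul_of_nonneg_left hpow2 hl
  linarith

/-- **Inequality of Estermann**: a real point near `1` at which `ζ * G` is not positive forces
`G 1` to be bounded away from `0`. -/
theorem exists_le_apply_one_of_nonpos : ∃ A c : ℝ, 0 < A ∧ 0 < c ∧
    ∀ (a : ℕ → ℂ) (G : ℂ → ℂ) (M β : ℝ), IsZetaMul a G → 1 ≤ M →
      (∀ s ∈ Metric.closedBall (2 : ℂ) (3 / 2), ‖G s‖ ≤ M) → 7 / 8 ≤ β → β < 1 →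
      (riemannZeta β * G β).re ≤ 0 →
      (1 - β) / 4 * (A * M) ^ (-(c * (1 - β))) ≤ (G 1).re := by
  obtain ⟨Z, hZ⟩ := (isCompact_sphere (2 : ℂ) (3 / 2)).exists_bound_of_continuousOn
    differentiable_zetaRegular.continuous.continuousOn
  refine ⟨8 * (|Z| + 4), (Real.log (4 / 3))⁻¹, by positivity,
    inv_pos.2 (Real.log_pos (by norm_num)), fun a G M β h hM hbd hβ hβ1 hneg => ?_⟩
  have h1mem : (1 : ℂ) ∈ Metric.closedBall (2 : ℂ) (3 / 2) := by
    rw [Metric.mem_closedBall, dist_eq_norm]; norm_num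
  have hbd2 : ∀ s ∈ Metric.sphere (2 : ℂ) (3 / 2), ‖regularPart G s‖ ≤ (|Z| + 4) * M := by
    intro s hs
    have e0 : ‖s - 2‖ = 3 / 2 := by simpa [dist_eq_norm] using hs
    have e1 : 1 / 2 ≤ ‖s - 1‖ := by
      have := norm_sub_le (s - 1) 1
      rw [show s - 1 - 1 = s - 2 by ring, e0, norm_one] at this
      linarith
    have hs1 : s ≠ 1 := by rintro rfl; norm_num at e1
    have e2 : ‖G s‖ ≤ M := hbd s (Metric.sphere_subset_closedBall hs)
    rw [regularPart, dslope_of_ne _ hs1, slope_def_field]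
    calc _ ≤ ‖(G s - G 1) / (s - 1)‖ + ‖zetaRegular s * G s‖ := norm_add_le _ _
      _ ≤ (M + M) / (1 / 2) + |Z| * M := by
        rw [norm_div, norm_mul]
        gcongr
        · exact (norm_sub_le _ _).trans (add_le_add e2 (hbd 1 h1mem))
        · exact (hZ s hs).trans (le_abs_self Z)
      _ = _ := by ring
  have hre : (riemannZeta β * G β).re = (regularPart G β).re - (G 1).re / ((2 - β) - 1) := by
    have hβne : (β : ℂ) ≠ 1 := by exact_mod_cast hβ1.ne
    rw [zeta_mul_eq G hβne, add_re, ← ofReal_one, ← ofReal_sub, ← ofReal_inv, re_mul_ofReal,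
      show 2 - β - 1 = -(β - 1) by ring, div_neg, div_eq_mul_inv]
    ring
  have key := le_of_hasSum_taylor (B := fun m => (taylorTwo (LSeries a) m).re)
    (l := (G 1).re) (x := 2 - β) (M := (|Z| + 4) * M)
    (fun m => (Complex.le_def.1 (h.taylorTwo_nonneg m)).1) h.one_le_taylorTwo_zero
    (Complex.le_def.1 h.nonneg_apply_one).1 (by linarith) (by linarith)
    (by nlinarith [abs_nonneg Z]) (fun m => ?_) (h.hasSum_regularPart β).1 (by rwa [← hre])
  · rw [show 2 - β - 1 = 1 - β by ring, ← mul_assoc] at key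
    exact key
  · rw [← sub_re, ← h.taylorTwo_regularPart]
    exact (abs_re_le_norm _).trans (h.norm_taylorTwo_le hbd2 m)

/-- If `ζ * G` has no zero on `[β, 1)` and `G 1 ≠ 0`, then `ζ * G` is negative at `β`. -/
lemma IsZetaMul.nonpos_of_forall_ne_zero {a : ℕ → ℂ} {G : ℂ → ℂ} (h : IsZetaMul a G)
    (h1 : G 1 ≠ 0) {β : ℝ} (hβ : β < 1)
    (hne : ∀ x : ℝ, β ≤ x → x < 1 → riemannZeta x * G x ≠ 0) :
    (riemannZeta β * G β).re ≤ 0 := by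
  let k : ℝ → ℝ := fun x => (x - 1) * (regularPart G x).re + (G 1).re
  have hG1 : (G 1).im = 0 := (Complex.le_def.1 h.nonneg_apply_one).2.symm
  have hk : ∀ x : ℝ, x ≠ 1 → riemannZeta x * G x = ((k x / (x - 1) : ℝ) : ℂ) := by
    intro x hx
    have hx' : (x : ℂ) ≠ 1 := by exact_mod_cast hx
    have hx2 : x - 1 ≠ 0 := sub_ne_zero.2 hx
    have e1 : k x / (x - 1) = (regularPart G x).re + (G 1).re * (x - 1)⁻¹ := by
      simp only [k]; field_simp
    rw [zeta_mul_eq G hx', e1]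
    push_cast
    rw [Complex.conj_eq_iff_re.1 (Complex.conj_eq_iff_im.2 (h.hasSum_regularPart x).2),
      Complex.conj_eq_iff_re.1 (Complex.conj_eq_iff_im.2 hG1)]
  have hcont : Continuous k := by
    have : Continuous (regularPart G) := (differentiable_regularPart h.differentiable).continuous
    exact ((continuous_id.sub continuous_const).mul
      (Complex.continuous_re.comp (this.comp Complex.continuous_ofReal))).add continuous_const
  have hk2 : 0 < k 2 := by
    have e := hk 2 (by norm_num)
    rw [show ((2 : ℝ) : ℂ) = 2 by norm_num, ← h.eq 2 (by simp)] at e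
    have e2 := LSeries.positive h.nonneg (by rw [h.one]; exact one_pos) (h.abscissa_lt one_lt_two)
    rw [show ((2 : ℝ) : ℂ) = 2 by norm_num, e] at e2
    have := Complex.zero_lt_real.1 e2
    norm_num at this
    exact this
  have hkne : ∀ x ∈ Set.Icc β 2, k x ≠ 0 := by
    intro x hx hx0
    rcases lt_trichotomy x 1 with h2 | rfl | h2
    · exact hne x hx.1 h2 (by rw [hk x h2.ne, hx0]; simp)
    · simp only [k, sub_self, zero_mul, zero_add] at hx0
      exact h1 (Complex.ext hx0 hG1)
    · have e := hk x h2.ne'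
      have e2 := LSeries.positive h.nonneg (by rw [h.one]; exact one_pos) (h.abscissa_lt h2)
      rw [h.eq _ (by simpa using h2), e, hx0] at e2
      simp at e2
  have hkβ : 0 < k β := by
    by_contra hcon
    obtain ⟨x, hx, hx0⟩ := intermediate_value_Icc (by linarith : β ≤ 2) hcont.continuousOn
      ⟨not_lt.1 hcon, hk2.le⟩
    exact hkne x hx hx0
  rw [hk β hβ.ne, ofReal_re]
  exact div_nonpos_of_nonneg_of_nonpos hkβ.le (by linarith)

namespace DirichletCharacter

open ArithmeticFunction

variable {N N₁ N₂ N₃ : ℕ}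

lemma LSeriesSummable_toArithmeticFunction (χ : DirichletCharacter ℂ N) {s : ℂ} (hs : 1 < s.re) :
    LSeriesSummable (toArithmeticFunction (χ ·)) s :=
  (LSeriesSummable_congr s χ.apply_eq_toArithmeticFunction_apply).1
    (LSeriesSummable_of_one_lt_re χ hs)

lemma LSeries_toArithmeticFunction [NeZero N] (χ : DirichletCharacter ℂ N) {s : ℂ}
    (hs : 1 < s.re) : LSeries (toArithmeticFunction (χ ·)) s = χ.LFunction s := by
  rw [χ.LFunction_eq_LSeries hs]
  exact (LSeries_congr χ.apply_eq_toArithmeticFunction_apply s).symm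

lemma LSeries_zetaMul [NeZero N] (χ : DirichletCharacter ℂ N) {s : ℂ} (hs : 1 < s.re) :
    LSeries χ.zetaMul s = riemannZeta s * χ.LFunction s := by
  rw [← LSeries_toArithmeticFunction χ hs, ← LSeries_zeta_eq_riemannZeta hs]
  exact LSeries_mul' (LSeriesSummable_zeta_iff.2 hs) (LSeriesSummable_toArithmeticFunction χ hs)

lemma isZetaMul_zetaMul [NeZero N] {χ : DirichletCharacter ℂ N} (hχ : χ ≠ 1) (hχ2 : χ ^ 2 = 1) :
    IsZetaMul χ.zetaMul χ.LFunction where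
  nonneg := zetaMul_nonneg hχ2
  one := χ.isMultiplicative_zetaMul.map_one
  abscissa_le := LSeries.abscissaOfAbsConv_le_of_forall_lt_LSeriesSummable fun y hy =>
    LSeriesSummable_zetaMul χ (by simpa using hy)
  differentiable := differentiable_LFunction hχ
  eq _ hs := LSeries_zetaMul χ hs

/-- The coefficients of `ζ(s) L(s, χ₁) L(s, χ₂) L(s, χ₃)`. -/
noncomputable def zetaMulMulMul (χ₁ : DirichletCharacter ℂ N₁) (χ₂ : DirichletCharacter ℂ N₂)
    (χ₃ : DirichletCharacter ℂ N₃) : ArithmeticFunction ℂ :=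
  χ₁.zetaMul * (toArithmeticFunction (χ₂ ·) * toArithmeticFunction (χ₃ ·))

variable {χ₁ : DirichletCharacter ℂ N₁} {χ₂ : DirichletCharacter ℂ N₂}
  {χ₃ : DirichletCharacter ℂ N₃}

lemma toArithmeticFunction_mul_apply (h : ∀ n : ℕ, χ₃ n = χ₁ n * χ₂ n) (n : ℕ) :
    (toArithmeticFunction (χ₂ ·) * toArithmeticFunction (χ₃ ·)) n = χ₂ n * χ₁.zetaMul n := by
  rw [zetaMul, mul_apply, mul_apply, Finset.mul_sum]
  refine Finset.sum_congr rfl fun x hx => ?_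
  obtain ⟨h1, h2⟩ := Nat.mem_divisorsAntidiagonal.1 hx
  have h3 : x.1 ≠ 0 := by rintro h; simp [h] at h1; exact h2 h1.symm
  have h4 : x.2 ≠ 0 := by rintro h; simp [h] at h1; exact h2 h1.symm
  simp only [toArithmeticFunction, coe_mk, h3, h4, ↓reduceIte, natCoe_apply, zeta_apply, ← h1, h]
  push_cast
  rw [map_mul]
  ring

lemma isMultiplicative_zetaMulMulMul : (zetaMulMulMul χ₁ χ₂ χ₃).IsMultiplicative :=
  χ₁.isMultiplicative_zetaMul.mul
    ((isMultiplicative_toArithmeticFunction χ₂).mul (isMultiplicative_toArithmeticFunction χ₃))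

lemma zetaMulMulMul_comm : zetaMulMulMul χ₁ χ₂ χ₃ = zetaMulMulMul χ₂ χ₁ χ₃ := by
  simp only [zetaMulMulMul, zetaMul]
  ring

lemma zetaMulMulMul_prime_pow_nonneg_of_forall (h : ∀ n : ℕ, χ₃ n = χ₁ n * χ₂ n)
    (h1 : χ₁ ^ 2 = 1) {p : ℕ} (hp : p.Prime)
    (h2 : ∀ j, 0 ≤ χ₂ (p ^ j : ℕ) * χ₁.zetaMul (p ^ j)) (k : ℕ) :
    0 ≤ zetaMulMulMul χ₁ χ₂ χ₃ (p ^ k) := by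
  rw [zetaMulMulMul, mul_apply]
  refine Finset.sum_nonneg fun x hx => mul_nonneg (zetaMul_nonneg h1 _) ?_
  rw [toArithmeticFunction_mul_apply h]
  obtain ⟨j, -, hj⟩ := (Nat.dvd_prime_pow hp).1
    (Dvd.intro_left _ (Nat.mem_divisorsAntidiagonal.1 hx).1)
  rw [hj]
  exact h2 j

lemma zetaMulMulMul_prime_pow_nonneg_of_nonneg (h : ∀ n : ℕ, χ₃ n = χ₁ n * χ₂ n)
    (h1 : χ₁ ^ 2 = 1) {p : ℕ} (hp : p.Prime) (h2 : 0 ≤ χ₂ p) (k : ℕ) :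
    0 ≤ zetaMulMulMul χ₁ χ₂ χ₃ (p ^ k) := by
  refine zetaMulMulMul_prime_pow_nonneg_of_forall h h1 hp (fun j => ?_) k
  rw [Nat.cast_pow, map_pow]
  exact mul_nonneg (pow_nonneg h2 j) (zetaMul_nonneg h1 _)

lemma zetaMul_prime_pow_of_eq_neg_one {χ : DirichletCharacter ℂ N} {p : ℕ} (hp : p.Prime)
    (h : χ p = -1) (k : ℕ) : χ.zetaMul (p ^ k) = if _root_.Even (k + 1) then 0 else 1 := by
  rw [zetaMul, coe_zeta_mul_apply, Nat.sum_divisors_prime_pow hp, ← neg_one_geom_sum]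
  refine Finset.sum_congr rfl fun i _ => ?_
  simp [toArithmeticFunction, hp.ne_zero, h]

lemma zetaMulMulMul_prime_pow_nonneg (h : ∀ n : ℕ, χ₃ n = χ₁ n * χ₂ n)
    (h1 : χ₁ ^ 2 = 1) (h2 : χ₂ ^ 2 = 1) {p : ℕ} (hp : p.Prime) (k : ℕ) :
    0 ≤ zetaMulMulMul χ₁ χ₂ χ₃ (p ^ k) := by
  rcases MulChar.isQuadratic_iff_sq_eq_one.mpr h2 p with e | e | e
  · exact zetaMulMulMul_prime_pow_nonneg_of_nonneg h h1 hp e.ge k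
  · exact zetaMulMulMul_prime_pow_nonneg_of_nonneg h h1 hp (e ▸ zero_le_one) k
  have h' : ∀ n : ℕ, χ₃ n = χ₂ n * χ₁ n := fun n => by rw [h, mul_comm]
  rcases MulChar.isQuadratic_iff_sq_eq_one.mpr h1 p with e1 | e1 | e1
  · rw [zetaMulMulMul_comm]
    exact zetaMulMulMul_prime_pow_nonneg_of_nonneg h' h2 hp e1.ge k
  · rw [zetaMulMulMul_comm]
    exact zetaMulMulMul_prime_pow_nonneg_of_nonneg h' h2 hp (e1 ▸ zero_le_one) k
  · refine zetaMulMulMul_prime_pow_nonneg_of_forall h h1 hp (fun j => ?_) k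
    rw [Nat.cast_pow, map_pow, e, zetaMul_prime_pow_of_eq_neg_one hp e1]
    split_ifs with hj
    · simp
    · have : _root_.Even j := by rwa [Nat.even_add_one, not_not] at hj
      simp [this.neg_one_pow]

lemma zetaMulMulMul_nonneg (h : ∀ n : ℕ, χ₃ n = χ₁ n * χ₂ n)
    (h1 : χ₁ ^ 2 = 1) (h2 : χ₂ ^ 2 = 1) (n : ℕ) : 0 ≤ zetaMulMulMul χ₁ χ₂ χ₃ n := by
  rcases eq_or_ne n 0 with rfl | hn
  · simp
  · rw [isMultiplicative_zetaMulMulMul.multiplicative_factorization _ hn]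
    exact Finset.prod_nonneg fun p hp =>
      zetaMulMulMul_prime_pow_nonneg h h1 h2 (Nat.prime_of_mem_primeFactors hp) _

lemma isZetaMul_zetaMulMulMul [NeZero N₁] [NeZero N₂] [NeZero N₃]
    (h : ∀ n : ℕ, χ₃ n = χ₁ n * χ₂ n) (h1 : χ₁ ^ 2 = 1) (h2 : χ₂ ^ 2 = 1)
    (h1' : χ₁ ≠ 1) (h2' : χ₂ ≠ 1) (h3' : χ₃ ≠ 1) :
    IsZetaMul (zetaMulMulMul χ₁ χ₂ χ₃)
      fun s => χ₁.LFunction s * (χ₂.LFunction s * χ₃.LFunction s) where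
  nonneg := zetaMulMulMul_nonneg h h1 h2
  one := isMultiplicative_zetaMulMulMul.map_one
  abscissa_le := LSeries.abscissaOfAbsConv_le_of_forall_lt_LSeriesSummable fun y hy => by
    have hy' : 1 < (y : ℂ).re := by simpa using hy
    exact ArithmeticFunction.LSeriesSummable_mul (LSeriesSummable_zetaMul χ₁ hy')
      (ArithmeticFunction.LSeriesSummable_mul (LSeriesSummable_toArithmeticFunction χ₂ hy')
        (LSeriesSummable_toArithmeticFunction χ₃ hy'))
  differentiable := (differentiable_LFunction h1').mul
    ((differentiable_LFunction h2').mul (differentiable_LFunction h3'))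
  eq s hs := by
    rw [zetaMulMulMul, LSeries_mul' (LSeriesSummable_zetaMul χ₁ hs)
      (ArithmeticFunction.LSeriesSummable_mul (LSeriesSummable_toArithmeticFunction χ₂ hs)
        (LSeriesSummable_toArithmeticFunction χ₃ hs)),
      LSeries_mul' (LSeriesSummable_toArithmeticFunction χ₂ hs)
        (LSeriesSummable_toArithmeticFunction χ₃ hs), LSeries_zetaMul χ₁ hs,
      LSeries_toArithmeticFunction χ₂ hs, LSeries_toArithmeticFunction χ₃ hs, mul_assoc]

end DirichletCharacter

namespace DirichletCharacter

/-- The quadratic character modulo a prime, with complex values. -/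
noncomputable def quadratic (p : ℕ) [Fact p.Prime] : DirichletCharacter ℂ p :=
  (quadraticChar (ZMod p)).ringHomComp (Int.castRingHom ℂ)

lemma quadratic_sq (p : ℕ) [Fact p.Prime] : quadratic p ^ 2 = 1 := by
  rw [← MulChar.isQuadratic_iff_sq_eq_one]
  exact (quadraticChar_isQuadratic (ZMod p)).comp _

lemma quadratic_ne_one {p : ℕ} [Fact p.Prime] (hp : p ≠ 2) : quadratic p ≠ 1 :=
  MulChar.ringHomComp_ne_one_iff (Int.castRingHom ℂ).injective_int |>.2 <|
    quadraticChar_ne_one (by rwa [ZMod.ringChar_zmod_n])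

lemma exists_mul_of_coprime {M N : ℕ} [NeZero M] (h : M.Coprime N) {χ₁ : DirichletCharacter ℂ M}
    (χ₂ : DirichletCharacter ℂ N) (h1 : χ₁ ≠ 1) :
    ∃ χ₃ : DirichletCharacter ℂ (M * N), χ₃ ≠ 1 ∧ ∀ n : ℕ, χ₃ n = χ₁ n * χ₂ n := by
  have key (n : ℕ) : (changeLevel (dvd_mul_right M N) χ₁ * changeLevel (dvd_mul_left N M) χ₂) n =
      χ₁ n * χ₂ n := by
    rw [MulChar.mul_apply]
    by_cases hn : IsUnit (n : ZMod (M * N))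
    · obtain ⟨u, hu⟩ := hn
      rw [← hu, changeLevel_eq_cast_of_dvd, changeLevel_eq_cast_of_dvd, hu,
        ZMod.cast_natCast (dvd_mul_right M N), ZMod.cast_natCast (dvd_mul_left N M)]
    · rw [MulChar.map_nonunit _ hn, zero_mul]
      rw [ZMod.isUnit_iff_coprime, Nat.coprime_mul_iff_right, not_and_or,
        ← ZMod.isUnit_iff_coprime, ← ZMod.isUnit_iff_coprime] at hn
      rcases hn with hn | hn
      · rw [MulChar.map_nonunit _ hn, zero_mul]
      · rw [MulChar.map_nonunit _ hn, mul_zero]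
  refine ⟨_, fun h3 => ?_, key⟩
  obtain ⟨u, hu⟩ := MulChar.ne_one_iff.1 h1
  obtain ⟨n, hn1, hn2⟩ := Nat.chineseRemainder h (u : ZMod M).val 1
  have e1 : (n : ZMod M) = u := by
    rw [(ZMod.natCast_eq_natCast_iff _ _ _).2 hn1, ZMod.natCast_zmod_val]
  have e2 : (n : ZMod N) = 1 := by
    rw [(ZMod.natCast_eq_natCast_iff _ _ _).2 hn2, Nat.cast_one]
  have e3 := key n
  rw [h3, e1, e2, map_one, mul_one, MulChar.one_apply] at e3
  · exact hu e3.symm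
  · rw [ZMod.isUnit_iff_coprime, Nat.coprime_mul_iff_right, ← ZMod.isUnit_iff_coprime,
      ← ZMod.isUnit_iff_coprime, e1, e2]
    exact ⟨u.isUnit, isUnit_one⟩

lemma norm_LFunction_le_of_mem_closedBall {N : ℕ} [NeZero N] {χ : DirichletCharacter ℂ N}
    (hχ : χ ≠ 1) {s : ℂ} (hs : s ∈ Metric.closedBall (2 : ℂ) (3 / 2)) :
    ‖χ.LFunction s‖ ≤ 7 * N := by
  rw [Metric.mem_closedBall, dist_eq_norm] at hs
  have h1 : 1 / 2 ≤ s.re := by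
    have := (abs_le.1 ((abs_re_le_norm _).trans hs)).1
    simp only [sub_re, re_ofNat] at this
    linarith
  have h2 : ‖s‖ ≤ 7 / 2 := by
    have := norm_le_insert' s 2
    rw [show ‖(2 : ℂ)‖ = 2 by simp] at this
    linarith
  have h3 := norm_LFunction_le hχ zero_le_one le_rfl (s := s) (by linarith) (by linarith)
  rw [Real.rpow_one, add_sub_cancel_right] at h3
  have h0 : 0 < s.re := by linarith
  calc _ ≤ _ := h3
    _ ≤ 7 / 2 * (N / (1 / 2)) := by gcongr
    _ = 7 * N := by ring

/-- **Theorem of Siegel** for the quadratic characters of prime conductor. -/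
theorem exists_le_LFunction_quadratic_one {ε : ℝ} (hε : 0 < ε) (hε2 : ε ≤ 2) :
    ∃ C : ℝ, 0 < C ∧ ∀ (p : ℕ) [Fact p.Prime], p ≠ 2 →
      C * (p : ℝ) ^ (-ε) ≤ ((quadratic p).LFunction 1).re := by
  obtain ⟨A, c, hA, hc, key⟩ := exists_le_apply_one_of_nonpos
  set η := min (1 / 8) (ε / (4 * c)) with hη
  have hη0 : 0 < η := by positivity
  have hη1 : η ≤ 1 / 8 := min_le_left _ _
  have hη2 : 2 * c * η ≤ ε / 2 := by
    have : η ≤ ε / (4 * c) := min_le_right _ _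
    rw [le_div_iff₀ (by positivity)] at this
    linarith
  have hnn (p : ℕ) [Fact p.Prime] (hp : p ≠ 2) : 0 ≤ (quadratic p).LFunction 1 :=
    (isZetaMul_zetaMul (quadratic_ne_one hp) (quadratic_sq p)).nonneg_apply_one
  have hpow (p : ℕ) [Fact p.Prime] : (1 : ℝ) ≤ p := by
    exact_mod_cast (Fact.out : p.Prime).one_le
  by_cases hcase : ∃ (q : ℕ) (_ : Fact q.Prime) (β : ℝ), q ≠ 2 ∧ 1 - η ≤ β ∧ β < 1 ∧
      riemannZeta β * (quadratic q).LFunction β = 0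
  · obtain ⟨q, hq, β, hq2, hβ, hβ1, h0⟩ := hcase
    have hq1 := hpow q
    set C₁ := (1 - β) / 4 * (A * (343 * (q : ℝ) ^ 2)) ^ (-(c * (1 - β))) /
      (7 * q * ((q : ℝ) ^ (ε / 2) / (ε / 2)))
    have hC₁ : 0 < C₁ := by
      have : 0 < 1 - β := by linarith
      positivity
    have hL : 0 < ((quadratic q).LFunction 1).re :=
      (Complex.lt_def.1 ((hnn q hq2).lt_of_ne
        (LFunction_apply_one_ne_zero (quadratic_ne_one hq2)).symm)).1
    refine ⟨min C₁ ((quadratic q).LFunction 1).re, lt_min hC₁ hL, fun p hp hp2 => ?_⟩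
    have hp1 := hpow p
    have hp0 : (0 : ℝ) < p := by linarith
    by_cases hpq : p = q
    · subst hpq
      calc _ ≤ ((quadratic p).LFunction 1).re * 1 := by
            gcongr
            · exact min_le_right _ _
            · exact Real.rpow_le_one_of_one_le_of_nonpos hp1 (by linarith)
        _ = _ := mul_one _
    · obtain ⟨χ, hχ, hχm⟩ := exists_mul_of_coprime
        ((Nat.coprime_primes hq.out hp.out).2 (Ne.symm hpq)) (quadratic p) (quadratic_ne_one hq2)
      have hz := isZetaMul_zetaMulMulMul hχm (quadratic_sq q) (quadratic_sq p)
        (quadratic_ne_one hq2) (quadratic_ne_one hp2) hχ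
      have h1 := key _ _ (343 * (q : ℝ) ^ 2 * (p : ℝ) ^ 2) β hz ?_ ?_ (by linarith) hβ1 ?_
      · have hδ : ‖χ.LFunction 1‖ ≤ ((q : ℝ) ^ (ε / 2) / (ε / 2)) * (p : ℝ) ^ (ε / 2) := by
          have := norm_LFunction_le hχ (δ := ε / 2) (s := 1) (by linarith) (by linarith) (by simp)
            (by simpa)
          simp only [norm_one, one_mul, one_re, add_sub_cancel_left, Nat.cast_mul] at this
          rw [Real.mul_rpow (by positivity) (by positivity)] at this
          convert this using 1
          ring
        have hre : ‖(quadratic p).LFunction 1‖ = ((quadratic p).LFunction 1).re := by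
          have := Complex.eq_re_of_ofReal_le (r := 0) (by simpa using hnn p hp2)
          rw [this, norm_real, ofReal_re, Real.norm_of_nonneg (Complex.le_def.1 (hnn p hp2)).1]
        have hre0 := (Complex.le_def.1 (hnn p hp2)).1
        have hball : (1 : ℂ) ∈ Metric.closedBall (2 : ℂ) (3 / 2) := by
          rw [Metric.mem_closedBall, dist_eq_norm]; norm_num
        have h2 : (1 - β) / 4 * (A * (343 * (q : ℝ) ^ 2)) ^ (-(c * (1 - β))) *
            (p : ℝ) ^ (-(ε / 2)) ≤ 7 * q * (((quadratic p).LFunction 1).re *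
            (((q : ℝ) ^ (ε / 2) / (ε / 2)) * (p : ℝ) ^ (ε / 2))) := by
          calc _ ≤ (1 - β) / 4 * (A * (343 * (q : ℝ) ^ 2 * (p : ℝ) ^ 2)) ^ (-(c * (1 - β))) := by
                have e1 : (A * (343 * (q : ℝ) ^ 2 * (p : ℝ) ^ 2)) ^ (-(c * (1 - β))) =
                    (A * (343 * (q : ℝ) ^ 2)) ^ (-(c * (1 - β))) *
                      (p : ℝ) ^ (2 * -(c * (1 - β))) := by
                  rw [Real.rpow_mul hp0.le, Real.rpow_two,
                    ← Real.mul_rpow (by positivity) (by positivity)]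
                  ring_nf
                have : 0 < 1 - β := by linarith
                rw [e1, ← mul_assoc ((1 - β) / 4)]
                gcongr ?_ * ?_
                refine Real.rpow_le_rpow_of_exponent_le hp1 ?_
                nlinarith
            _ ≤ _ := h1
            _ ≤ _ := re_le_norm _
            _ ≤ _ := by
              rw [norm_mul, norm_mul, hre]
              gcongr
              · exact mul_nonneg hre0 (norm_nonneg _)
              · exact norm_LFunction_le_of_mem_closedBall (quadratic_ne_one hq2) hball
        have hp3 : 0 < (p : ℝ) ^ (ε / 2) := by positivity
        have hD : 0 < 7 * q * ((q : ℝ) ^ (ε / 2) / (ε / 2)) := by positivity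
        calc _ ≤ C₁ * (p : ℝ) ^ (-ε) := by gcongr; exact min_le_left _ _
          _ ≤ _ := by
            simp only [C₁]
            rw [div_mul_eq_mul_div, div_le_iff₀ hD, show -ε = -(ε / 2) + -(ε / 2) by ring,
              Real.rpow_add hp0, ← mul_assoc, Real.rpow_neg hp0.le (ε / 2), ← div_eq_mul_inv,
              ← div_eq_mul_inv, div_le_iff₀ hp3]
            rw [Real.rpow_neg hp0.le, ← div_eq_mul_inv] at h2
            linarith
      · have := one_le_pow₀ hq1 (n := 2)
        have := one_le_pow₀ hp1 (n := 2)
        nlinarith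
      · intro s hs
        rw [norm_mul, norm_mul]
        calc _ ≤ 7 * (q : ℝ) * (7 * p * (7 * (q * p : ℕ))) := by
              gcongr
              · exact norm_LFunction_le_of_mem_closedBall (quadratic_ne_one hq2) hs
              · exact norm_LFunction_le_of_mem_closedBall (quadratic_ne_one hp2) hs
              · exact norm_LFunction_le_of_mem_closedBall hχ hs
          _ = _ := by push_cast; ring
      · rw [← mul_assoc, h0]; simp
  · push Not at hcase
    refine ⟨η / 4 * (A * 7) ^ (-(c * η)), by positivity, fun p hp hp2 => ?_⟩
    have hp1 := hpow p
    have hp0 : (0 : ℝ) < p := by linarith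
    have hz := isZetaMul_zetaMul (quadratic_ne_one hp2) (quadratic_sq p)
    have h1 := key _ _ (7 * p) (1 - η) hz (by linarith)
      (fun s hs => norm_LFunction_le_of_mem_closedBall (quadratic_ne_one hp2) hs) (by linarith)
      (by linarith) (hz.nonpos_of_forall_ne_zero
        (LFunction_apply_one_ne_zero (quadratic_ne_one hp2)) (by linarith)
        fun x hx hx1 => hcase p hp x hp2 hx hx1)
    rw [sub_sub_cancel, ← mul_assoc, Real.mul_rpow (by positivity) hp0.le, ← mul_assoc] at h1
    refine le_trans ?_ h1
    gcongr
    nlinarith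

end DirichletCharacter

namespace DirichletCharacter

lemma tendsto_sum_range_div {N : ℕ} [NeZero N] {χ : DirichletCharacter ℂ N} (hχ : χ ≠ 1) :
    Tendsto (fun n => ∑ k ∈ Finset.range n, χ k / k) atTop (𝓝 (χ.LFunction 1)) := by
  let c : ℕ → ℂ := fun k => if k = 0 then 0 else χ k
  have hc (n : ℕ) : ∑ k ∈ Finset.Icc 0 n, c k = ∑ k ∈ Finset.Icc 1 n, χ k := by
    rw [← Finset.add_sum_Ioc_eq_sum_Icc n.zero_le]
    simp only [c, ↓reduceIte, zero_add]
    refine Finset.sum_congr rfl fun k hk => ?_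
    simp [(Finset.mem_Ioc.1 hk).1.ne']
  let f : ℝ → ℂ := fun t => (t : ℂ)⁻¹
  have hd : ∀ t ∈ Set.Ici (1 : ℝ), HasDerivAt f (-((t : ℂ) ^ 2)⁻¹) t := fun t ht =>
    (hasDerivAt_inv (by
      have : (1 : ℝ) ≤ t := ht
      exact_mod_cast (by linarith : t ≠ 0))).comp_ofReal
  have hb (n : ℕ) : ‖∑ k ∈ Finset.Icc 0 n, c k‖ ≤ N := by
    rw [hc]; exact norm_sum_Icc_le_level hχ n
  have h1 := tendsto_sum_mul_atTop_nhds_one_sub_integral₀ (f := f) (c := c) (l := 0)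
    (g := fun t => t ^ (-2 : ℝ)) (by simp [c]) (fun t ht => (hd t ht).differentiableAt) ?_ ?_ ?_ ?_
  · rw [LFunction_eq_mul_integral hχ (by simp)]
    rw [← tendsto_add_atTop_iff_nat 1]
    convert h1 using 2
    · rw [Finset.range_eq_Ico]
      refine Finset.sum_congr (by ext; simp) fun k _ => ?_
      rcases eq_or_ne k 0 with rfl | hk
      · simp [f]
      · simp [f, c, hk, div_eq_inv_mul]
    · rw [one_mul, zero_sub, ← MeasureTheory.integral_neg]
      refine MeasureTheory.setIntegral_congr_fun measurableSet_Ioi fun t ht => ?_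
      have ht1 : (1 : ℝ) < t := ht
      simp only [hc, charSum]
      rw [(hd t ht1.le).deriv, show (-(1 + 1) : ℂ) = ((-2 : ℤ) : ℂ) by norm_num,
        cpow_intCast, zpow_neg, neg_mul, neg_neg, mul_comm]
      norm_cast
  · refine ContinuousOn.locallyIntegrableOn ?_ measurableSet_Ici
    refine ContinuousOn.congr (f := fun t : ℝ => (-((t : ℂ) ^ 2)⁻¹)) ?_ fun t ht => (hd t ht).deriv
    refine ContinuousOn.neg (ContinuousOn.inv₀ (by fun_prop) fun t ht => ?_)
    have : (1 : ℝ) ≤ t := ht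
    exact pow_ne_zero 2 (by exact_mod_cast (by linarith : t ≠ 0))
  · refine squeeze_zero_norm (a := fun n : ℕ => (N : ℝ) / n) (fun n => ?_)
      (tendsto_const_div_atTop_nhds_zero_nat _)
    rw [norm_mul, div_eq_inv_mul]
    gcongr
    · simp [f]
    · exact hb n
  · refine Asymptotics.IsBigO.of_bound N ?_
    filter_upwards [eventually_ge_atTop (1 : ℝ)] with t ht
    have ht0 : 0 < t := by linarith
    rw [(hd t ht).deriv, norm_mul, mul_comm]
    gcongr
    · exact hb _
    · rw [norm_neg, norm_inv, norm_pow, norm_real, Real.norm_of_nonneg ht0.le,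
        Real.norm_of_nonneg (by positivity), Real.rpow_neg ht0.le, Real.rpow_two]
  · exact ⟨Set.Ioi 1, Ioi_mem_atTop 1, integrableOn_Ioi_rpow_of_lt (by norm_num) one_pos⟩

end DirichletCharacter

lemma arg_one_sub_exp {x : ℝ} (hx : 0 < x) (hx1 : x < 1) :
    arg (1 - exp (2 * Real.pi * I * x)) = Real.pi * x - Real.pi / 2 := by
  have hs : 0 < Real.sin (Real.pi * x) :=
    Real.sin_pos_of_pos_of_lt_pi (by positivity) (by nlinarith [Real.pi_pos])
  have h : 1 - exp (2 * Real.pi * I * x) = ((2 * Real.sin (Real.pi * x) : ℝ) : ℂ) *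
      (cos (Real.pi * x - Real.pi / 2 : ℝ) + sin (Real.pi * x - Real.pi / 2 : ℝ) * I) := by
    rw [show (2 * Real.pi * I * x : ℂ) = ((2 * (Real.pi * x) : ℝ) : ℂ) * I by push_cast; ring,
      exp_mul_I, ← ofReal_cos, ← ofReal_cos, ← ofReal_sin, ← ofReal_sin, Real.cos_sub_pi_div_two,
      Real.sin_sub_pi_div_two, Real.cos_two_mul, Real.sin_two_mul, Real.cos_sq']
    push_cast
    ring
  rw [h, arg_mul_cos_add_sin_mul_I (by positivity)]
  constructor <;> nlinarith [Real.pi_pos]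

lemma stdAddChar_ne_one {N : ℕ} [NeZero N] {a : ZMod N} (ha : a ≠ 0) :
    ZMod.stdAddChar a ≠ (1 : ℂ) := by
  rw [← AddChar.map_zero_eq_one (ZMod.stdAddChar (N := N))]
  exact fun h => ha (ZMod.injective_stdAddChar h)

lemma norm_stdAddChar {N : ℕ} [NeZero N] (a : ZMod N) : ‖(ZMod.stdAddChar a : ℂ)‖ = 1 := by
  rw [ZMod.stdAddChar_apply, Circle.norm_coe]

lemma one_sub_mem_slitPlane {z : ℂ} (hz : ‖z‖ = 1) (h1 : z ≠ 1) : 1 - z ∈ slitPlane := by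
  by_cases h : z.re = 1
  · right
    simp only [sub_im, one_im, zero_sub, ne_eq, neg_eq_zero]
    exact fun h2 => h1 (Complex.ext h h2)
  · left
    have := (re_le_norm z).lt_of_ne (by rwa [hz])
    simp
    linarith

namespace DirichletCharacter

lemma apply_zero_of_ne_one {N : ℕ} [NeZero N] {χ : DirichletCharacter ℂ N} (hχ : χ ≠ 1) :
    χ 0 = 0 := by
  rcases eq_or_ne N 1 with rfl | hN
  · exact absurd (level_one χ) hχ
  · have : Fact (1 < N) := ⟨by have := NeZero.ne N; omega⟩
    exact MulChar.map_nonunit χ not_isUnit_zero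

lemma gaussSum_mul_LFunction_inv {N : ℕ} [NeZero N] {χ : DirichletCharacter ℂ N}
    (hχ : χ ≠ 1) (hp : χ.IsPrimitive) :
    gaussSum χ ZMod.stdAddChar * χ⁻¹.LFunction 1 =
      -∑ a : ZMod N, χ a * log (1 - ZMod.stdAddChar a) := by
  have hχ' : χ⁻¹ ≠ 1 := by rwa [ne_eq, inv_eq_one]
  have h0 : χ 0 = 0 := apply_zero_of_ne_one hχ
  have h1 := (Complex.tendsto_tsum_powerSeries_nhdsWithin_lt (tendsto_sum_range_div hχ')).const_mul
    (gaussSum χ ZMod.stdAddChar)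
  rw [tendsto_map'_iff] at h1
  have h2 : Tendsto (fun r : ℝ => -∑ a : ZMod N, χ a * log (1 - r * ZMod.stdAddChar a))
      (𝓝[<] 1) (𝓝 (-∑ a : ZMod N, χ a * log (1 - ZMod.stdAddChar a))) := by
    refine (tendsto_finsetSum _ fun a _ => ?_).neg
    rcases eq_or_ne a 0 with rfl | ha
    · simp [h0]
    · have : ContinuousAt (fun r : ℝ => χ a * log (1 - r * ZMod.stdAddChar a)) 1 := by
        refine continuousAt_const.mul (ContinuousAt.clog (by fun_prop) ?_)
        rw [ofReal_one, one_mul]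
        exact one_sub_mem_slitPlane (norm_stdAddChar a) (stdAddChar_ne_one ha)
      simpa using this.tendsto.mono_left nhdsWithin_le_nhds
  refine tendsto_nhds_unique (h1.congr' ?_) h2
  filter_upwards [Ioo_mem_nhdsLT (show (0 : ℝ) < 1 by norm_num)] with r hr
  have h3 (a : ZMod N) : HasSum (fun n : ℕ => χ a * ((r * ZMod.stdAddChar a) ^ n / n))
      (χ a * -log (1 - r * ZMod.stdAddChar a)) := by
    refine (hasSum_taylorSeries_neg_log ?_).mul_left _
    rw [norm_mul, norm_stdAddChar, mul_one, norm_real, Real.norm_of_nonneg hr.1.le]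
    exact hr.2
  have h4 := hasSum_sum (s := Finset.univ) fun a _ => h3 a
  simp only [mul_neg, Finset.sum_neg_distrib] at h4
  rw [← h4.tsum_eq, Function.comp_apply, ← tsum_mul_left]
  refine tsum_congr fun n => ?_
  have h5 := gaussSum_mulShift_of_isPrimitive ZMod.stdAddChar hp (n : ZMod N)
  rw [gaussSum] at h5
  calc _ = (χ⁻¹ n * gaussSum χ ZMod.stdAddChar) * ((r : ℂ) ^ n / n) := by ring
    _ = _ := by
      rw [← h5, Finset.sum_mul]
      refine Finset.sum_congr rfl fun a _ => ?_
      rw [AddChar.mulShift_apply, ← nsmul_eq_mul, AddChar.map_nsmul_eq_pow, mul_pow]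
      ring

lemma sum_mul_eq_zero_of_odd_of_even {N : ℕ} [NeZero N] {χ : DirichletCharacter ℂ N}
    (hχ : χ.Odd) {f : ZMod N → ℂ} (hf : ∀ a, f (-a) = f a) : ∑ a, χ a * f a = 0 := by
  have h : ∑ a, χ a * f a = ∑ a, χ (-a) * f (-a) :=
    (Equiv.sum_comp (Equiv.neg (ZMod N)) fun a => χ a * f a).symm
  simp only [hχ.eval_neg, hf, neg_mul, Finset.sum_neg_distrib] at h
  exact self_eq_neg.1 h

lemma stdAddChar_neg {N : ℕ} [NeZero N] (a : ZMod N) :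
    (ZMod.stdAddChar (-a) : ℂ) = (starRingEnd ℂ) (ZMod.stdAddChar a) := by
  rw [AddChar.map_neg_eq_inv, Complex.inv_def, Complex.normSq_eq_norm_sq, norm_stdAddChar]
  simp

/-- The value at `1` of the `L`-function of an odd primitive Dirichlet character. -/
theorem gaussSum_mul_LFunction_inv_of_odd {N : ℕ} [NeZero N] {χ : DirichletCharacter ℂ N}
    (hχ : χ ≠ 1) (hp : χ.IsPrimitive) (ho : χ.Odd) :
    gaussSum χ ZMod.stdAddChar * χ⁻¹.LFunction 1 =
      -(Real.pi * I / N * ∑ a : ZMod N, χ a * a.val) := by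
  have h0 : χ 0 = 0 := apply_zero_of_ne_one hχ
  rw [gaussSum_mul_LFunction_inv hχ hp]
  congr 1
  have h1 (a : ZMod N) : χ a * log (1 - ZMod.stdAddChar a) =
      χ a * (Real.log ‖(1 - ZMod.stdAddChar a : ℂ)‖ : ℝ) +
      (Real.pi * I / N * (χ a * a.val) - Real.pi * I / 2 * χ a) := by
    rcases eq_or_ne a 0 with rfl | ha
    · simp [h0]
    have hN : (0 : ℝ) < N := by exact_mod_cast NeZero.pos N
    have h2 : arg (1 - ZMod.stdAddChar a) = Real.pi * (a.val / N) - Real.pi / 2 := by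
      rw [ZMod.stdAddChar_apply, ZMod.toCircle_apply, ← arg_one_sub_exp]
      · push_cast
        rw [mul_div_assoc]
      · have : (0 : ℝ) < a.val := by exact_mod_cast ZMod.val_pos.2 ha
        positivity
      · rw [div_lt_one hN]
        exact_mod_cast a.val_lt
    rw [log, h2]
    push_cast
    ring
  simp only [h1, Finset.sum_add_distrib, Finset.sum_sub_distrib, ← Finset.mul_sum,
    MulChar.sum_eq_zero_of_ne_one hχ]
  rw [sum_mul_eq_zero_of_odd_of_even ho]
  · ring
  · intro a
    rw [stdAddChar_neg, ← map_one (starRingEnd ℂ), ← map_sub, norm_conj, map_one]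

end DirichletCharacter

namespace Polynomial

lemma coeff_card_prod_of_coeff_zero_eq_zero {R ι : Type*} [CommRing R] (s : Finset ι) (f : ι → R[X])
    (hf : ∀ i ∈ s, (f i).coeff 0 = 0) :
    (∏ i ∈ s, f i).coeff s.card = ∏ i ∈ s, (f i).coeff 1 := by
  have h : ∏ i ∈ s, f i = X ^ s.card * ∏ i ∈ s, (f i).divX := by
    rw [← Finset.prod_const, ← Finset.prod_mul_distrib]
    refine Finset.prod_congr rfl fun i hi => ?_
    conv_lhs => rw [← X_mul_divX_add (f i), hf i hi, C_0, add_zero]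
  have h1 := coeff_X_pow_mul (∏ i ∈ s, (f i).divX) s.card 0
  rw [zero_add, ← h] at h1
  rw [h1, coeff_zero_prod]
  simp [coeff_divX]

end Polynomial

section GaussSumSign

open Polynomial

variable {p : ℕ} [Fact p.Prime]

lemma factorial_mul_sum_pow_mul_choose (hp : p ≠ 2) :
    ((p / 2)! : ZMod p) * ∑ x : ZMod p, x ^ (p / 2) * (x.val.choose (p / 2) : ZMod p) = -1 := by
  have hodd : 2 * (p / 2) + 1 = p := Nat.two_mul_div_two_add_one_of_odd
    ((Fact.out : p.Prime).odd_of_ne_two hp)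
  have hp1 := (Fact.out : p.Prime).one_lt
  set n := p / 2 with hn
  have hn0 : 0 < n := by omega
  have h1 (x : ZMod p) : (n ! : ZMod p) * (x ^ n * (x.val.choose n : ZMod p)) =
      ∑ i ∈ Finset.range (n + 1), (descPochhammer (ZMod p) n).coeff i * x ^ (n + i) := by
    have h2 : (n ! : ZMod p) * (x.val.choose n : ZMod p) = (descPochhammer (ZMod p) n).eval x := by
      conv_rhs => rw [← ZMod.natCast_zmod_val x]
      rw [descPochhammer_eval_eq_descFactorial, Nat.descFactorial_eq_factorial_mul_choose]
      push_cast
      rfl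
    rw [mul_left_comm, h2, eval_eq_sum_range, descPochhammer_natDegree, Finset.mul_sum]
    exact Finset.sum_congr rfl fun i _ => by ring
  rw [Finset.mul_sum]
  simp only [h1]
  rw [Finset.sum_comm, Finset.sum_range_succ]
  simp only [← Finset.mul_sum]
  rw [Finset.sum_eq_zero]
  · have h3 : (descPochhammer (ZMod p) n).coeff n = 1 := by
      have := (monic_descPochhammer (ZMod p) n).coeff_natDegree
      rwa [descPochhammer_natDegree] at this
    have h4 (x : ZMod p) : x ^ (n + n) = if x = 0 then 0 else 1 := by
      split_ifs with h
      · rw [h, zero_pow (by omega)]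
      · rw [← ZMod.pow_card_sub_one_eq_one h]
        congr 1
        omega
    simp only [h3, h4, one_mul, zero_add]
    rw [Finset.sum_ite, Finset.sum_const_zero, zero_add, Finset.sum_const, Finset.filter_ne',
      Finset.card_erase_of_mem (Finset.mem_univ _), Finset.card_univ, ZMod.card, nsmul_one,
      Nat.cast_sub hp1.le]
    simp
  · intro i hi
    rw [FiniteField.sum_pow_lt_card_sub_one, mul_zero]
    rw [ZMod.card]
    have := Finset.mem_range.1 hi
    omega

lemma two_pow_half_eq_one (hp : p % 8 = 7) : (2 : ZMod p) ^ (p / 2) = 1 := by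
  have h2 : p ≠ 2 := by omega
  have h := (ZMod.exists_sq_eq_two_iff h2).2 (Or.inr hp)
  have h20 : (2 : ZMod p) ≠ 0 := by
    have := (ZMod.natCast_eq_zero_iff 2 p).not.2 fun h => by
      have := Nat.le_of_dvd two_pos h
      omega
    exact_mod_cast this
  exact (ZMod.euler_criterion p h20).1 h

lemma factorial_half_sq_ne (hp : p % 4 = 3) : ((p / 2)! : ZMod p) * ((p / 2)! : ZMod p) ≠ -1 :=
  fun h => (ZMod.exists_sq_eq_neg_one_iff (p := p)).1 ⟨_, h.symm⟩ hp

/-- Modulo `p`, `∑ χ(x) X ^ x` and `∏ (X ^ k - X ^ (p - k))` differ in their order `p / 2` term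
at `1`. -/
lemma not_cyclotomic_dvd (hp : p % 8 = 7) :
    ¬ cyclotomic p ℤ ∣ ∑ x : ZMod p, C (quadraticChar (ZMod p) x) * X ^ x.val -
      ∏ k ∈ Finset.range (p / 2), (X ^ (k + 1) - X ^ (p - (k + 1))) := by
  intro h
  have h2 : p ≠ 2 := by omega
  have h1 := _root_.map_dvd (taylorAlgHom (1 : ZMod p))
    (Polynomial.map_dvd (Int.castRingHom (ZMod p)) h)
  have h3 : X ^ (p / 2 + 1) ∣ taylorAlgHom (1 : ZMod p) (cyclotomic p (ZMod p)) := by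
    have h4 : cyclotomic p (ZMod p) = (X - 1) ^ (p - 1) := by
      refine mul_right_cancel₀ (X_sub_C_ne_zero (1 : ZMod p)) ?_
      rw [C_1, cyclotomic_prime_mul_X_sub_one, ← pow_succ,
        Nat.sub_add_cancel (Fact.out : p.Prime).one_le, sub_pow_char, one_pow]
    rw [h4, map_pow, map_sub, map_one, taylorAlgHom_apply, taylor_X, C_1, add_sub_cancel_right]
    exact pow_dvd_pow _ (by omega)
  rw [map_cyclotomic] at h1
  have h4 := X_pow_dvd_iff.1 (h3.trans h1) (p / 2) (Nat.lt_succ_self _)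
  have h5 : (taylor (1 : ZMod p) (∏ k ∈ Finset.range (p / 2),
      (X ^ (k + 1) - X ^ (p - (k + 1))))).coeff (p / 2) = (p / 2)! := by
    have := coeff_card_prod_of_coeff_zero_eq_zero (R := ZMod p) (Finset.range (p / 2))
      (fun k => taylor 1 (X ^ (k + 1) - X ^ (p - (k + 1)))) fun k _ => by
        rw [taylor_coeff_zero]; simp
    rw [Finset.card_range] at this
    rw [← taylorAlgHom_apply, map_prod]
    simp only [taylorAlgHom_apply]
    rw [this]
    calc _ = ∏ k ∈ Finset.range (p / 2), (2 * ((k + 1 : ℕ) : ZMod p)) := by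
          refine Finset.prod_congr rfl fun k hk => ?_
          have := Finset.mem_range.1 hk
          rw [taylor_coeff_one, derivative_sub, derivative_X_pow, derivative_X_pow]
          rw [Nat.cast_sub (by omega)]
          simp
          ring
      _ = _ := by
        rw [Finset.prod_mul_distrib, Finset.prod_const, Finset.card_range, two_pow_half_eq_one hp,
          one_mul, ← Nat.cast_prod, Finset.prod_range_add_one_eq_factorial]
  have h6 : (taylor (1 : ZMod p) (∑ x : ZMod p,
      C ((quadraticChar (ZMod p) x : ℤ) : ZMod p) * X ^ x.val)).coeff (p / 2) =
      ∑ x : ZMod p, x ^ (p / 2) * (x.val.choose (p / 2) : ZMod p) := by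
    rw [map_sum, finsetSum_coeff]
    refine Finset.sum_congr rfl fun x _ => ?_
    rw [taylor_coeff, quadraticChar_eq_pow_of_char_ne_two' (by rwa [ZMod.ringChar_zmod_n]),
      ZMod.card, C_mul_X_pow_eq_monomial, hasseDeriv_monomial]
    simp [mul_comm]
  have h7 : Polynomial.map (Int.castRingHom (ZMod p))
      (∑ x : ZMod p, C (quadraticChar (ZMod p) x) * X ^ x.val -
        ∏ k ∈ Finset.range (p / 2), (X ^ (k + 1) - X ^ (p - (k + 1)))) =
      ∑ x : ZMod p, C ((quadraticChar (ZMod p) x : ℤ) : ZMod p) * X ^ x.val -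
        ∏ k ∈ Finset.range (p / 2), (X ^ (k + 1) - X ^ (p - (k + 1))) := by
    simp [Polynomial.map_sum, Polynomial.map_prod]
  rw [h7, taylorAlgHom_apply, map_sub, coeff_sub] at h4
  rw [h6, h5, sub_eq_zero] at h4
  have := factorial_mul_sum_pow_mul_choose h2
  rw [h4] at this
  exact factorial_half_sq_ne (by omega) this

end GaussSumSign

lemma IsPrimitiveRoot.prod_pow_sub_pow_sq {p : ℕ} (hp : p % 4 = 3) {ζ : ℂ}
    (hζ : IsPrimitiveRoot ζ p) :
    (∏ k ∈ Finset.range (p / 2), (ζ ^ (k + 1) - ζ ^ (p - (k + 1)))) ^ 2 = -p := by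
  have hn : p = p / 2 + p / 2 + 1 := by omega
  have hη : IsPrimitiveRoot (ζ ^ 2) (p / 2 + p / 2 + 1) := by
    rw [← hn]
    exact hζ.pow_of_coprime 2 (Nat.coprime_two_left.2 (Nat.odd_iff.2 (by omega)))
  have h1 := hη.prod_one_sub_pow_eq_order
  rw [Finset.prod_range_add, ← Finset.prod_range_reflect (fun k => 1 - (ζ ^ 2) ^ (p / 2 + k + 1)),
    ← Finset.prod_mul_distrib] at h1
  have h2 : (p : ℂ) = ((p / 2 + p / 2 : ℕ) : ℂ) + 1 := by exact_mod_cast hn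
  rw [h2, ← h1, ← Finset.prod_pow]
  calc _ = ∏ k ∈ Finset.range (p / 2), (-1) * ((1 - (ζ ^ 2) ^ (k + 1)) *
        (1 - (ζ ^ 2) ^ (p / 2 + (p / 2 - 1 - k) + 1))) := by
        refine Finset.prod_congr rfl fun k hk => ?_
        have hk := Finset.mem_range.1 hk
        have e1 : ζ ^ (k + 1) * ζ ^ (p - (k + 1)) = 1 := by
          rw [← pow_add, Nat.add_sub_cancel' (by omega), hζ.pow_eq_one]
        have e2 : p / 2 + (p / 2 - 1 - k) + 1 = p - (k + 1) := by omega
        rw [e2, ← pow_mul, ← pow_mul, mul_comm 2, mul_comm 2, pow_mul, pow_mul]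
        generalize ζ ^ (k + 1) = a at *
        generalize ζ ^ (p - (k + 1)) = b at *
        linear_combination (a * b - 1) * e1
    _ = _ := by
        rw [Finset.prod_mul_distrib, Finset.prod_const, Finset.card_range,
          Odd.neg_one_pow (Nat.odd_iff.2 (by omega)), neg_one_mul]

lemma prod_pow_sub_pow_eq {p : ℕ} (hp : p % 8 = 7) :
    ∃ s : ℝ, 0 < s ∧ ∏ k ∈ Finset.range (p / 2), (exp (2 * Real.pi * I / p) ^ (k + 1) -
      exp (2 * Real.pi * I / p) ^ (p - (k + 1))) = -(I * s) := by
  have hp0 : (0 : ℝ) < p := by exact_mod_cast (by omega : 0 < p)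
  have hp0' : (p : ℂ) ≠ 0 := by exact_mod_cast hp0.ne'
  refine ⟨∏ k ∈ Finset.range (p / 2), (2 * Real.sin (2 * Real.pi * (k + 1) / p)),
    Finset.prod_pos fun k hk => ?_, ?_⟩
  · have hk := Finset.mem_range.1 hk
    have hk' : 2 * ((k : ℝ) + 1) < p := by exact_mod_cast (by omega : 2 * (k + 1) < p)
    refine mul_pos two_pos (Real.sin_pos_of_pos_of_lt_pi (by positivity) ?_)
    rw [div_lt_iff₀ hp0]
    nlinarith [Real.pi_pos]
  · have hI : I ^ (p / 2) = -I := by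
      have : p / 2 = 4 * (p / 2 / 4) + 3 := by omega
      rw [this, pow_add, pow_mul, I_pow_four, one_pow, one_mul, I_pow_three]
    rw [ofReal_prod, ← neg_mul, ← hI]
    conv_rhs => rw [← Finset.card_range (p / 2), ← Finset.prod_const]
    rw [Finset.card_range, ← Finset.prod_mul_distrib]
    refine Finset.prod_congr rfl fun k hk => ?_
    have hk := Finset.mem_range.1 hk
    have e : exp (2 * Real.pi * I / p) ^ (p - (k + 1)) =
        exp (-((2 * Real.pi * (k + 1) / p : ℝ) : ℂ) * I) := by
      rw [← exp_nat_mul, exp_eq_exp_iff_exists_int]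
      refine ⟨1, ?_⟩
      rw [Nat.cast_sub (by omega)]
      push_cast
      field_simp
      ring
    have e' : exp (2 * Real.pi * I / p) ^ (k + 1) =
        exp (((2 * Real.pi * (k + 1) / p : ℝ) : ℂ) * I) := by
      rw [← exp_nat_mul]
      congr 1
      push_cast
      ring
    rw [e, e', ofReal_mul, ofReal_sin, ofReal_ofNat, two_sin]
    linear_combination (exp (((2 * Real.pi * (k + 1) / p : ℝ) : ℂ) * I) -
        exp (-((2 * Real.pi * (k + 1) / p : ℝ) : ℂ) * I)) * I_sq

namespace DirichletCharacter

lemma quadratic_isQuadratic (p : ℕ) [Fact p.Prime] : (quadratic p).IsQuadratic :=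
  (quadraticChar_isQuadratic (ZMod p)).comp _

lemma quadratic_odd {p : ℕ} [Fact p.Prime] (hp : p % 4 = 3) : (quadratic p).Odd := by
  rw [Odd, quadratic, MulChar.ringHomComp_apply,
    quadraticChar_neg_one (by rw [ZMod.ringChar_zmod_n]; omega), ZMod.card,
    ZMod.χ₄_nat_three_mod_four hp]
  simp

/-- The sign of the quadratic Gauss sum. -/
lemma gaussSum_quadratic {p : ℕ} [Fact p.Prime] (hp : p % 8 = 7) :
    gaussSum (quadratic p) ZMod.stdAddChar = I * (√p : ℝ) := by
  have hζ := isPrimitiveRoot_exp p (by omega)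
  have h1 : gaussSum (quadratic p) ZMod.stdAddChar ^ 2 = -p := by
    rw [gaussSum_sq (χ := quadratic p) (quadratic_ne_one (by omega)) (quadratic_isQuadratic p)
      (ZMod.isPrimitive_stdAddChar p), quadratic_odd (by omega), ZMod.card, neg_one_mul]
  have h2 := hζ.prod_pow_sub_pow_sq (by omega)
  obtain ⟨s, hs, h3⟩ := prod_pow_sub_pow_eq hp
  have h4 : gaussSum (quadratic p) ZMod.stdAddChar ≠
      ∏ k ∈ Finset.range (p / 2), (exp (2 * Real.pi * I / p) ^ (k + 1) -
        exp (2 * Real.pi * I / p) ^ (p - (k + 1))) := fun h => by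
    refine not_cyclotomic_dvd hp ?_
    rw [Polynomial.cyclotomic_eq_minpoly hζ (by omega)]
    refine minpoly.isIntegrallyClosed_dvd (hζ.isIntegral (by omega)) ?_
    rw [map_sub, sub_eq_zero, map_prod, map_sum]
    simp only [map_sub, map_mul, map_pow, Polynomial.aeval_X, Polynomial.aeval_C]
    rw [← h, gaussSum]
    refine Finset.sum_congr rfl fun x _ => ?_
    rw [ZMod.stdAddChar_apply, ZMod.toCircle_apply, ← exp_nat_mul]
    congr 1
    congr 1
    ring
  rw [h3] at h2 h4
  have h5 : s = √p := by
    rw [eq_comm, Real.sqrt_eq_iff_mul_self_eq_of_pos hs]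
    have : ((s : ℂ)) * s = p := by linear_combination -h2 + s ^ 2 * I_sq
    exact_mod_cast this
  rcases sq_eq_sq_iff_eq_or_eq_neg.1 (h1.trans h2.symm) with h | h
  · exact absurd h h4
  · rw [h, neg_neg, h5]

end DirichletCharacter

namespace DirichletCharacter

lemma isPrimitive_of_prime {p : ℕ} [Fact p.Prime] {χ : DirichletCharacter ℂ p} (hχ : χ ≠ 1) :
    χ.IsPrimitive := by
  rw [isPrimitive_def]
  exact ((Nat.dvd_prime Fact.out).1 χ.conductor_dvd_level).resolve_left fun h =>
    hχ (eq_one_iff_conductor_eq_one.2 h)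

end DirichletCharacter

section QuarterSum

variable {p : ℕ} [Fact p.Prime]

local notation "𝔮" => quadraticChar (ZMod p)

lemma quadraticChar_two_eq_one (hp : p % 8 = 7) : 𝔮 2 = 1 := by
  rw [quadraticChar_two (by rw [ZMod.ringChar_zmod_n]; omega), ZMod.card,
    ZMod.χ₈_nat_eq_if_mod_eight]
  simp [hp]
  omega

lemma quadraticChar_neg_eq_neg (hp : p % 4 = 3) (a : ZMod p) : 𝔮 (-a) = -𝔮 a := by
  rw [← neg_one_mul, map_mul, quadraticChar_neg_one (by rw [ZMod.ringChar_zmod_n]; omega),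
    ZMod.card, ZMod.χ₄_nat_three_mod_four hp, neg_one_mul]

lemma mul_sum_quadraticChar_mul_div {k : ℕ} (hk : 𝔮 k = 1) :
    p * ∑ a : ZMod p, 𝔮 a * ((k * a.val / p : ℕ) : ℤ) = (k - 1) * ∑ a : ZMod p, 𝔮 a * a.val := by
  have hk0 : (k : ZMod p) ≠ 0 := fun h => by simp [h] at hk
  have h := Equiv.sum_comp (Equiv.mulLeft₀ (k : ZMod p) hk0) fun a => 𝔮 a * (a.val : ℤ)
  have h2 (a : ZMod p) :
      (((k : ZMod p) * a).val : ℤ) = k * a.val - p * ((k * a.val / p : ℕ) : ℤ) := by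
    conv_lhs => rw [← ZMod.natCast_zmod_val a, ← Nat.cast_mul, ZMod.val_natCast]
    rw [eq_sub_iff_add_eq]
    exact_mod_cast Nat.mod_add_div _ _
  simp only [Equiv.mulLeft₀_apply, map_mul, hk, one_mul, h2] at h
  rw [sub_mul, one_mul]
  nth_rewrite 2 [← h]
  rw [Finset.mul_sum, Finset.mul_sum, ← Finset.sum_sub_distrib]
  exact Finset.sum_congr rfl fun a _ => by ring

/-- The sum of the quadratic character over the first quarter of the residues. -/
lemma mul_quarter_sum_quadraticChar (hp : p % 8 = 7) :
    p * ∑ a : ZMod p, (if 4 * a.val < p then 𝔮 a else 0) = -∑ a : ZMod p, 𝔮 a * a.val := by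
  have h2 := quadraticChar_two_eq_one hp
  have h4 : 𝔮 ((4 : ℕ) : ZMod p) = 1 := by
    rw [show ((4 : ℕ) : ZMod p) = 2 * 2 by norm_num, map_mul, h2, one_mul]
  have e2 := mul_sum_quadraticChar_mul_div (p := p) (k := 2) (by exact_mod_cast h2)
  have e4 := mul_sum_quadraticChar_mul_div h4
  have h0 : ∑ a : ZMod p, 𝔮 a = 0 := quadraticChar_sum_zero (by rw [ZMod.ringChar_zmod_n]; omega)
  have h5 : ∑ a : ZMod p, (if 4 * (-a).val < p then 𝔮 a else 0) =
      -∑ a : ZMod p, (if 4 * a.val < p then 𝔮 a else 0) := by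
    rw [← Equiv.sum_comp (Equiv.neg (ZMod p)), ← Finset.sum_neg_distrib]
    refine Finset.sum_congr rfl fun a _ => ?_
    simp only [Equiv.neg_apply, neg_neg, quadraticChar_neg_eq_neg (p := p) (by omega)]
    split_ifs <;> simp
  have h6 (a : ZMod p) : 𝔮 a * ((4 * a.val / p : ℕ) : ℤ) = 𝔮 a * ((2 * a.val / p : ℕ) : ℤ) + 𝔮 a -
      (if 4 * a.val < p then 𝔮 a else 0) + (if 4 * (-a).val < p then 𝔮 a else 0) := by
    rcases eq_or_ne a 0 with rfl | ha
    · simp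
    have hv := a.val_lt
    have hv0 := ZMod.val_pos.2 ha
    have : NeZero a := ⟨ha⟩
    rw [ZMod.val_neg_of_ne_zero]
    have hd (m r : ℕ) (h1 : r * p ≤ m) (h2 : m < (r + 1) * p) : m / p = r :=
      Nat.div_eq_of_lt_le h1 h2
    rcases lt_or_ge (4 * a.val) p with c1 | c1
    · rw [if_pos c1, if_neg (by omega), hd _ 0 (by omega) (by omega), hd _ 0 (by omega) (by omega)]
      ring
    rcases lt_or_ge (2 * a.val) p with c2 | c2
    · rw [if_neg (by omega), if_neg (by omega), hd _ 1 (by omega) (by omega),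
        hd _ 0 (by omega) (by omega)]
      ring
    rcases lt_or_ge (4 * a.val) (3 * p) with c3 | c3
    · rw [if_neg (by omega), if_neg (by omega), hd _ 2 (by omega) (by omega),
        hd _ 1 (by omega) (by omega)]
      ring
    · rw [if_neg (by omega), if_pos (by omega), hd _ 3 (by omega) (by omega),
        hd _ 1 (by omega) (by omega)]
      ring
  simp only [h6, Finset.sum_add_distrib, Finset.sum_sub_distrib, h5, h0] at e4
  push_cast at e2 e4
  linarith

lemma quarter_sum_quadraticChar_eq (hp : p % 8 = 7) :
    ∑ a : ZMod p, (if 4 * a.val < p then 𝔮 a else 0) =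
      ((p - 1) / 4 : ℕ) - 2 * (Ncount p 4 : ℤ) := by
  classical
  have h1 : ∑ a : ZMod p, (if 4 * a.val < p then 𝔮 a else 0) =
      ∑ k ∈ Finset.Icc 1 ((p - 1) / 4), 𝔮 ((4 * k : ℕ) : ZMod p) := by
    rw [← Finset.sum_filter, ← Finset.sum_erase (a := 0) _ (by simp)]
    refine Finset.sum_nbij' ZMod.val Nat.cast ?_ ?_ ?_ ?_ ?_
    · intro a ha
      simp only [Finset.mem_erase, Finset.mem_filter, Finset.mem_univ, true_and] at ha
      have := ZMod.val_pos.2 ha.1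
      rw [Finset.mem_Icc]
      omega
    · intro k hk
      rw [Finset.mem_Icc] at hk
      have : (k : ZMod p).val = k := ZMod.val_cast_of_lt (by omega)
      simp only [Finset.mem_erase, Finset.mem_filter, Finset.mem_univ, true_and, this]
      refine ⟨fun h => ?_, by omega⟩
      rw [h, ZMod.val_zero] at this
      omega
    · exact fun a _ => ZMod.natCast_zmod_val a
    · intro k hk
      rw [Finset.mem_Icc] at hk
      exact ZMod.val_cast_of_lt (by omega)
    · intro a _
      rw [Nat.cast_mul, map_mul, ZMod.natCast_zmod_val,
        show ((4 : ℕ) : ZMod p) = 2 * 2 by norm_num, map_mul, quadraticChar_two_eq_one hp,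
        one_mul, one_mul]
  have h2 : Ncount p 4 = ((Finset.Icc 1 ((p - 1) / 4)).filter fun k => ¬ IsQR p (4 * k)).card := by
    rw [Ncount]
    refine Finset.card_nbij' (· / 4) (4 * ·) ?_ ?_ ?_ ?_
    · rintro a ha
      simp only [Finset.coe_filter, Finset.mem_Icc, Set.mem_ofPred_eq] at ha ⊢
      obtain ⟨ha, ⟨b, rfl⟩, hb⟩ := ha
      rw [Nat.mul_div_cancel_left b four_pos]
      exact ⟨by omega, hb⟩
    · rintro a ha
      simp only [Finset.coe_filter, Finset.mem_Icc, Set.mem_ofPred_eq] at ha ⊢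
      exact ⟨by omega, ⟨a, rfl⟩, ha.2⟩
    · rintro a ha
      simp only [Finset.coe_filter, Finset.mem_Icc, Set.mem_ofPred_eq] at ha
      exact Nat.mul_div_cancel' ha.2.1
    · exact fun a _ => Nat.mul_div_cancel_left a four_pos
  have h3 : ∀ k ∈ Finset.Icc 1 ((p - 1) / 4), 𝔮 ((4 * k : ℕ) : ZMod p) =
      1 - 2 * (if ¬ IsQR p (4 * k) then 1 else 0) := by
    intro k hk
    rw [Finset.mem_Icc] at hk
    have hk0 : ((4 * k : ℕ) : ZMod p) ≠ 0 := by
      rw [ne_eq, ZMod.natCast_eq_zero_iff]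
      exact fun h => absurd (Nat.le_of_dvd (by omega) h) (by omega)
    have hiff : IsQR p (4 * k) ↔ IsSquare ((4 * k : ℕ) : ZMod p) := by
      constructor
      · rintro ⟨x, hx⟩
        refine ⟨x, ?_⟩
        rw [← ZMod.intCast_eq_intCast_iff] at hx
        push_cast at hx ⊢
        rw [← hx, sq]
      · rintro ⟨x, hx⟩
        refine ⟨x.val, ?_⟩
        rw [← ZMod.intCast_eq_intCast_iff]
        push_cast at hx ⊢
        rw [ZMod.natCast_zmod_val, hx, sq]
    by_cases h : IsSquare ((4 * k : ℕ) : ZMod p)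
    · rw [(quadraticChar_one_iff_isSquare hk0).2 h, if_neg (not_not.2 (hiff.2 h))]
      norm_num
    · rw [quadraticChar_neg_one_iff_not_isSquare.2 h, if_pos (hiff.not.2 h)]
      norm_num
  rw [h1, h2, Finset.sum_congr rfl h3, Finset.sum_sub_distrib, ← Finset.mul_sum, Finset.sum_boole]
  simp

/-- The excess of residues among the multiples of `4` as a value of an `L`-function. -/
lemma half_sub_Ncount_eq (hp : p % 8 = 7) :
    (((p - 1) / 4 : ℕ) : ℝ) / 2 - (Ncount p 4 : ℝ) =
      √p / (2 * Real.pi) * ((DirichletCharacter.quadratic p).LFunction 1).re := by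
  have hp0 : (p : ℂ) ≠ 0 := by exact_mod_cast (Fact.out : p.Prime).ne_zero
  have h1 := DirichletCharacter.quadratic_ne_one (p := p) (by omega)
  have key := DirichletCharacter.gaussSum_mul_LFunction_inv_of_odd h1
    (DirichletCharacter.isPrimitive_of_prime h1) (DirichletCharacter.quadratic_odd (by omega))
  rw [(DirichletCharacter.quadratic_isQuadratic p).inv, DirichletCharacter.gaussSum_quadratic hp]
    at key
  have h2 : ∑ a : ZMod p, DirichletCharacter.quadratic p a * a.val =
      -(p * (((p - 1) / 4 : ℕ) - 2 * (Ncount p 4 : ℂ))) := by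
    have := (mul_quarter_sum_quadraticChar hp).symm
    rw [quarter_sum_quadraticChar_eq hp, neg_eq_iff_eq_neg] at this
    generalize (p - 1) / 4 = m at this ⊢
    have := congrArg (Int.cast (R := ℂ)) this
    push_cast at this
    rw [← this]
    rfl
  rw [h2] at key
  have h3 : ((√p : ℝ) : ℂ) * (DirichletCharacter.quadratic p).LFunction 1 =
      (Real.pi * (((p - 1) / 4 : ℕ) - 2 * (Ncount p 4 : ℝ)) : ℝ) := by
    refine mul_left_cancel₀ I_ne_zero ?_
    rw [← mul_assoc, key]
    push_cast
    field_simp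
  have h4 := congrArg re h3
  rw [re_ofReal_mul, ofReal_re] at h4
  field_simp
  linarith

end QuarterSum

end

theorem stmt13 (ε : ℝ) (hε0 : 0 < ε) (hε : ε < 1 / 2) :
    ∃ C : ℝ, 0 < C ∧ ∀ p : ℕ, p.Prime → p % 8 = 7 →
      (((p - 1) / 4 : ℕ) : ℝ) / 2 - (Ncount p 4 : ℝ) ≥ C * (p : ℝ) ^ ((1 : ℝ) / 2 - ε) := by
  obtain ⟨C, hC, h⟩ := DirichletCharacter.exists_le_LFunction_quadratic_one hε0 (by linarith)
  refine ⟨C / (2 * Real.pi), by positivity, fun p hp hp8 => ?_⟩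
  have : Fact p.Prime := ⟨hp⟩
  have hp0 : (0 : ℝ) < p := by exact_mod_cast hp.pos
  rw [half_sub_Ncount_eq hp8, sub_eq_add_neg, Real.rpow_add hp0, ← Real.sqrt_eq_rpow]
  calc _ = √p / (2 * Real.pi) * (C * (p : ℝ) ^ (-ε)) := by ring
    _ ≤ _ := by
      gcongr
      exact h p (by omega)
end
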